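/- Let p ∈ (1,2], h ≥ 0 and d ∈ ℕ. There exists a constant C = C(p,h,d) > 0 such that for every incompressible sequence Λ = (μ_n)_{n∈ℤ} of density d lying in the strip Π_h and every g ∈ L^p[0,1], one has the weighted Hardy–Littlewood type inequality ∑_{n∈ℤ} (1+|n|)^{p−2} (𝓕[g](μ_n))^{p} ≤ C · ‖g‖_{L^p[0,1]}^{p}. -/

import Mathlib

open MeasureTheory

/-- A sequence `Λ : ℤ → ℂ` is *incompressible of density `d`* if every vertical
strip `[t-1, t+1] × ℝ` contains at most `d` entries of the sequence. -/
def Incompressible (d : ℕ) (Λ : ℤ → ℂ) : Prop :=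
  ∀ t : ℝ, {n : ℤ | |(Λ n).re - t| ≤ 1}.encard ≤ (d : ℕ∞)

/-- The "maximal" Fourier transform `𝓕[g](λ) = sup_{x ∈ [0,1]} |∫₀ˣ g(t) e^{iλt} dt|`. -/
noncomputable def maxFourier (g : ℝ → ℂ) (lam : ℂ) : ℝ :=
  ⨆ x : Set.Icc (0:ℝ) 1, ‖∫ t in (0:ℝ)..(x : ℝ), g t * Complex.exp (Complex.I * lam * t)‖

/-- The `L^p`-norm of `g` on `[0,1]`. -/
noncomputable def lpNorm01 (p : ℝ) (g : ℝ → ℂ) : ℝ :=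
  (∫ t in (0:ℝ)..1, ‖g t‖ ^ p) ^ (1 / p)

namespace MaxFourier

set_option linter.unusedSectionVars false

/-- Integer length of a grid interval of scale `i`. -/
def sc (l0 i : ℕ) : ℤ := l0 * 8 ^ i

/-- Real length of a grid interval of scale `i`. -/
noncomputable def len (l0 i : ℕ) : ℝ := l0 * 8 ^ i

/-- The weight adapted to the grid interval `[a l, (a + 1) l)`. -/
noncomputable def wt (l : ℝ) (a x : ℤ) : ℝ := (1 + |(x : ℝ) / l - a|)⁻¹

/-- A tile: the product of a grid interval in space and one in frequency. -/
@[ext] structure Tile where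
  /-- scale -/
  i : ℕ
  /-- space index -/
  a : ℤ
  /-- frequency index -/
  b : ℤ

noncomputable instance : DecidableEq Tile := Classical.decEq _

section basic
variable {l0 : ℕ}

lemma sc_cast (i : ℕ) : ((sc l0 i : ℤ) : ℝ) = len l0 i := by simp [sc, len]

lemma sc_add (i d : ℕ) : sc l0 (i + d) = sc l0 i * 8 ^ d := by simp [sc, pow_add]; ring

lemma len_add (i d : ℕ) : len l0 (i + d) = 8 ^ d * len l0 i := by simp [len, pow_add]; ring

lemma len_succ (i : ℕ) : len l0 (i + 1) = 8 * len l0 i := by simpa using len_add (l0 := l0) i 1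

lemma wt_pos (l : ℝ) (a x : ℤ) : 0 < wt l a x := by unfold wt; positivity

lemma wt_nonneg (l : ℝ) (a x : ℤ) : 0 ≤ wt l a x := (wt_pos l a x).le

lemma wt_le_one (l : ℝ) (a x : ℤ) : wt l a x ≤ 1 := by
  unfold wt; exact inv_le_one_of_one_le₀ (by linarith [abs_nonneg ((x : ℝ) / l - a)])

lemma wt_pow_anti (l : ℝ) (a x : ℤ) {m n : ℕ} (h : m ≤ n) : wt l a x ^ n ≤ wt l a x ^ m :=
  pow_le_pow_of_le_one (wt_nonneg l a x) (wt_le_one l a x) h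

variable [NeZero l0]

lemma sc_pos (i : ℕ) : 0 < sc l0 i := by
  have := Nat.pos_of_ne_zero (NeZero.ne l0)
  unfold sc; positivity

lemma len_pos (i : ℕ) : 0 < len l0 i := by
  have := Nat.pos_of_ne_zero (NeZero.ne l0)
  unfold len; positivity

lemma one_le_len (i : ℕ) : 1 ≤ len l0 i := by
  rw [← sc_cast]; exact_mod_cast sc_pos i

lemma len_mono {i j : ℕ} (h : i ≤ j) : len l0 i ≤ len l0 j := by
  obtain ⟨d, rfl⟩ := Nat.exists_eq_add_of_le h
  rw [len_add]
  exact le_mul_of_one_le_left (len_pos i).le (one_le_pow₀ (by norm_num))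

lemma ediv_sc_add (x : ℤ) (i d : ℕ) : x / sc l0 (i + d) = x / sc l0 i / 8 ^ d := by
  rw [sc_add, Int.ediv_ediv_of_nonneg (sc_pos i).le]

lemma ediv_sc_le {i j : ℕ} (h : i ≤ j) (x : ℤ) : x / sc l0 j = x / sc l0 i / 8 ^ (j - i) := by
  rw [← ediv_sc_add, Nat.add_sub_cancel' h]

lemma floor_len_add (ξ : ℝ) (i d : ℕ) :
    ⌊len l0 i * ξ⌋ = ⌊len l0 (i + d) * ξ⌋ / 8 ^ d := by
  have h := Int.floor_div_natCast (len l0 (i + d) * ξ) (8 ^ d)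
  push_cast at h
  rw [← h, len_add]
  congr 1
  field_simp

lemma floor_len_le {i j : ℕ} (h : i ≤ j) (ξ : ℝ) :
    ⌊len l0 i * ξ⌋ = ⌊len l0 j * ξ⌋ / 8 ^ (j - i) := by
  rw [floor_len_add ξ i (j - i), Nat.add_sub_cancel' h]

lemma mem_cell_iff {x q : ℤ} (i : ℕ) :
    x / sc l0 i = q ↔ q * len l0 i ≤ x ∧ (x : ℝ) < (q + 1) * len l0 i := by
  rw [← sc_cast, Int.ediv_eq_iff_of_pos (sc_pos i)]
  constructor
  · rintro ⟨h1, h2⟩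
    exact ⟨by exact_mod_cast h1, by have : x < (q + 1) * sc l0 i := by linarith
                                    exact_mod_cast this⟩
  · rintro ⟨h1, h2⟩
    have h1' : q * sc l0 i ≤ x := by exact_mod_cast h1
    have h2' : x < (q + 1) * sc l0 i := by exact_mod_cast h2
    exact ⟨by linarith, by linarith⟩

end basic

lemma sum_telescope_le {l : ℝ} (hl : 1 ≤ l) (n : ℕ) :
    ∑ m ∈ Finset.range n, ((1 + (m : ℝ) / l)⁻¹) ^ 2 ≤ 2 * l := by
  have key : ∑ m ∈ Finset.range n, ((1 + (m : ℝ) / l)⁻¹) ^ 2 ≤ 2 * l - 2 * l ^ 2 / (l + n) := by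
    induction n with
    | zero => simp; field_simp; simp
    | succ k ih =>
      rw [Finset.sum_range_succ]
      have e : ((1 + (k : ℝ) / l)⁻¹) ^ 2 = l ^ 2 / (l + k) ^ 2 := by field_simp
      have hk : (0 : ℝ) ≤ k := Nat.cast_nonneg k
      have h2 : l ^ 2 / (l + k) ^ 2 ≤ 2 * l ^ 2 / (l + k) - 2 * l ^ 2 / (l + (k + 1)) := by
        rw [div_sub_div _ _ (by positivity) (by positivity), div_le_div_iff₀ (by positivity) (by positivity)]
        have : 2 * l ^ 2 * (l + (↑k + 1)) - (l + ↑k) * (2 * l ^ 2) = 2 * l ^ 2 := by ring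
        rw [this]
        have h3 : (l + k) * (l + (k + 1)) ≤ 2 * (l + k) ^ 2 := by nlinarith
        nlinarith [sq_nonneg l, mul_le_mul_of_nonneg_left h3 (sq_nonneg l)]
      push_cast
      rw [e]; linarith
  have : 0 ≤ 2 * l ^ 2 / (l + n) := by positivity
  linarith

lemma sum_inv_sq_le {l : ℝ} (hl : 1 ≤ l) (c : ℝ) (X : Finset ℤ) :
    ∑ x ∈ X, ((1 + |(x : ℝ) / l - c|)⁻¹) ^ 2 ≤ 4 * l := by
  classical
  have hl0 : 0 < l := by linarith
  have half : ∀ (Y : Finset ℤ) (g : ℤ → ℕ), Set.InjOn g Y →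
      (∀ y ∈ Y, (g y : ℝ) / l ≤ |(y : ℝ) / l - c|) →
      ∑ x ∈ Y, ((1 + |(x : ℝ) / l - c|)⁻¹) ^ 2 ≤ 2 * l := by
    intro Y g hg hY
    calc ∑ x ∈ Y, ((1 + |(x : ℝ) / l - c|)⁻¹) ^ 2
        ≤ ∑ x ∈ Y, ((1 + (g x : ℝ) / l)⁻¹) ^ 2 := by
          refine Finset.sum_le_sum fun x hx => ?_
          have := hY x hx
          gcongr
      _ = ∑ m ∈ Y.image g, ((1 + (m : ℝ) / l)⁻¹) ^ 2 := by
          rw [Finset.sum_image hg]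
      _ ≤ ∑ m ∈ Finset.range ((Y.image g).sup id + 1), ((1 + (m : ℝ) / l)⁻¹) ^ 2 := by
          refine Finset.sum_le_sum_of_subset_of_nonneg ?_ fun _ _ _ => by positivity
          intro m hm
          exact Finset.mem_range.2 (Nat.lt_succ_of_le (Finset.le_sup (f := id) hm))
      _ ≤ 2 * l := sum_telescope_le hl _
  have e : ∀ y : ℤ, (y : ℝ) / l - c = (y - c * l) / l := fun y => by field_simp
  rw [← Finset.sum_filter_add_sum_filter_not X (fun x => ⌈c * l⌉ ≤ x)]
  have h1 := half (X.filter (fun x => ⌈c * l⌉ ≤ x)) (fun x => (x - ⌈c * l⌉).toNat) (by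
    intro x hx y hy hxy
    simp at hx hy hxy
    omega) (by
    intro y hy
    simp only [Finset.mem_filter] at hy
    rw [e, abs_div, abs_of_pos hl0]
    gcongr
    have h0 : (((y - ⌈c * l⌉).toNat : ℤ) : ℝ) = y - ⌈c * l⌉ := by
      rw [Int.toNat_of_nonneg (by omega)]; push_cast; rfl
    have h1 := Int.le_ceil (c * l)
    have h2 := le_abs_self ((y : ℝ) - c * l)
    push_cast at h0
    linarith)
  have h2 := half (X.filter (fun x => ¬ ⌈c * l⌉ ≤ x)) (fun x => (⌈c * l⌉ - 1 - x).toNat) (by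
    intro x hx y hy hxy
    simp at hx hy hxy
    omega) (by
    intro y hy
    simp only [Finset.mem_filter] at hy
    rw [e, abs_div, abs_of_pos hl0]
    gcongr
    have h0 : (((⌈c * l⌉ - 1 - y).toNat : ℤ) : ℝ) = ⌈c * l⌉ - 1 - y := by
      rw [Int.toNat_of_nonneg (by omega)]; push_cast; rfl
    have h1 := Int.ceil_lt_add_one (c * l)
    have h2 := neg_abs_le ((y : ℝ) - c * l)
    push_cast at h0
    linarith)
  linarith

lemma sum_wt_sq_le {l : ℝ} (hl : 1 ≤ l) (a : ℤ) (X : Finset ℤ) :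
    ∑ x ∈ X, wt l a x ^ 2 ≤ 4 * l := sum_inv_sq_le hl a X

lemma sum_wt_sq_le' (l : ℝ) (x : ℤ) (A : Finset ℤ) :
    ∑ a ∈ A, wt l a x ^ 2 ≤ 4 := by
  have := sum_inv_sq_le le_rfl ((x : ℝ) / l) A
  simp only [div_one, mul_one] at this
  simpa [wt, abs_sub_comm] using this

lemma sum_wt_pow_le {l : ℝ} (hl : 1 ≤ l) (a : ℤ) (X : Finset ℤ) {n : ℕ} (hn : 2 ≤ n) :
    ∑ x ∈ X, wt l a x ^ n ≤ 4 * l :=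
  (Finset.sum_le_sum fun _ _ => wt_pow_anti _ _ _ hn).trans (sum_wt_sq_le hl a X)

lemma summable_wt_pow {l : ℝ} (hl : 1 ≤ l) (a : ℤ) {n : ℕ} (hn : 2 ≤ n) :
    Summable fun x => wt l a x ^ n :=
  summable_of_sum_le (fun _ => pow_nonneg (wt_nonneg _ _ _) _) fun X => sum_wt_pow_le hl a X hn

section grid
variable {l0 : ℕ} [NeZero l0]

lemma ediv_pow_bounds (a : ℤ) (d : ℕ) :
    (a / 8 ^ d) * (8 : ℤ) ^ d ≤ a ∧ a + 1 ≤ (a / 8 ^ d + 1) * (8 : ℤ) ^ d := by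
  have h8 : (0 : ℤ) < 8 ^ d := by positivity
  have h1 := Int.mul_ediv_add_emod a (8 ^ d)
  have h2 := Int.emod_nonneg a h8.ne'
  have h3 := Int.emod_lt_of_pos a h8
  constructor <;> linarith

/-- An interval is contained in its ancestors. -/
lemma anc_bounds {i j : ℕ} (h : i ≤ j) (a : ℤ) :
    ((a / 8 ^ (j - i) : ℤ) : ℝ) * len l0 j ≤ a * len l0 i ∧
      ((a : ℝ) + 1) * len l0 i ≤ (((a / 8 ^ (j - i) : ℤ) : ℝ) + 1) * len l0 j := by
  obtain ⟨d, rfl⟩ := Nat.exists_eq_add_of_le h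
  rw [Nat.add_sub_cancel_left, len_add]
  obtain ⟨h1, h2⟩ := ediv_pow_bounds a d
  have h1' : ((a / 8 ^ d : ℤ) : ℝ) * 8 ^ d ≤ a := by exact_mod_cast h1
  have h2' : (a : ℝ) + 1 ≤ (((a / 8 ^ d : ℤ) : ℝ) + 1) * 8 ^ d := by exact_mod_cast h2
  have := (len_pos (l0 := l0) i).le
  constructor
  · calc _ = ((a / 8 ^ d : ℤ) : ℝ) * 8 ^ d * len l0 i := by ring
      _ ≤ _ := by gcongr
  · calc _ ≤ (((a / 8 ^ d : ℤ) : ℝ) + 1) * 8 ^ d * len l0 i := by gcongr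
      _ = _ := by ring

lemma wt_eq (i : ℕ) (a x : ℤ) :
    wt (len l0 i) a x = (1 + |(x : ℝ) - a * len l0 i| / len l0 i)⁻¹ := by
  unfold wt
  have := len_pos (l0 := l0) i
  rw [← abs_of_pos this, ← abs_div, abs_of_pos this]
  congr 3
  field_simp

lemma wt_le_anc {i j : ℕ} (h : i ≤ j) (a x : ℤ) :
    wt (len l0 i) a x ≤ 2 * wt (len l0 j) (a / 8 ^ (j - i)) x := by
  rw [wt_eq, wt_eq]
  have hi := len_pos (l0 := l0) i
  have hj := len_pos (l0 := l0) j
  have hij := len_mono (l0 := l0) h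
  obtain ⟨h1, h2⟩ := anc_bounds (l0 := l0) h a
  set a' := a / 8 ^ (j - i)
  have h3 : |(x : ℝ) - a' * len l0 j| ≤ |(x : ℝ) - a * len l0 i| + len l0 j := by
    have : (x : ℝ) - a' * len l0 j = (x - a * len l0 i) + (a * len l0 i - a' * len l0 j) := by ring
    rw [this]
    refine (abs_add_le _ _).trans ?_
    gcongr
    rw [abs_of_nonneg (by linarith)]; linarith
  have h4 : |(x : ℝ) - a' * len l0 j| / len l0 j ≤ |(x : ℝ) - a * len l0 i| / len l0 i + 1 := by
    calc _ ≤ (|(x : ℝ) - a * len l0 i| + len l0 j) / len l0 j := by gcongr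
      _ = |(x : ℝ) - a * len l0 i| / len l0 j + 1 := by field_simp
      _ ≤ _ := by gcongr
  rw [← one_div, ← one_div, mul_one_div, div_le_div_iff₀ (by positivity) (by positivity)]
  have : 0 ≤ |(x : ℝ) - a * len l0 i| / len l0 i := by positivity
  linarith

/-- Points of `[q l, (q + 1) l)` and of neighbouring cells have large weight. -/
lemma one_le_wt_of_near {i : ℕ} {a x : ℤ} (h : |a - x / sc l0 i| ≤ 1) :
    1 ≤ 3 * wt (len l0 i) a x := by
  have hi := len_pos (l0 := l0) i
  obtain ⟨h1, h2⟩ := (mem_cell_iff (l0 := l0) (x := x) i).1 rfl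
  set q := x / sc l0 i
  rw [← le_div_iff₀ hi] at h1
  rw [← div_lt_iff₀ hi] at h2
  have h3 : |(a : ℝ) - q| ≤ 1 := by exact_mod_cast h
  rw [abs_le] at h3
  have : |(x : ℝ) / len l0 i - a| ≤ 2 := by rw [abs_le]; constructor <;> linarith
  unfold wt
  rw [← one_div, mul_one_div, le_div_iff₀ (by positivity)]
  linarith

end grid

/-- A tile is valid when its frequency interval lies in `[0, 1)`. -/
def Tile.Valid (l0 : ℕ) (s : Tile) : Prop := 0 ≤ s.b ∧ s.b < sc l0 s.i

/-- The Gram matrix of a family of sequences. -/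
noncomputable def gram (φ : Tile → ℤ → ℂ) (s t : Tile) : ℂ :=
  ∑' x, starRingEnd ℂ (φ s x) * φ t x

/-- Wave packets adapted to tiles. -/
structure Packets (l0 : ℕ) (φ : Tile → ℤ → ℂ) (K : ℝ) : Prop where
  decay : ∀ s x, ‖φ s x‖ ≤ K / √(len l0 s.i) * wt (len l0 s.i) s.a x ^ 20
  orth_same : ∀ s t : Tile, s.Valid l0 → t.Valid l0 → s.i = t.i → s.b ≠ t.b → gram φ s t = 0
  orth : ∀ s t : Tile, s.Valid l0 → t.Valid l0 → t.i < s.i →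
    (s.b / 8 ^ (s.i - t.i) ≠ t.b ∨ s.b / 8 ^ (s.i - t.i - 1) = 8 * t.b + 7) → gram φ s t = 0
  repro : ∀ (k : ℕ) (ξ : ℝ), 0 ≤ ξ → ξ < 1 → ∃ L : ℤ → ℂ,
    (∀ z, ‖L z‖ ≤ K * ((len l0 k)⁻¹ * ((1 + |(z : ℝ)| / len l0 k)⁻¹) ^ 2)) ∧
    ∀ s : Tile, s.Valid l0 → ⌊len l0 s.i * ξ⌋ = s.b →
      (k ≤ s.i → ∀ x, HasSum (fun z => φ s z * L (x - z)) (φ s x)) ∧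
      (s.i < k → ⌊len l0 (s.i + 1) * ξ⌋ = 8 * s.b + 7 →
        ∀ x, HasSum (fun z => φ s z * L (x - z)) 0)

section gram
variable {l0 : ℕ} [NeZero l0] {φ : Tile → ℤ → ℂ} {K : ℝ}

lemma Packets.nonneg (h : Packets l0 φ K) : 0 ≤ K := by
  have h1 := (norm_nonneg _).trans (h.decay ⟨0, 0, 0⟩ 0)
  have h2 := pow_pos (wt_pos (len l0 0) 0 0) 20
  have h3 := Real.sqrt_pos.2 (len_pos (l0 := l0) 0)
  by_contra hK
  push Not at hK
  have : K / √(len l0 0) * wt (len l0 0) 0 0 ^ 20 < 0 :=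
    mul_neg_of_neg_of_pos (div_neg_of_neg_of_pos hK h3) h2
  exact absurd h1 (not_le.2 this)

lemma Packets.decay' (h : Packets l0 φ K) (s : Tile) (x : ℤ) {n : ℕ} (hn : n ≤ 20) :
    ‖φ s x‖ ≤ K / √(len l0 s.i) * wt (len l0 s.i) s.a x ^ n :=
  (h.decay s x).trans (mul_le_mul_of_nonneg_left (wt_pow_anti _ _ _ hn)
    (div_nonneg h.nonneg (Real.sqrt_nonneg _)))

/-- Product of two weights is controlled by the value of the larger weight at the smaller tile. -/
lemma wt_mul_wt_le {i j : ℕ} (hij : j ≤ i) (a a' x y : ℤ) (hy : y / sc l0 j = a') :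
    wt (len l0 i) a x * wt (len l0 j) a' x ≤ 2 * wt (len l0 i) a y := by
  have hi := len_pos (l0 := l0) i
  have hj := len_pos (l0 := l0) j
  have hl := len_mono (l0 := l0) hij
  obtain ⟨h1, h2⟩ := (mem_cell_iff (l0 := l0) j).1 hy
  rw [← le_div_iff₀ hj] at h1
  rw [← div_lt_iff₀ hj] at h2
  unfold wt
  rw [← mul_inv, ← one_div, ← one_div, mul_one_div, div_le_div_iff₀ (by positivity) (by positivity)]
  set A := |(x : ℝ) / len l0 i - a|
  set B := |(x : ℝ) / len l0 j - a'|
  have hA : 0 ≤ A := abs_nonneg _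
  have hB : 0 ≤ B := abs_nonneg _
  have hyx : |(y : ℝ) / len l0 i - x / len l0 i| ≤ B + 1 := by
    have e : (y : ℝ) / len l0 i - x / len l0 i = (len l0 j / len l0 i) * (y / len l0 j - x / len l0 j) := by
      field_simp
    rw [e, abs_mul, abs_of_pos (by positivity)]
    have h3 : len l0 j / len l0 i ≤ 1 := (div_le_one hi).2 hl
    have h4 : |(y : ℝ) / len l0 j - x / len l0 j| ≤ B + 1 := by
      have : (y : ℝ) / len l0 j - x / len l0 j = (y / len l0 j - a') - (x / len l0 j - a') := by ring
      rw [this]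
      refine (abs_sub _ _).trans ?_
      have : |(y : ℝ) / len l0 j - a'| ≤ 1 := by rw [abs_le]; constructor <;> linarith
      linarith
    calc _ ≤ 1 * |(y : ℝ) / len l0 j - x / len l0 j| := by gcongr
      _ ≤ _ := by linarith
  have h5 : |(y : ℝ) / len l0 i - a| ≤ A + (B + 1) := by
    have : (y : ℝ) / len l0 i - a = (x / len l0 i - a) + (y / len l0 i - x / len l0 i) := by ring
    rw [this]
    exact (abs_add_le _ _).trans (by gcongr)
  nlinarith [mul_nonneg hA hB]

lemma summable_gram (h : Packets l0 φ K) (s t : Tile) :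
    Summable fun x => ‖starRingEnd ℂ (φ s x) * φ t x‖ := by
  have hK := h.nonneg
  refine Summable.of_nonneg_of_le (fun _ => norm_nonneg _) (fun x => ?_)
    ((summable_wt_pow (one_le_len (l0 := l0) s.i) s.a (n := 20) (by norm_num)).mul_left
      (K / √(len l0 s.i) * (K / √(len l0 t.i))))
  rw [norm_mul, RCLike.norm_conj]
  have h1 := h.decay s x
  have h2 := h.decay' t x (n := 0) (by norm_num)
  simp only [pow_zero, mul_one] at h2
  calc _ ≤ (K / √(len l0 s.i) * wt (len l0 s.i) s.a x ^ 20) * (K / √(len l0 t.i)) := by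
        gcongr
    _ = _ := by ring

lemma norm_gram_comm (s t : Tile) : ‖gram φ s t‖ = ‖gram φ t s‖ := by
  rw [← RCLike.norm_conj (gram φ s t), gram, Complex.conj_tsum]
  congr 2
  simp [mul_comm]

lemma gram_le (h : Packets l0 φ K) (s t : Tile) (hts : t.i ≤ s.i) {y : ℤ}
    (hy : y / sc l0 t.i = t.a) :
    ‖gram φ s t‖ ≤ 2 ^ 20 * K ^ 2 * (√(len l0 t.i) / √(len l0 s.i)) *
      wt (len l0 s.i) s.a y ^ 18 := by
  have hK := h.nonneg
  have hs := Real.sqrt_pos.2 (len_pos (l0 := l0) s.i)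
  have ht := Real.sqrt_pos.2 (len_pos (l0 := l0) t.i)
  refine (norm_tsum_le_tsum_norm (summable_gram h s t)).trans ?_
  refine Real.tsum_le_of_sum_le (fun _ => norm_nonneg _) fun X => ?_
  calc ∑ x ∈ X, ‖starRingEnd ℂ (φ s x) * φ t x‖
      ≤ ∑ x ∈ X, (K / √(len l0 s.i) * (K / √(len l0 t.i)) * (2 ^ 18 * wt (len l0 s.i) s.a y ^ 18)) *
          wt (len l0 t.i) t.a x ^ 2 := by
        refine Finset.sum_le_sum fun x _ => ?_
        rw [norm_mul, RCLike.norm_conj]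
        have w1 := wt_nonneg (len l0 s.i) s.a x
        have w2 := wt_nonneg (len l0 t.i) t.a x
        have w3 := pow_le_pow_left₀ (mul_nonneg w1 w2) (wt_mul_wt_le hts s.a t.a x y hy) 18
        calc _ ≤ (K / √(len l0 s.i) * wt (len l0 s.i) s.a x ^ 18) *
              (K / √(len l0 t.i) * wt (len l0 t.i) t.a x ^ 20) := by
              gcongr
              exacts [h.decay' s x (by norm_num), h.decay t x]
          _ = (K / √(len l0 s.i) * (K / √(len l0 t.i)) *
              ((wt (len l0 s.i) s.a x * wt (len l0 t.i) t.a x) ^ 18)) * wt (len l0 t.i) t.a x ^ 2 := by ring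
          _ ≤ (K / √(len l0 s.i) * (K / √(len l0 t.i)) *
              ((2 * wt (len l0 s.i) s.a y) ^ 18)) * wt (len l0 t.i) t.a x ^ 2 := by gcongr
          _ = _ := by ring
    _ ≤ (K / √(len l0 s.i) * (K / √(len l0 t.i)) * (2 ^ 18 * wt (len l0 s.i) s.a y ^ 18)) *
          (4 * len l0 t.i) := by
        rw [← Finset.mul_sum]
        have := pow_nonneg (wt_nonneg (len l0 s.i) s.a y) 18
        gcongr
        exact sum_wt_sq_le (one_le_len _) _ _
    _ = _ := by
        have e : len l0 t.i = √(len l0 t.i) * √(len l0 t.i) :=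
          (Real.mul_self_sqrt (len_pos _).le).symm
        generalize √(len l0 s.i) = p at *
        generalize √(len l0 t.i) = q at *
        rw [e]
        field_simp
        ring

/-- `ℓ²` norm of a finite combination of packets through the Gram matrix. -/
lemma sum_sq_le_gram (h : Packets l0 φ K) (S : Finset Tile) (c : Tile → ℂ) (Z : Finset ℤ) :
    ∑ z ∈ Z, ‖∑ s ∈ S, c s * φ s z‖ ^ 2 ≤ ∑ s ∈ S, ∑ t ∈ S, ‖c s‖ * ‖c t‖ * ‖gram φ s t‖ := by
  have hs : ∀ s t, HasSum (fun x => starRingEnd ℂ (c s) * c t * (starRingEnd ℂ (φ s x) * φ t x))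
      (starRingEnd ℂ (c s) * c t * gram φ s t) := fun s t =>
    ((summable_gram h s t).of_norm.hasSum).mul_left _
  have h2 : HasSum (fun x => ∑ s ∈ S, ∑ t ∈ S,
      starRingEnd ℂ (c s) * c t * (starRingEnd ℂ (φ s x) * φ t x))
      (∑ s ∈ S, ∑ t ∈ S, starRingEnd ℂ (c s) * c t * gram φ s t) :=
    hasSum_sum fun s _ => hasSum_sum fun t _ => hs s t
  have e : ∀ x, ∑ s ∈ S, ∑ t ∈ S, starRingEnd ℂ (c s) * c t * (starRingEnd ℂ (φ s x) * φ t x)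
      = ((‖∑ s ∈ S, c s * φ s x‖ ^ 2 : ℝ) : ℂ) := by
    intro x
    push_cast
    rw [← Complex.conj_mul', map_sum, Finset.sum_mul_sum]
    refine Finset.sum_congr rfl fun s _ => Finset.sum_congr rfl fun t _ => ?_
    rw [map_mul]; ring
  simp_rw [e] at h2
  have h3 := Complex.hasSum_re h2
  simp only [Complex.ofReal_re] at h3
  refine (sum_le_hasSum Z (fun _ _ => by positivity) h3).trans ?_
  refine (Complex.re_le_norm _).trans ((norm_sum_le _ _).trans ?_)
  refine Finset.sum_le_sum fun s _ => (norm_sum_le _ _).trans ?_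
  refine Finset.sum_le_sum fun t _ => ?_
  simp

end gram

lemma schur_le {ι : Type*} (S : Finset ι) (c : ι → ℝ) (g : ι → ι → ℝ) (hg : ∀ s t, 0 ≤ g s t)
    (hsym : ∀ s t, g s t = g t s) {C : ℝ} (hC : ∀ s ∈ S, ∑ t ∈ S, g s t ≤ C) :
    ∑ s ∈ S, ∑ t ∈ S, c s * c t * g s t ≤ C * ∑ s ∈ S, c s ^ 2 := by
  have h1 : ∑ s ∈ S, ∑ t ∈ S, c s * c t * g s t ≤
      ∑ s ∈ S, ∑ t ∈ S, (c s ^ 2 * g s t / 2 + c t ^ 2 * g t s / 2) := by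
    refine Finset.sum_le_sum fun s _ => Finset.sum_le_sum fun t _ => ?_
    rw [← hsym s t]
    nlinarith [mul_nonneg (sq_nonneg (c s - c t)) (hg s t)]
  refine h1.trans ?_
  simp_rw [Finset.sum_add_distrib]
  rw [Finset.sum_comm (f := fun s t => c t ^ 2 * g t s / 2), ← two_mul, Finset.mul_sum, Finset.mul_sum]
  refine Finset.sum_le_sum fun s hs => ?_
  rw [← Finset.sum_div, ← Finset.mul_sum]
  nlinarith [mul_le_mul_of_nonneg_left (hC s hs) (sq_nonneg (c s))]

/-- The top of a tree. -/
structure Top where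
  /-- scale -/
  i : ℕ
  /-- space index -/
  a : ℤ
  /-- frequency -/
  ξ : ℝ

/-- The tile lies in the tree with the given top. -/
def Top.In (l0 : ℕ) (T : Top) (s : Tile) : Prop :=
  s.i ≤ T.i ∧ s.a / 8 ^ (T.i - s.i) = T.a ∧ ⌊len l0 s.i * T.ξ⌋ = s.b

/-- The tile lies in the tree with the given top and its marked child contains the top frequency. -/
def Top.Lac (l0 : ℕ) (T : Top) (s : Tile) : Prop :=
  T.In l0 s ∧ ⌊len l0 (s.i + 1) * T.ξ⌋ = 8 * s.b + 7

section ao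
variable {l0 : ℕ} [NeZero l0] {φ : Tile → ℤ → ℂ} {K : ℝ}

lemma sum_gram_same_le (h : Packets l0 φ K) (s : Tile) (V : Finset Tile)
    (hV : ∀ t ∈ V, t.i = s.i ∧ t.b = s.b) : ∑ t ∈ V, ‖gram φ s t‖ ≤ 2 ^ 22 * K ^ 2 := by
  have hi := len_pos (l0 := l0) s.i
  have hi' := Real.sqrt_pos.2 hi
  calc ∑ t ∈ V, ‖gram φ s t‖ ≤ ∑ t ∈ V, 2 ^ 20 * K ^ 2 * wt 1 t.a s.a ^ 2 := by
        refine Finset.sum_le_sum fun t ht => ?_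
        obtain ⟨h1, h2⟩ := hV t ht
        have := gram_le h s t h1.le (y := t.a * sc l0 t.i)
          (Int.mul_ediv_cancel _ (sc_pos _).ne')
        refine this.trans ?_
        have e : wt (len l0 s.i) s.a (t.a * sc l0 t.i) = wt 1 t.a s.a := by
          unfold wt
          push_cast
          rw [sc_cast, h1, mul_div_assoc, div_self hi.ne', mul_one, div_one, abs_sub_comm]
        rw [e, h1, div_self hi'.ne', mul_one]
        gcongr ?_ * ?_
        exact wt_pow_anti _ _ _ (by norm_num)
    _ = 2 ^ 20 * K ^ 2 * ∑ a ∈ V.image Tile.a, wt 1 a s.a ^ 2 := by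
        rw [← Finset.mul_sum, Finset.sum_image]
        intro t ht t' ht' e
        ext
        · rw [(hV t ht).1, (hV t' ht').1]
        · exact e
        · rw [(hV t ht).2, (hV t' ht').2]
    _ ≤ 2 ^ 20 * K ^ 2 * 4 := by
        gcongr
        exact sum_wt_sq_le' _ _ _
    _ = _ := by ring

/-- Lacunary trees are almost orthogonal. -/
lemma sum_sq_lac_le (h : Packets l0 φ K) (T : Top) (S : Finset Tile)
    (hS : ∀ s ∈ S, T.Lac l0 s ∧ s.Valid l0) (c : Tile → ℂ) (Z : Finset ℤ) :
    ∑ z ∈ Z, ‖∑ s ∈ S, c s * φ s z‖ ^ 2 ≤ 2 ^ 22 * K ^ 2 * ∑ s ∈ S, ‖c s‖ ^ 2 := by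
  refine (sum_sq_le_gram h S c Z).trans (schur_le S (fun s => ‖c s‖) _ (fun _ _ => norm_nonneg _)
    norm_gram_comm fun s hs => ?_)
  have key : ∀ s ∈ S, ∀ t ∈ S, t.i < s.i → gram φ s t = 0 := by
    intro s hs t ht hlt
    refine h.orth s t (hS s hs).2 (hS t ht).2 hlt (Or.inr ?_)
    rw [← (hS t ht).1.2, ← (hS s hs).1.1.2.2, floor_len_le (by omega : t.i + 1 ≤ s.i)]
    congr 2
  rw [← Finset.sum_filter_add_sum_filter_not S (fun t => t.i = s.i)]
  have h0 : ∑ t ∈ S with ¬ t.i = s.i, ‖gram φ s t‖ = 0 := by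
    refine Finset.sum_eq_zero fun t ht => ?_
    simp only [Finset.mem_filter] at ht
    rcases lt_or_gt_of_ne ht.2 with h1 | h1
    · rw [key s hs t ht.1 h1, norm_zero]
    · rw [norm_gram_comm, key t ht.1 s hs h1, norm_zero]
  rw [h0, add_zero]
  refine sum_gram_same_le h s _ fun t ht => ?_
  simp only [Finset.mem_filter] at ht
  refine ⟨ht.2, ?_⟩
  rw [← (hS t ht.1).1.1.2.2, ← (hS s hs).1.1.2.2, ht.2]

end ao

/-- The averaging kernel at scale `l`. -/
noncomputable def avgK (l : ℝ) (y z : ℤ) : ℝ := l⁻¹ * ((1 + |(y : ℝ) - z| / l)⁻¹) ^ 2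

section maximal

lemma avgK_nonneg {l : ℝ} (hl : 1 ≤ l) (y z : ℤ) : 0 ≤ avgK l y z := by
  have : 0 < l := by linarith
  unfold avgK; positivity

lemma avgK_comm (l : ℝ) (y z : ℤ) : avgK l y z = avgK l z y := by
  unfold avgK; rw [abs_sub_comm]

lemma sum_avgK_le {l : ℝ} (hl : 1 ≤ l) (y : ℤ) (Z : Finset ℤ) : ∑ z ∈ Z, avgK l y z ≤ 4 := by
  have hl0 : 0 < l := by linarith
  have h := sum_inv_sq_le hl (y / l) Z
  have e : ∀ z : ℤ, avgK l y z = l⁻¹ * ((1 + |(z : ℝ) / l - y / l|)⁻¹) ^ 2 := fun z => by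
    unfold avgK
    rw [← sub_div, abs_div, abs_of_pos hl0, abs_sub_comm]
  simp_rw [e]
  rw [← Finset.mul_sum]
  calc _ ≤ l⁻¹ * (4 * l) := by gcongr
    _ = 4 := by field_simp

lemma avgK_le_of {l C : ℝ} (hl : 1 ≤ l) {y z y' z' : ℤ}
    (h : 1 + |(y' : ℝ) - z'| / l ≤ C * (1 + |(y : ℝ) - z| / l)) :
    avgK l y z ≤ C ^ 2 * avgK l y' z' := by
  have hl0 : 0 < l := by linarith
  unfold avgK
  have h1 : (1 + |(y : ℝ) - z| / l)⁻¹ ≤ C * (1 + |(y' : ℝ) - z'| / l)⁻¹ := by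
    rw [← one_div, ← one_div, mul_one_div, div_le_div_iff₀ (by positivity) (by positivity)]
    linarith
  calc _ ≤ l⁻¹ * (C * (1 + |(y' : ℝ) - z'| / l)⁻¹) ^ 2 := by gcongr
    _ = _ := by ring

lemma sum_avgK_mul_le {l l' : ℝ} (hl : 1 ≤ l) (hl' : 1 ≤ l') (y y' : ℤ) (Z : Finset ℤ) :
    ∑ z ∈ Z, avgK l y z * avgK l' y' z ≤ 16 * (avgK l y y' + avgK l' y y') := by
  have key : ∀ z, avgK l y z * avgK l' y' z ≤
      4 * avgK l y y' * avgK l' y' z + 4 * avgK l' y y' * avgK l y z := by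
    intro z
    have n1 := avgK_nonneg hl y z
    have n2 := avgK_nonneg hl' y' z
    have n3 := avgK_nonneg hl y y'
    have n4 := avgK_nonneg hl' y y'
    have tri : |(y : ℝ) - y'| ≤ |(y : ℝ) - z| + |(y' : ℝ) - z| := by
      rw [abs_sub_comm (y' : ℝ) z]; exact abs_sub_le _ _ _
    rcases le_total |(y' : ℝ) - z| |(y : ℝ) - z| with h | h
    · have : avgK l y z ≤ 2 ^ 2 * avgK l y y' := by
        refine avgK_le_of hl ?_
        have : |(y : ℝ) - y'| / l ≤ (2 * |(y : ℝ) - z|) / l := by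
          have : 0 < l := by linarith
          gcongr; linarith
        rw [mul_div_assoc] at this
        linarith
      nlinarith [mul_le_mul_of_nonneg_right this n2, mul_nonneg n4 n1]
    · have : avgK l' y' z ≤ 2 ^ 2 * avgK l' y y' := by
        refine avgK_le_of hl' ?_
        have : |(y : ℝ) - y'| / l' ≤ (2 * |(y' : ℝ) - z|) / l' := by
          have : 0 < l' := by linarith
          gcongr; linarith
        rw [mul_div_assoc] at this
        linarith
      nlinarith [mul_le_mul_of_nonneg_left this n1, mul_nonneg n3 n2]
  refine (Finset.sum_le_sum fun z _ => key z).trans ?_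
  rw [Finset.sum_add_distrib, ← Finset.mul_sum, ← Finset.mul_sum]
  have h1 := sum_avgK_le hl y Z
  have h2 := sum_avgK_le hl' y' Z
  have h3 := mul_le_mul_of_nonneg_left h2 (avgK_nonneg hl y y')
  have h4 := mul_le_mul_of_nonneg_left h1 (avgK_nonneg hl' y y')
  linarith

/-- Dual form of the `ℓ²` bound for the linearized maximal average. -/
lemma sum_dual_avgK_sq_le (Y Z : Finset ℤ) (hYZ : Y ⊆ Z) (g : ℤ → ℝ) (hg : ∀ y, 0 ≤ g y)
    (l : ℤ → ℝ) (hl : ∀ y, 1 ≤ l y) :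
    √(∑ z ∈ Z, (∑ y ∈ Y, g y * avgK (l y) y z) ^ 2) ≤ 32 * √(∑ y ∈ Y, g y ^ 2) := by
  set H : ℤ → ℝ := fun z => ∑ y ∈ Y, g y * avgK (l y) y z with hH
  have h1 : ∑ z ∈ Z, H z ^ 2 ≤ 32 * ∑ y ∈ Y, g y * H y := by
    calc ∑ z ∈ Z, H z ^ 2
        = ∑ y ∈ Y, ∑ y' ∈ Y, g y * g y' * ∑ z ∈ Z, avgK (l y) y z * avgK (l y') y' z := by
          simp_rw [hH, sq, Finset.sum_mul_sum, Finset.mul_sum]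
          rw [Finset.sum_comm]
          refine Finset.sum_congr rfl fun y _ => ?_
          rw [Finset.sum_comm]
          refine Finset.sum_congr rfl fun y' _ => Finset.sum_congr rfl fun z _ => ?_
          ring
      _ ≤ ∑ y ∈ Y, ∑ y' ∈ Y, g y * g y' * (16 * (avgK (l y) y y' + avgK (l y') y y')) := by
          refine Finset.sum_le_sum fun y _ => Finset.sum_le_sum fun y' _ => ?_
          exact mul_le_mul_of_nonneg_left (sum_avgK_mul_le (hl y) (hl y') y y' Z)
            (mul_nonneg (hg _) (hg _))
      _ = 16 * (∑ y ∈ Y, ∑ y' ∈ Y, g y * g y' * avgK (l y) y y') +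
            16 * (∑ y ∈ Y, ∑ y' ∈ Y, g y * g y' * avgK (l y') y' y) := by
          simp_rw [Finset.mul_sum, ← Finset.sum_add_distrib]
          refine Finset.sum_congr rfl fun y _ => Finset.sum_congr rfl fun y' _ => ?_
          rw [avgK_comm _ y' y]; ring
      _ = 32 * ∑ y ∈ Y, g y * H y := by
          have e1 : ∑ y ∈ Y, ∑ y' ∈ Y, g y * g y' * avgK (l y') y' y = ∑ y ∈ Y, g y * H y := by
            refine Finset.sum_congr rfl fun y _ => ?_
            rw [hH, Finset.mul_sum]
            exact Finset.sum_congr rfl fun y' _ => by ring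
          have e2 : ∑ y ∈ Y, ∑ y' ∈ Y, g y * g y' * avgK (l y) y y' = ∑ y ∈ Y, g y * H y := by
            rw [Finset.sum_comm, ← e1]
            exact Finset.sum_congr rfl fun y' _ => Finset.sum_congr rfl fun y _ => by ring
          rw [e1, e2]; ring
  have h2 : ∑ y ∈ Y, g y * H y ≤ √(∑ y ∈ Y, g y ^ 2) * √(∑ z ∈ Z, H z ^ 2) := by
    refine (Real.sum_mul_le_sqrt_mul_sqrt _ _ _).trans ?_
    gcongr
  set u := √(∑ z ∈ Z, H z ^ 2)
  have h3 : u ^ 2 = ∑ z ∈ Z, H z ^ 2 := Real.sq_sqrt (Finset.sum_nonneg fun _ _ => sq_nonneg _)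
  have hu : 0 ≤ u := Real.sqrt_nonneg _
  rcases hu.eq_or_lt with h0 | h0
  · rw [← h0]; positivity
  · have : u * u ≤ (32 * √(∑ y ∈ Y, g y ^ 2)) * u := by nlinarith
    exact le_of_mul_le_mul_right this h0

lemma summable_avgK_mul {l : ℝ} (hl : 1 ≤ l) (y : ℤ) {u : ℤ → ℝ} {M : ℝ} (hu : ∀ z, 0 ≤ u z)
    (hM : ∀ z, u z ≤ M) : Summable fun z => avgK l y z * u z := by
  have hM0 : 0 ≤ M := (hu 0).trans (hM 0)
  refine summable_of_sum_le (c := 4 * M) (fun z => mul_nonneg (avgK_nonneg hl _ _) (hu z)) fun Z => ?_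
  calc ∑ z ∈ Z, avgK l y z * u z ≤ ∑ z ∈ Z, avgK l y z * M :=
        Finset.sum_le_sum fun z _ => mul_le_mul_of_nonneg_left (hM z) (avgK_nonneg hl _ _)
    _ ≤ 4 * M := by
        rw [← Finset.sum_mul]; exact mul_le_mul_of_nonneg_right (sum_avgK_le hl _ _) hM0

/-- `ℓ²` bound for the linearized maximal average. -/
lemma sum_avgK_maximal_le (Y : Finset ℤ) (g : ℤ → ℝ) (hg : ∀ y, 0 ≤ g y)
    (l : ℤ → ℝ) (hl : ∀ y, 1 ≤ l y) (u : ℤ → ℝ) (hu : ∀ z, 0 ≤ u z) (M : ℝ)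
    (hM : ∀ Z : Finset ℤ, ∑ z ∈ Z, u z ^ 2 ≤ M) :
    ∑ y ∈ Y, g y * ∑' z, avgK (l y) y z * u z ≤ 32 * √(∑ y ∈ Y, g y ^ 2) * √M := by
  have hbd : ∀ z, u z ≤ √M := fun z => Real.le_sqrt_of_sq_le (by simpa using hM {z})
  have hs : ∀ y, HasSum (fun z => g y * (avgK (l y) y z * u z))
      (g y * ∑' z, avgK (l y) y z * u z) := fun y =>
    (summable_avgK_mul (hl y) y hu hbd).hasSum.mul_left _
  have h1 := hasSum_sum (s := Y) fun y _ => hs y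
  rw [← h1.tsum_eq]
  refine Real.tsum_le_of_sum_le (fun z => Finset.sum_nonneg fun y _ =>
    mul_nonneg (hg y) (mul_nonneg (avgK_nonneg (hl y) _ _) (hu z))) fun Z => ?_
  have hmono : ∑ z ∈ Z, ∑ y ∈ Y, g y * (avgK (l y) y z * u z) ≤
      ∑ z ∈ Z ∪ Y, ∑ y ∈ Y, g y * (avgK (l y) y z * u z) :=
    Finset.sum_le_sum_of_subset_of_nonneg Finset.subset_union_left fun z _ _ =>
      Finset.sum_nonneg fun y _ => mul_nonneg (hg y) (mul_nonneg (avgK_nonneg (hl y) _ _) (hu z))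
  refine hmono.trans ?_
  calc ∑ z ∈ Z ∪ Y, ∑ y ∈ Y, g y * (avgK (l y) y z * u z)
      = ∑ z ∈ Z ∪ Y, (∑ y ∈ Y, g y * avgK (l y) y z) * u z := by
        refine Finset.sum_congr rfl fun z _ => ?_
        rw [Finset.sum_mul]; exact Finset.sum_congr rfl fun y _ => by ring
    _ ≤ √(∑ z ∈ Z ∪ Y, (∑ y ∈ Y, g y * avgK (l y) y z) ^ 2) * √(∑ z ∈ Z ∪ Y, u z ^ 2) :=
        Real.sum_mul_le_sqrt_mul_sqrt _ _ _
    _ ≤ (32 * √(∑ y ∈ Y, g y ^ 2)) * √M := by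
        gcongr
        · exact sum_dual_avgK_sq_le Y _ Finset.subset_union_right g hg l hl
        · exact hM _

end maximal
open scoped Classical

section stopping
variable {l0 : ℕ} [NeZero l0]

/-- The grid cell of scale `k` containing `x`. -/
noncomputable def cell (l0 : ℕ) (x : ℤ) (k : ℕ) : Finset ℤ :=
  Finset.Ico (x / sc l0 k * sc l0 k) (x / sc l0 k * sc l0 k + sc l0 k)

lemma mem_cell {x y : ℤ} {k : ℕ} : y ∈ cell l0 x k ↔ y / sc l0 k = x / sc l0 k := by
  rw [cell, Finset.mem_Ico, Int.ediv_eq_iff_of_pos (sc_pos k)]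

lemma card_cell (x : ℤ) (k : ℕ) : ((cell l0 x k).card : ℝ) = len l0 k := by
  rw [cell, Int.card_Ico, ← sc_cast]
  have := (sc_pos (l0 := l0) k).le
  have h : ((x / sc l0 k * sc l0 k + sc l0 k - x / sc l0 k * sc l0 k).toNat : ℤ) = sc l0 k := by
    rw [Int.toNat_of_nonneg] <;> linarith
  exact_mod_cast h

/-- Some tile of `S` lies within the triple of the cell of scale `k` at `x`. -/
def Near (l0 : ℕ) (S : Finset Tile) (x : ℤ) (k : ℕ) : Prop :=
  ∃ s ∈ S, s.i ≤ k ∧ |s.a / 8 ^ (k - s.i) - x / sc l0 k| ≤ 1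

/-- The first scale (at most `n`) at which `S` is near `x`. -/
noncomputable def haltScale (l0 : ℕ) (S : Finset Tile) (n : ℕ) (x : ℤ) : ℕ :=
  sInf {k | k = n ∨ Near l0 S x k}

variable {S : Finset Tile} {n : ℕ} {x y : ℤ}

lemma haltScale_mem : haltScale l0 S n x = n ∨ Near l0 S x (haltScale l0 S n x) :=
  Nat.sInf_mem (s := {k | k = n ∨ Near l0 S x k}) ⟨n, Or.inl rfl⟩

lemma haltScale_le : haltScale l0 S n x ≤ n := Nat.sInf_le (Or.inl rfl)

lemma near_haltScale (h : haltScale l0 S n x < n) : Near l0 S x (haltScale l0 S n x) :=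
  haltScale_mem.resolve_left h.ne

lemma haltScale_le_of_near {k : ℕ} (h : Near l0 S x k) : haltScale l0 S n x ≤ k := Nat.sInf_le (Or.inr h)

lemma not_near_of_lt {k : ℕ} (h : k < haltScale l0 S n x) : ¬ Near l0 S x k :=
  fun h' => absurd (haltScale_le_of_near h') (not_le.2 h)

lemma abs_ediv_sub_ediv_le {a b : ℤ} (d : ℕ) (h : |a - b| ≤ 1) : |a / 8 ^ d - b / 8 ^ d| ≤ 1 := by
  obtain ⟨a1, a2⟩ := ediv_pow_bounds a d
  obtain ⟨b1, b2⟩ := ediv_pow_bounds b d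
  have h8 : (1 : ℤ) ≤ 8 ^ d := one_le_pow₀ (by norm_num)
  rw [abs_le] at h ⊢
  constructor <;> nlinarith

lemma near_mono {j k : ℕ} (hjk : j ≤ k) (h : Near l0 S x j) : Near l0 S x k := by
  obtain ⟨s, hs, hsj, h⟩ := h
  refine ⟨s, hs, hsj.trans hjk, ?_⟩
  have := abs_ediv_sub_ediv_le (k - j) h
  rwa [Int.ediv_ediv_of_nonneg (by positivity), ← pow_add, ← ediv_sc_le hjk,
    show j - s.i + (k - j) = k - s.i by omega] at this

lemma near_congr {j k : ℕ} (hjk : j ≤ k) (h : y / sc l0 j = x / sc l0 j) :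
    Near l0 S y k ↔ Near l0 S x k := by
  unfold Near
  rw [ediv_sc_le hjk, h, ← ediv_sc_le hjk]

lemma haltScale_congr (h : y / sc l0 (haltScale l0 S n x - 1) = x / sc l0 (haltScale l0 S n x - 1)) :
    haltScale l0 S n y = haltScale l0 S n x := by
  apply le_antisymm
  · rcases haltScale_mem (l0 := l0) (S := S) (n := n) (x := x) with h1 | h1
    · rw [h1]; exact haltScale_le
    · exact haltScale_le_of_near ((near_congr (by omega) h).2 h1)
  · by_contra hlt
    push Not at hlt
    have h1 := near_haltScale (hlt.trans_le haltScale_le)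
    have h2 := (near_congr le_rfl h).1 (near_mono (by omega : _ ≤ haltScale l0 S n x - 1) h1)
    exact not_near_of_lt (n := n) (by omega) h2

/-- The cell of `x` just below the stopping scale. -/
noncomputable def scell (l0 : ℕ) (S : Finset Tile) (n : ℕ) (x : ℤ) : Finset ℤ :=
  cell l0 x (haltScale l0 S n x - 1)

lemma mem_scell : y ∈ scell l0 S n x ↔
    y / sc l0 (haltScale l0 S n x - 1) = x / sc l0 (haltScale l0 S n x - 1) := mem_cell

lemma haltScale_of_mem_scell (h : y ∈ scell l0 S n x) : haltScale l0 S n y = haltScale l0 S n x :=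
  haltScale_congr (mem_scell.1 h)

lemma mem_scell_comm : y ∈ scell l0 S n x ↔ x ∈ scell l0 S n y := by
  constructor <;> intro h <;> rw [mem_scell, haltScale_of_mem_scell h] <;> exact (mem_scell.1 h).symm

/-- The weight of a tile below the stopping scale is essentially constant on stopping cells. -/
lemma wt_le_of_mem_scell {s : Tile} (hs : s ∈ S) (hlt : s.i < haltScale l0 S n x)
    (hy : y ∈ scell l0 S n x) : wt (len l0 s.i) s.a x ≤ 2 * wt (len l0 s.i) s.a y := by
  set k := haltScale l0 S n x - 1 with hk
  have hn : ¬ Near l0 S x k := not_near_of_lt (n := n) (by omega)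
  have hsk : s.i ≤ k := by omega
  have hfar : 2 ≤ |s.a / 8 ^ (k - s.i) - x / sc l0 k| := by
    by_contra h
    exact hn ⟨s, hs, hsk, by omega⟩
  obtain ⟨x1, x2⟩ := (mem_cell_iff (l0 := l0) (x := x) k).1 rfl
  obtain ⟨y1, y2⟩ := (mem_cell_iff (l0 := l0) (x := y) k).1 (mem_scell.1 hy)
  obtain ⟨a1, a2⟩ := anc_bounds (l0 := l0) hsk s.a
  set q := x / sc l0 k
  set a' := s.a / 8 ^ (k - s.i)
  have hL := len_pos (l0 := l0) k
  have hl := len_pos (l0 := l0) s.i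
  have hd : len l0 k ≤ |(x : ℝ) - s.a * len l0 s.i| := by
    rw [le_abs] at hfar ⊢
    rcases hfar with h | h
    · right
      have h' : (q : ℝ) + 2 ≤ a' := by exact_mod_cast (by linarith : q + 2 ≤ a')
      nlinarith
    · left
      have h' : (a' : ℝ) + 2 ≤ q := by exact_mod_cast (by linarith : a' + 2 ≤ q)
      nlinarith
  have hxy : |(y : ℝ) - x| ≤ len l0 k := by
    rw [abs_le]; constructor <;> nlinarith
  have h2 : |(y : ℝ) - s.a * len l0 s.i| ≤ 2 * |(x : ℝ) - s.a * len l0 s.i| := by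
    have := abs_sub_le (y : ℝ) x (s.a * len l0 s.i)
    linarith
  rw [wt_eq, wt_eq, ← one_div, ← one_div, mul_one_div,
    div_le_div_iff₀ (by positivity) (by positivity)]
  have h3 : |(y : ℝ) - s.a * len l0 s.i| / len l0 s.i ≤
      2 * |(x : ℝ) - s.a * len l0 s.i| / len l0 s.i := by gcongr
  rw [mul_div_assoc] at h3
  linarith

/-- Averaging over stopping cells and exchanging the order of summation. -/
lemma sum_scell_swap (E : Finset ℤ) (f : ℤ → ℤ → ℝ) :
    ∑ x ∈ E, ∑ y ∈ scell l0 S n x, f x y =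
      ∑ y ∈ E.biUnion (scell l0 S n), ∑ x ∈ E with x ∈ scell l0 S n y, f x y := by
  refine Finset.sum_comm' fun x y => ?_
  simp only [Finset.mem_filter, Finset.mem_biUnion]
  constructor
  · rintro ⟨h1, h2⟩
    exact ⟨⟨h1, mem_scell_comm.1 h2⟩, x, h1, h2⟩
  · rintro ⟨⟨h1, h2⟩, -⟩
    exact ⟨h1, mem_scell_comm.1 h2⟩

end stopping

section tree
variable {l0 : ℕ} [NeZero l0] {S : Finset Tile} {T : Top}

lemma sum_len_le (k : ℕ) : ∑ i ∈ Finset.range (k + 1), len l0 i ≤ 2 * len l0 k := by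
  induction k with
  | zero => simp; linarith [len_pos (l0 := l0) 0]
  | succ k ih =>
    rw [Finset.sum_range_succ, len_succ]
    linarith [len_pos (l0 := l0) k]

lemma sum_scale_le (hS : ∀ s ∈ S, T.In l0 s) (i : ℕ) (y : ℤ) :
    ∑ s ∈ S with s.i = i, wt (len l0 s.i) s.a y ^ 2 ≤ 4 := by
  calc _ = ∑ s ∈ S with s.i = i, wt (len l0 i) s.a y ^ 2 := by
        refine Finset.sum_congr rfl fun s hs => ?_
        rw [(Finset.mem_filter.1 hs).2]
    _ = ∑ a ∈ (S.filter (fun s => s.i = i)).image Tile.a, wt (len l0 i) a y ^ 2 := by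
        rw [Finset.sum_image]
        intro s hs t ht e
        obtain ⟨hs1, hs2⟩ := Finset.mem_filter.1 hs
        obtain ⟨ht1, ht2⟩ := Finset.mem_filter.1 ht
        ext
        · rw [hs2, ht2]
        · exact e
        · rw [← (hS s hs1).2.2, ← (hS t ht1).2.2, hs2, ht2]
    _ ≤ 4 := sum_wt_sq_le' _ _ _

lemma sum_below_le (hS : ∀ s ∈ S, T.In l0 s) (k : ℕ) (y : ℤ) :
    ∑ s ∈ S with s.i ≤ k, len l0 s.i * wt (len l0 s.i) s.a y ^ 2 ≤ 8 * len l0 k := by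
  rw [← Finset.sum_fiberwise_of_maps_to (g := Tile.i) (t := Finset.range (k + 1))
    (fun s hs => Finset.mem_range.2 (Nat.lt_succ_of_le (Finset.mem_filter.1 hs).2))]
  calc _ ≤ ∑ i ∈ Finset.range (k + 1), len l0 i * 4 := by
        refine Finset.sum_le_sum fun i _ => ?_
        calc _ ≤ ∑ s ∈ S with s.i = i, len l0 i * wt (len l0 s.i) s.a y ^ 2 := by
              rw [Finset.filter_filter]
              refine (Finset.sum_le_sum_of_subset_of_nonneg (t := S.filter (fun s => s.i = i))
                (fun s hs => ?_) fun s hs _ => ?_).trans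
                (Finset.sum_le_sum fun s hs => ?_)
              · simp only [Finset.mem_filter] at hs ⊢
                exact ⟨hs.1, hs.2.2⟩
              · exact mul_nonneg (len_pos _).le (sq_nonneg _)
              · rw [(Finset.mem_filter.1 hs).2]
          _ ≤ len l0 i * 4 := by
              rw [← Finset.mul_sum]
              exact mul_le_mul_of_nonneg_left (sum_scale_le hS i y) (len_pos i).le
    _ ≤ 8 * len l0 k := by
        rw [← Finset.sum_mul]
        linarith [sum_len_le (l0 := l0) k]

variable {E : Finset ℤ} {P : ℤ → ℕ → Prop} {δ : ℝ}

/-- Tiles below the stopping scale. -/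
lemma sum_small_le (hS : ∀ s ∈ S, T.In l0 s)
    (hD : ∀ s ∈ S, ∀ j, s.i ≤ j →
      ∑ x ∈ E with P x j, wt (len l0 j) (s.a / 8 ^ (j - s.i)) x ^ 10 ≤ δ * len l0 j)
    (hδ : 0 ≤ δ) :
    ∑ x ∈ E, ∑ s ∈ S with s.i < haltScale l0 S (T.i + 1) x ∧ P x s.i, wt (len l0 s.i) s.a x ^ 20 ≤
      2 ^ 18 * δ * len l0 T.i := by
  set n := T.i + 1 with hn
  set Y := E.biUnion (scell l0 S n)
  let R : ℤ → ℝ := fun y => (len l0 (haltScale l0 S n y - 1))⁻¹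
  have hR : ∀ y, 0 ≤ R y := fun y => inv_nonneg.2 (len_pos _).le
  have hw : ∀ (s : Tile) (x : ℤ) (m : ℕ), 0 ≤ wt (len l0 s.i) s.a x ^ m :=
    fun s x m => pow_nonneg (wt_nonneg _ _ _) _
  have step1 : ∀ x, ∀ s ∈ S, s.i < haltScale l0 S n x → wt (len l0 s.i) s.a x ^ 20 ≤
      ∑ y ∈ scell l0 S n x, R y * (2 ^ 10 * wt (len l0 s.i) s.a x ^ 10 * wt (len l0 s.i) s.a y ^ 10) := by
    intro x s hs hlt
    have hle : ∀ y ∈ scell l0 S n x, R x * wt (len l0 s.i) s.a x ^ 20 ≤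
        R y * (2 ^ 10 * wt (len l0 s.i) s.a x ^ 10 * wt (len l0 s.i) s.a y ^ 10) := by
      intro y hy
      have h1 := pow_le_pow_left₀ (wt_nonneg _ _ _) (wt_le_of_mem_scell hs hlt hy) 10
      have h2 : R y = R x := by simp only [R]; rw [haltScale_of_mem_scell hy]
      rw [h2]
      refine mul_le_mul_of_nonneg_left ?_ (hR x)
      calc _ = wt (len l0 s.i) s.a x ^ 10 * wt (len l0 s.i) s.a x ^ 10 := by ring
        _ ≤ wt (len l0 s.i) s.a x ^ 10 * (2 * wt (len l0 s.i) s.a y) ^ 10 :=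
            mul_le_mul_of_nonneg_left h1 (hw _ _ _)
        _ = _ := by ring
    refine le_trans (le_of_eq ?_) (Finset.sum_le_sum hle)
    rw [Finset.sum_const, nsmul_eq_mul, scell, card_cell, ← mul_assoc, mul_inv_cancel₀ (len_pos _).ne',
      one_mul]
  calc _ ≤ ∑ x ∈ E, ∑ s ∈ S with s.i < haltScale l0 S n x ∧ P x s.i, ∑ y ∈ scell l0 S n x,
        R y * (2 ^ 10 * wt (len l0 s.i) s.a x ^ 10 * wt (len l0 s.i) s.a y ^ 10) := by
        refine Finset.sum_le_sum fun x _ => Finset.sum_le_sum fun s hs => ?_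
        simp only [Finset.mem_filter] at hs
        exact step1 x s hs.1 hs.2.1
    _ = ∑ y ∈ Y, ∑ x ∈ E with x ∈ scell l0 S n y, ∑ s ∈ S with s.i < haltScale l0 S n x ∧ P x s.i,
        R y * (2 ^ 10 * wt (len l0 s.i) s.a x ^ 10 * wt (len l0 s.i) s.a y ^ 10) := by
        rw [← sum_scell_swap]
        exact Finset.sum_congr rfl fun x _ => Finset.sum_comm
    _ ≤ ∑ y ∈ Y, ∑ s ∈ S with s.i ≤ haltScale l0 S n y - 1, ∑ x ∈ E with P x s.i,
        R y * (2 ^ 10 * wt (len l0 s.i) s.a x ^ 10 * wt (len l0 s.i) s.a y ^ 10) := by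
        refine Finset.sum_le_sum fun y _ => ?_
        have nn : ∀ x (s : Tile),
            0 ≤ R y * (2 ^ 10 * wt (len l0 s.i) s.a x ^ 10 * wt (len l0 s.i) s.a y ^ 10) :=
          fun x s => mul_nonneg (hR y) (mul_nonneg (mul_nonneg (by norm_num) (hw _ _ _)) (hw _ _ _))
        rw [Finset.sum_comm' (t' := S.filter (fun s => s.i ≤ haltScale l0 S n y - 1))
          (s' := fun s => E.filter (fun x => x ∈ scell l0 S n y ∧ s.i < haltScale l0 S n x ∧ P x s.i))]
        · refine Finset.sum_le_sum fun s _ => Finset.sum_le_sum_of_subset_of_nonneg ?_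
            fun x _ _ => nn x s
          intro x hx
          simp only [Finset.mem_filter] at hx ⊢
          exact ⟨hx.1, hx.2.2.2⟩
        · intro x s
          simp only [Finset.mem_filter]
          constructor
          · rintro ⟨⟨h1, h2⟩, h3, h4, h5⟩
            have := haltScale_of_mem_scell h2
            exact ⟨⟨h1, h2, h4, h5⟩, h3, by omega⟩
          · rintro ⟨⟨h1, h2, h4, h5⟩, h3, -⟩
            exact ⟨⟨h1, h2⟩, h3, h4, h5⟩
    _ ≤ ∑ y ∈ Y, ∑ s ∈ S with s.i ≤ haltScale l0 S n y - 1,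
        R y * (2 ^ 10 * (δ * len l0 s.i) * (4 * wt (len l0 T.i) T.a y ^ 2 * wt (len l0 s.i) s.a y ^ 2)) := by
        refine Finset.sum_le_sum fun y _ => Finset.sum_le_sum fun s hs => ?_
        simp only [Finset.mem_filter] at hs
        rw [← Finset.mul_sum, ← Finset.sum_mul, ← Finset.mul_sum]
        have h1 := hD s hs.1 s.i le_rfl
        simp only [Nat.sub_self, pow_zero, Int.ediv_one] at h1
        refine mul_le_mul_of_nonneg_left ?_ (hR y)
        have h2 : wt (len l0 s.i) s.a y ^ 10 ≤
            4 * wt (len l0 T.i) T.a y ^ 2 * wt (len l0 s.i) s.a y ^ 2 := by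
          have h3 := wt_le_anc (l0 := l0) (hS s hs.1).1 s.a y
          rw [(hS s hs.1).2.1] at h3
          have h4 := pow_le_pow_left₀ (wt_nonneg _ _ _) h3 2
          calc _ ≤ wt (len l0 s.i) s.a y ^ 4 := wt_pow_anti _ _ _ (by norm_num)
            _ = wt (len l0 s.i) s.a y ^ 2 * wt (len l0 s.i) s.a y ^ 2 := by ring
            _ ≤ (2 * wt (len l0 T.i) T.a y) ^ 2 * wt (len l0 s.i) s.a y ^ 2 :=
              mul_le_mul_of_nonneg_right h4 (hw _ _ _)
            _ = _ := by ring
        exact mul_le_mul (mul_le_mul_of_nonneg_left h1 (by norm_num)) h2 (hw _ _ _)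
          (mul_nonneg (by norm_num) (mul_nonneg hδ (len_pos _).le))
    _ ≤ ∑ y ∈ Y, 2 ^ 15 * δ * wt (len l0 T.i) T.a y ^ 2 := by
        refine Finset.sum_le_sum fun y _ => ?_
        have h1 := sum_below_le hS (haltScale l0 S n y - 1) y
        calc _ = R y * (2 ^ 12 * δ * wt (len l0 T.i) T.a y ^ 2) *
              ∑ s ∈ S with s.i ≤ haltScale l0 S n y - 1, len l0 s.i * wt (len l0 s.i) s.a y ^ 2 := by
              rw [Finset.mul_sum]
              exact Finset.sum_congr rfl fun s _ => by ring
          _ ≤ R y * (2 ^ 12 * δ * wt (len l0 T.i) T.a y ^ 2) * (8 * len l0 (haltScale l0 S n y - 1)) :=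
              mul_le_mul_of_nonneg_left h1 (mul_nonneg (hR y) (by positivity))
          _ = 2 ^ 15 * δ * wt (len l0 T.i) T.a y ^ 2 *
                (R y * len l0 (haltScale l0 S n y - 1)) := by ring
          _ = _ := by simp only [R]; rw [inv_mul_cancel₀ (len_pos _).ne', mul_one]
    _ ≤ 2 ^ 15 * δ * (4 * len l0 T.i) := by
        rw [← Finset.mul_sum]
        exact mul_le_mul_of_nonneg_left (sum_wt_sq_le (one_le_len _) _ _) (by positivity)
    _ ≤ _ := by nlinarith [mul_nonneg hδ (len_pos (l0 := l0) T.i).le]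

/-- The triple of the spatial interval of the top. -/
noncomputable def Top.triple (l0 : ℕ) (T : Top) : Finset ℤ :=
  Finset.Ico ((T.a - 1) * sc l0 T.i) ((T.a + 2) * sc l0 T.i)

lemma card_triple (T : Top) : ((T.triple l0).card : ℝ) = 3 * len l0 T.i := by
  rw [Top.triple, Int.card_Ico, ← sc_cast]
  have := (sc_pos (l0 := l0) T.i).le
  have h : (((T.a + 2) * sc l0 T.i - (T.a - 1) * sc l0 T.i).toNat : ℤ) = 3 * sc l0 T.i := by
    rw [Int.toNat_of_nonneg] <;> linarith
  exact_mod_cast h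

lemma mem_triple {T : Top} {x : ℤ} : x ∈ T.triple l0 ↔ |T.a - x / sc l0 T.i| ≤ 1 := by
  rw [Top.triple, Finset.mem_Ico, ← Int.le_ediv_iff_mul_le (sc_pos _),
    ← Int.ediv_lt_iff_lt_mul (sc_pos _), abs_le]
  constructor <;> rintro ⟨h1, h2⟩ <;> constructor <;> omega

lemma mem_triple_of_stop (hS : ∀ s ∈ S, T.In l0 s) {x y : ℤ}
    (hx : haltScale l0 S (T.i + 1) x < T.i + 1) (hy : y ∈ scell l0 S (T.i + 1) x) :
    y ∈ T.triple l0 := by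
  obtain ⟨s, hs, hsi, h⟩ := near_haltScale hx
  set k := haltScale l0 S (T.i + 1) x
  have h1 := abs_ediv_sub_ediv_le (T.i - k) h
  rw [Int.ediv_ediv_of_nonneg (by positivity), ← pow_add, ← ediv_sc_le (by omega),
    show k - s.i + (T.i - k) = T.i - s.i by omega, (hS s hs).2.1] at h1
  have h2 := mem_scell.1 hy
  rw [mem_triple, ediv_sc_le (by omega : k - 1 ≤ T.i), h2, ← ediv_sc_le (by omega : k - 1 ≤ T.i)]
  exact h1

/-- Points above the stopping scale are counted by the density. -/
lemma sum_large_le (hS : ∀ s ∈ S, T.In l0 s)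
    (hD : ∀ s ∈ S, ∀ j, s.i ≤ j →
      ∑ x ∈ E with P x j, wt (len l0 j) (s.a / 8 ^ (j - s.i)) x ^ 10 ≤ δ * len l0 j)
    (hδ : 0 ≤ δ) (W M : ℤ → ℝ) (hM : ∀ y, 0 ≤ M y)
    (hW : ∀ x, ∀ y ∈ scell l0 S (T.i + 1) x, haltScale l0 S (T.i + 1) x < T.i + 1 → W x ≤ M y) :
    ∑ x ∈ E with haltScale l0 S (T.i + 1) x < T.i + 1 ∧ P x (haltScale l0 S (T.i + 1) x), W x ≤
      2 ^ 19 * δ * ∑ y ∈ T.triple l0, M y := by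
  set n := T.i + 1 with hn
  let R : ℤ → ℝ := fun y => (len l0 (haltScale l0 S n y - 1))⁻¹
  have hR : ∀ y, 0 ≤ R y := fun y => inv_nonneg.2 (len_pos _).le
  set E' := E.filter (fun x => haltScale l0 S n x < n ∧ P x (haltScale l0 S n x)) with hE'
  have count : ∀ y, ((E'.filter (fun x => x ∈ scell l0 S n y)).card : ℝ) * R y ≤ 2 ^ 19 * δ := by
    intro y
    by_cases hne : (E'.filter (fun x => x ∈ scell l0 S n y)).Nonempty
    · obtain ⟨x0, hx0⟩ := hne
      rw [hE', Finset.filter_filter, Finset.mem_filter] at hx0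
      have e0 := haltScale_of_mem_scell hx0.2.2
      have hlt : haltScale l0 S n y < n := by rw [← e0]; exact hx0.2.1.1
      obtain ⟨s, hs, hsi, h⟩ := near_haltScale hlt
      set k := haltScale l0 S n y
      have hD' := hD s hs k hsi
      have h1 : ((E'.filter (fun x => x ∈ scell l0 S n y)).card : ℝ) ≤ 3 ^ 10 * (δ * len l0 k) := by
        calc _ = ∑ x ∈ E'.filter (fun x => x ∈ scell l0 S n y), (1 : ℝ) := by simp
          _ ≤ ∑ x ∈ E'.filter (fun x => x ∈ scell l0 S n y),
                3 ^ 10 * wt (len l0 k) (s.a / 8 ^ (k - s.i)) x ^ 10 := by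
              refine Finset.sum_le_sum fun x hx => ?_
              have hx2 := mem_scell.1 (Finset.mem_filter.1 hx).2
              rw [← mul_pow]
              refine one_le_pow₀ (one_le_wt_of_near ?_)
              rw [ediv_sc_le (by omega : k - 1 ≤ k), hx2, ← ediv_sc_le (by omega : k - 1 ≤ k)]
              exact h
          _ ≤ ∑ x ∈ E with P x k, 3 ^ 10 * wt (len l0 k) (s.a / 8 ^ (k - s.i)) x ^ 10 := by
              refine Finset.sum_le_sum_of_subset_of_nonneg ?_ fun _ _ _ =>
                mul_nonneg (by norm_num) (pow_nonneg (wt_nonneg _ _ _) _)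
              intro x hx
              rw [hE', Finset.filter_filter, Finset.mem_filter] at hx
              rw [Finset.mem_filter]
              refine ⟨hx.1, ?_⟩
              have := haltScale_of_mem_scell hx.2.2
              have h3 := hx.2.1.2
              rw [this] at h3
              exact h3
          _ ≤ _ := by rw [← Finset.mul_sum]; gcongr
      have h2 : len l0 k ≤ 8 * len l0 (k - 1) := by
        rw [← len_succ]; exact len_mono (by omega)
      have h3 := len_pos (l0 := l0) (k - 1)
      calc _ ≤ 3 ^ 10 * (δ * (8 * len l0 (k - 1))) * R y := by
            refine mul_le_mul_of_nonneg_right (h1.trans ?_) (hR y)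
            gcongr
        _ = 3 ^ 10 * 8 * δ * (len l0 (k - 1) * R y) := by ring
        _ = 3 ^ 10 * 8 * δ := by
            simp only [R]; rw [mul_inv_cancel₀ h3.ne', mul_one]
        _ ≤ _ := by gcongr; norm_num
    · rw [Finset.not_nonempty_iff_eq_empty.1 hne]
      simp; positivity
  calc ∑ x ∈ E', W x ≤ ∑ x ∈ E', ∑ y ∈ scell l0 S n x, R y * M y := by
        refine Finset.sum_le_sum fun x hx => ?_
        have hlt := (Finset.mem_filter.1 hx).2.1
        calc W x = ∑ y ∈ scell l0 S n x, R x * W x := by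
              rw [Finset.sum_const, nsmul_eq_mul, scell, card_cell, ← mul_assoc,
                mul_inv_cancel₀ (len_pos _).ne', one_mul]
          _ ≤ _ := by
              refine Finset.sum_le_sum fun y hy => ?_
              have h2 : R y = R x := by simp only [R]; rw [haltScale_of_mem_scell hy]
              rw [h2]
              exact mul_le_mul_of_nonneg_left (hW x y hy hlt) (hR x)
    _ = ∑ y ∈ E'.biUnion (scell l0 S n), ((E'.filter (fun x => x ∈ scell l0 S n y)).card * R y) * M y := by
        rw [sum_scell_swap]
        refine Finset.sum_congr rfl fun y _ => ?_
        rw [Finset.sum_const, nsmul_eq_mul]; ring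
    _ ≤ ∑ y ∈ E'.biUnion (scell l0 S n), 2 ^ 19 * δ * M y :=
        Finset.sum_le_sum fun y _ => mul_le_mul_of_nonneg_right (count y) (hM y)
    _ ≤ ∑ y ∈ T.triple l0, 2 ^ 19 * δ * M y := by
        refine Finset.sum_le_sum_of_subset_of_nonneg ?_ fun y _ _ => mul_nonneg (by positivity) (hM y)
        intro y hy
        obtain ⟨x, hx, hxy⟩ := Finset.mem_biUnion.1 hy
        exact mem_triple_of_stop hS (Finset.mem_filter.1 hx).2.1 hxy
    _ = _ := by rw [Finset.mul_sum]

end tree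

section tree
variable {l0 : ℕ} [NeZero l0] {S : Finset Tile} {T : Top} {E : Finset ℤ} {P : ℤ → ℕ → Prop}
  {δ σ K : ℝ} {φ : Tile → ℤ → ℂ} {c : Tile → ℂ}

lemma norm_coef_mul_le (h : Packets l0 φ K) {s : Tile} (hc : ‖c s‖ ≤ σ * √(len l0 s.i)) (x : ℤ) :
    ‖c s * φ s x‖ ≤ K * σ * wt (len l0 s.i) s.a x ^ 20 := by
  have hl := Real.sqrt_pos.2 (len_pos (l0 := l0) s.i)
  have hK := h.nonneg
  have hw : 0 ≤ wt (len l0 s.i) s.a x ^ 20 := pow_nonneg (wt_nonneg _ _ _) _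
  rw [norm_mul]
  calc _ ≤ (σ * √(len l0 s.i)) * (K / √(len l0 s.i) * wt (len l0 s.i) s.a x ^ 20) :=
        mul_le_mul hc (h.decay s x) (norm_nonneg _) ((norm_nonneg _).trans hc)
    _ = _ := by field_simp

lemma small_norm_le (h : Packets l0 φ K) (hS : ∀ s ∈ S, T.In l0 s)
    (hD : ∀ s ∈ S, ∀ j, s.i ≤ j →
      ∑ x ∈ E with P x j, wt (len l0 j) (s.a / 8 ^ (j - s.i)) x ^ 10 ≤ δ * len l0 j)
    (hδ : 0 ≤ δ) (hσ : 0 ≤ σ) (hc : ∀ s ∈ S, ‖c s‖ ≤ σ * √(len l0 s.i))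
    (Q : ℤ → Tile → Prop) (hQ : ∀ x s, Q x s → P x s.i) :
    ∑ x ∈ E, ‖∑ s ∈ S with s.i < haltScale l0 S (T.i + 1) x ∧ Q x s, c s * φ s x‖ ≤
      2 ^ 18 * K * (σ * δ * len l0 T.i) := by
  have hK := h.nonneg
  calc _ ≤ ∑ x ∈ E, ∑ s ∈ S with s.i < haltScale l0 S (T.i + 1) x ∧ P x s.i,
        K * σ * wt (len l0 s.i) s.a x ^ 20 := by
        refine Finset.sum_le_sum fun x _ => (norm_sum_le _ _).trans ?_
        refine (Finset.sum_le_sum fun s hs =>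
          norm_coef_mul_le h (hc s (Finset.mem_filter.1 hs).1) x).trans ?_
        refine Finset.sum_le_sum_of_subset_of_nonneg (fun s hs => ?_) fun s _ _ =>
          mul_nonneg (mul_nonneg hK hσ) (pow_nonneg (wt_nonneg _ _ _) _)
        simp only [Finset.mem_filter] at hs ⊢
        exact ⟨hs.1, hs.2.1, hQ x s hs.2.2⟩
    _ ≤ K * σ * (2 ^ 18 * δ * len l0 T.i) := by
        simp_rw [← Finset.mul_sum]
        exact mul_le_mul_of_nonneg_left (sum_small_le hS hD hδ) (mul_nonneg hK hσ)
    _ = _ := by ring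

lemma norm_sum_split_le (x : ℤ) (k : ℕ) (Q : Tile → Prop) :
    ‖∑ s ∈ S with Q s, c s * φ s x‖ ≤ ‖∑ s ∈ S with s.i < k ∧ Q s, c s * φ s x‖ +
      ‖∑ s ∈ S with k ≤ s.i ∧ Q s, c s * φ s x‖ := by
  refine le_trans (le_of_eq ?_) (norm_add_le _ _)
  congr 1
  rw [← Finset.sum_filter_add_sum_filter_not (S.filter Q) (fun s => s.i < k)]
  simp only [Finset.filter_filter, not_lt, and_comm]

/-- Truncation of a lacunary sum at a scale is a controlled convolution. -/
lemma norm_trunc_le (h : Packets l0 φ K) (hS : ∀ s ∈ S, T.Lac l0 s ∧ s.Valid l0) {k : ℕ} (x y : ℤ)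
    (hxy : |(y : ℝ) - x| ≤ len l0 k) {B : ℝ} (hB : ∀ z, ‖∑ s ∈ S, c s * φ s z‖ ≤ B) :
    ‖∑ s ∈ S with k ≤ s.i, c s * φ s x‖ ≤
      4 * K * ∑' z, avgK (len l0 k) y z * ‖∑ s ∈ S, c s * φ s z‖ := by
  have hl := len_pos (l0 := l0) k
  have hK := h.nonneg
  have hsum := summable_avgK_mul (one_le_len (l0 := l0) k) y (fun z => norm_nonneg _) hB
  have hn : 0 ≤ ∑' z, avgK (len l0 k) y z * ‖∑ s ∈ S, c s * φ s z‖ :=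
    tsum_nonneg fun z => mul_nonneg (avgK_nonneg (one_le_len k) _ _) (norm_nonneg _)
  rcases S.eq_empty_or_nonempty with rfl | ⟨s0, hs0⟩
  · simp
  have hξ : 0 ≤ T.ξ ∧ T.ξ < 1 := by
    obtain ⟨⟨⟨-, -, h1⟩, -⟩, h2, h3⟩ := hS s0 hs0
    rw [← h1] at h2 h3
    have hp := len_pos (l0 := l0) s0.i
    have h4 := Int.floor_nonneg.1 h2
    have h5 := Int.floor_lt.1 h3
    rw [sc_cast] at h5
    exact ⟨nonneg_of_mul_nonneg_right h4 hp, by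
      by_contra hh
      push Not at hh
      nlinarith⟩
  obtain ⟨L, hL, hr⟩ := h.repro k T.ξ hξ.1 hξ.2
  have hS2 : HasSum (fun z => ∑ s ∈ S, c s * (φ s z * L (x - z)))
      (∑ s ∈ S, c s * (if k ≤ s.i then φ s x else 0)) := by
    refine hasSum_sum fun s hs => ?_
    obtain ⟨h1, h2⟩ := hr s (hS s hs).2 (hS s hs).1.1.2.2
    split_ifs with hk
    · exact (h1 hk x).mul_left _
    · exact (h2 (by omega) (hS s hs).1.2 x).mul_left _
  have e1 : ∑ s ∈ S, c s * (if k ≤ s.i then φ s x else 0) = ∑ s ∈ S with k ≤ s.i, c s * φ s x := by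
    rw [Finset.sum_filter]
    exact Finset.sum_congr rfl fun s _ => by split_ifs <;> simp
  rw [← e1, ← hS2.tsum_eq, ← tsum_mul_left]
  refine tsum_of_norm_bounded (hsum.mul_left _).hasSum fun z => ?_
  have e2 : ∑ s ∈ S, c s * (φ s z * L (x - z)) = (∑ s ∈ S, c s * φ s z) * L (x - z) := by
    rw [Finset.sum_mul]
    exact Finset.sum_congr rfl fun s _ => by ring
  rw [e2, norm_mul]
  have h3 : avgK (len l0 k) x z ≤ 2 ^ 2 * avgK (len l0 k) y z := by
    refine avgK_le_of (one_le_len k) ?_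
    have h4 : |(y : ℝ) - z| / len l0 k ≤ 1 + |(x : ℝ) - z| / len l0 k := by
      rw [div_le_iff₀ hl, add_mul, one_mul, div_mul_cancel₀ _ hl.ne']
      have := abs_sub_le (y : ℝ) x z
      linarith
    have h5 : 0 ≤ |(x : ℝ) - z| / len l0 k := by positivity
    linarith
  have h6 := hL (x - z)
  have h7 : ‖L (x - z)‖ ≤ K * avgK (len l0 k) x z := by
    unfold avgK; push_cast at h6; exact h6
  calc _ ≤ ‖∑ s ∈ S, c s * φ s z‖ * (K * (2 ^ 2 * avgK (len l0 k) y z)) := by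
        refine mul_le_mul_of_nonneg_left (h7.trans ?_) (norm_nonneg _)
        exact mul_le_mul_of_nonneg_left h3 hK
    _ = _ := by ring

lemma norm_lac_le (h : Packets l0 φ K) (hS : ∀ s ∈ S, T.Lac l0 s ∧ s.Valid l0) :
    ∃ B, ∀ z, ‖∑ s ∈ S, c s * φ s z‖ ≤ B := by
  refine ⟨√(2 ^ 22 * K ^ 2 * ∑ s ∈ S, ‖c s‖ ^ 2), fun z => Real.le_sqrt_of_sq_le ?_⟩
  simpa using sum_sq_lac_le h T S hS c {z}

/-- Lacunary trees with a scale restriction depending on the point. -/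
lemma sum_lac_le (h : Packets l0 φ K) (hS : ∀ s ∈ S, T.Lac l0 s ∧ s.Valid l0)
    (hP : ∀ x i, P x (i + 1) → P x i)
    (hD : ∀ s ∈ S, ∀ j, s.i ≤ j →
      ∑ x ∈ E with P x j, wt (len l0 j) (s.a / 8 ^ (j - s.i)) x ^ 10 ≤ δ * len l0 j)
    (hδ : 0 ≤ δ) (hσ : 0 ≤ σ) (hc : ∀ s ∈ S, ‖c s‖ ≤ σ * √(len l0 s.i)) :
    ∑ x ∈ E, ‖∑ s ∈ S with P x s.i, c s * φ s x‖ ≤ 2 ^ 18 * K * (σ * δ * len l0 T.i) +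
      2 ^ 39 * K ^ 2 * δ * (√(len l0 T.i) * √(∑ s ∈ S, ‖c s‖ ^ 2)) := by
  have hK := h.nonneg
  set n := T.i + 1 with hn
  have hIn : ∀ s ∈ S, T.In l0 s := fun s hs => (hS s hs).1.1
  have hPm : ∀ x i j, i ≤ j → P x j → P x i := fun x i j hij => by
    induction j, hij using Nat.le_induction with
    | base => exact id
    | succ j _ ih => exact fun h => ih (hP x j h)
  obtain ⟨B, hB⟩ := norm_lac_le (c := c) h hS
  let F : ℕ → ℤ → ℝ := fun k y => ∑' z, avgK (len l0 k) y z * ‖∑ s ∈ S, c s * φ s z‖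
  have hF0 : ∀ k y, 0 ≤ F k y := fun k y =>
    tsum_nonneg fun z => mul_nonneg (avgK_nonneg (one_le_len k) _ _) (norm_nonneg _)
  have hmax : ∀ y, ∃ k, ∀ k' ≤ n, F k' y ≤ F k y := fun y => by
    obtain ⟨k, -, hk⟩ := Finset.exists_max_image (Finset.range (n + 1)) (fun k => F k y) ⟨0, by simp⟩
    exact ⟨k, fun k' hk' => hk k' (by simp; omega)⟩
  choose m hm using hmax
  have hW : ∀ x, ∀ y ∈ scell l0 S n x, haltScale l0 S n x < n →
      ‖∑ s ∈ S with haltScale l0 S n x ≤ s.i ∧ P x s.i, c s * φ s x‖ ≤ 8 * K * F (m y) y := by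
    intro x y hy hlt
    set k := haltScale l0 S n x with hk
    have hdist : ∀ j, k ≤ j → |(y : ℝ) - x| ≤ len l0 j := fun j hj => by
      obtain ⟨x1, x2⟩ := (mem_cell_iff (l0 := l0) (x := x) (k - 1)).1 rfl
      obtain ⟨y1, y2⟩ := (mem_cell_iff (l0 := l0) (x := y) (k - 1)).1 (mem_scell.1 hy)
      have := len_mono (l0 := l0) (show k - 1 ≤ j by omega)
      rw [abs_le]; constructor <;> linarith
    have htr : ∀ j, k ≤ j → j ≤ n → ‖∑ s ∈ S with j ≤ s.i, c s * φ s x‖ ≤ 4 * K * F (m y) y := by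
      intro j hj hjn
      refine (norm_trunc_le h hS x y (hdist j hj) hB).trans ?_
      exact mul_le_mul_of_nonneg_left (hm y j hjn) (by positivity)
    have hex : ∃ j, j = n ∨ ¬ P x j := ⟨n, Or.inl rfl⟩
    set t := Nat.find hex with ht
    have htn : t ≤ n := Nat.find_min' hex (Or.inl rfl)
    have hPt : ∀ i, i < n → (P x i ↔ i < t) := by
      intro i hi
      constructor
      · intro hp
        by_contra hti
        rcases Nat.find_spec hex with h1 | h1
        · omega
        · exact h1 (hPm x _ i (by omega) hp)
      · intro hit
        by_contra hp
        exact Nat.find_min hex hit (Or.inr hp)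
    by_cases hkt : k ≤ t
    · have e : ∑ s ∈ S with k ≤ s.i ∧ P x s.i, c s * φ s x =
          ∑ s ∈ S with k ≤ s.i, c s * φ s x - ∑ s ∈ S with t ≤ s.i, c s * φ s x := by
        rw [eq_sub_iff_add_eq,
          ← Finset.sum_filter_add_sum_filter_not (S.filter (fun s => k ≤ s.i)) (fun s => P x s.i)]
        simp only [Finset.filter_filter]
        congr 1
        refine Finset.sum_congr (Finset.filter_congr fun s hs => ?_) fun _ _ => rfl
        have := hPt s.i (by have := (hIn s hs).1; omega)
        rw [this]
        omega
      rw [e]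
      refine (norm_sub_le _ _).trans ?_
      linarith [htr k le_rfl haltScale_le, htr t hkt htn]
    · rw [Finset.filter_false_of_mem]
      · simp only [Finset.sum_empty, norm_zero]
        have := hF0 (m y) y
        positivity
      · rintro s hs ⟨h1, h2⟩
        rw [hPt s.i (by have := (hIn s hs).1; omega)] at h2
        omega
  have hlarge := sum_large_le hIn hD hδ
    (fun x => ‖∑ s ∈ S with haltScale l0 S n x ≤ s.i ∧ P x s.i, c s * φ s x‖)
    (fun y => 8 * K * F (m y) y) (fun y => mul_nonneg (by positivity) (hF0 _ _)) hW
  have hzero : ∑ x ∈ E, ‖∑ s ∈ S with haltScale l0 S n x ≤ s.i ∧ P x s.i, c s * φ s x‖ =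
      ∑ x ∈ E with haltScale l0 S n x < n ∧ P x (haltScale l0 S n x),
        ‖∑ s ∈ S with haltScale l0 S n x ≤ s.i ∧ P x s.i, c s * φ s x‖ := by
    rw [Finset.sum_filter_of_ne]
    intro x _ hne
    by_contra hcon
    apply hne
    rw [Finset.filter_false_of_mem, Finset.sum_empty, norm_zero]
    rintro s hs ⟨h1, h2⟩
    exact hcon ⟨by have := (hIn s hs).1; omega, hPm x _ _ h1 h2⟩
  have hmaxi := sum_avgK_maximal_le (T.triple l0) (fun _ => 1) (fun _ => zero_le_one)
    (fun y => len l0 (m y)) (fun y => one_le_len _) _ (fun z => norm_nonneg _) _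
    (sum_sq_lac_le h T S hS c)
  simp only [one_pow, Finset.sum_const, nsmul_eq_mul, mul_one, card_triple, one_mul] at hmaxi
  have hsq : √(3 * len l0 T.i) * √(2 ^ 22 * K ^ 2 * ∑ s ∈ S, ‖c s‖ ^ 2) ≤
      2 ^ 12 * K * (√(len l0 T.i) * √(∑ s ∈ S, ‖c s‖ ^ 2)) := by
    have h3 : √(3 : ℝ) ≤ 2 := by rw [Real.sqrt_le_left (by norm_num)]; norm_num
    rw [Real.sqrt_mul (by norm_num), Real.sqrt_mul (by positivity),
      show (2 : ℝ) ^ 22 * K ^ 2 = (2 ^ 11 * K) ^ 2 by ring, Real.sqrt_sq (by positivity)]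
    calc _ = √3 * (2 ^ 11 * K * (√(len l0 T.i) * √(∑ s ∈ S, ‖c s‖ ^ 2))) := by ring
      _ ≤ 2 * (2 ^ 11 * K * (√(len l0 T.i) * √(∑ s ∈ S, ‖c s‖ ^ 2))) := by gcongr
      _ = _ := by ring
  have hsmall := small_norm_le h hIn hD hδ hσ hc (fun x s => P x s.i) (fun _ _ hq => hq)
  calc _ ≤ ∑ x ∈ E, (‖∑ s ∈ S with s.i < haltScale l0 S n x ∧ P x s.i, c s * φ s x‖ +
        ‖∑ s ∈ S with haltScale l0 S n x ≤ s.i ∧ P x s.i, c s * φ s x‖) :=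
        Finset.sum_le_sum fun x _ => norm_sum_split_le x _ _
    _ ≤ 2 ^ 18 * K * (σ * δ * len l0 T.i) + 2 ^ 19 * δ * ∑ y ∈ T.triple l0, 8 * K * F (m y) y := by
        rw [Finset.sum_add_distrib, hzero]
        exact add_le_add hsmall hlarge
    _ ≤ _ := by
        rw [← Finset.mul_sum]
        have : ∑ y ∈ T.triple l0, F (m y) y ≤
            32 * (2 ^ 12 * K * (√(len l0 T.i) * √(∑ s ∈ S, ‖c s‖ ^ 2))) := by
          refine hmaxi.trans ?_
          rw [mul_assoc]
          exact mul_le_mul_of_nonneg_left hsq (by norm_num)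
        calc _ ≤ 2 ^ 18 * K * (σ * δ * len l0 T.i) + 2 ^ 19 * δ * (8 * K *
              (32 * (2 ^ 12 * K * (√(len l0 T.i) * √(∑ s ∈ S, ‖c s‖ ^ 2))))) := by gcongr
          _ = _ := by ring

end tree

/-- The tile is active at `x` for the frequency choice `N`. -/
def Act (l0 : ℕ) (N : ℤ → ℝ) (x : ℤ) (s : Tile) : Prop := ⌊len l0 (s.i + 1) * N x⌋ = 8 * s.b + 7

/-- The order on tiles. -/
def TileLE (s t : Tile) : Prop :=
  s.i ≤ t.i ∧ s.a / 8 ^ (t.i - s.i) = t.a ∧ t.b / 8 ^ (t.i - s.i) = s.b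

/-- The mass of `E` under a tile. -/
noncomputable def mass (l0 : ℕ) (E : Finset ℤ) (N : ℤ → ℝ) (t : Tile) : ℝ :=
  ∑ x ∈ E with ⌊len l0 t.i * N x⌋ = t.b, wt (len l0 t.i) t.a x ^ 10

/-- The density of the family is at most `δ`. -/
def Dens (l0 : ℕ) (E : Finset ℤ) (N : ℤ → ℝ) (δ : ℝ) (S : Finset Tile) : Prop :=
  ∀ s ∈ S, ∀ t, TileLE s t → mass l0 E N t ≤ δ * len l0 t.i

/-- The size of the family is at most `σ`. -/
def Size (l0 : ℕ) (c : Tile → ℂ) (σ : ℝ) (S : Finset Tile) : Prop :=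
  ∀ T : Top, ∑ s ∈ S with T.Lac l0 s, ‖c s‖ ^ 2 ≤ σ ^ 2 * len l0 T.i

/-- The model operator. -/
noncomputable def modelOp (l0 : ℕ) (N : ℤ → ℝ) (c : Tile → ℂ) (ψ : Tile → ℤ → ℂ) (S : Finset Tile)
    (x : ℤ) : ℂ := ∑ s ∈ S with Act l0 N x s, c s * ψ s x

section
variable {l0 : ℕ} {S S' : Finset Tile} {E : Finset ℤ} {N : ℤ → ℝ}
  {δ σ K : ℝ} {φ : Tile → ℤ → ℂ} {c : Tile → ℂ}

lemma Dens.mono (h : Dens l0 E N δ S) (hS : S' ⊆ S) : Dens l0 E N δ S' :=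
  fun s hs => h s (hS hs)

lemma Size.mono (h : Size l0 c σ S) (hS : S' ⊆ S) : Size l0 c σ S' := fun T =>
  (Finset.sum_le_sum_of_subset_of_nonneg (Finset.filter_subset_filter _ hS)
    fun _ _ _ => sq_nonneg _).trans (h T)

variable [NeZero l0] {T : Top}

/-- The left endpoint of the marked child of a tile. -/
noncomputable def Tile.left (l0 : ℕ) (s : Tile) : ℝ := (8 * s.b + 7) / len l0 (s.i + 1)

lemma Tile.floor_left (s : Tile) : ⌊len l0 (s.i + 1) * s.left l0⌋ = 8 * s.b + 7 := by
  rw [Tile.left, mul_div_cancel₀ _ (len_pos _).ne']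
  exact_mod_cast Int.floor_intCast (8 * s.b + 7)

lemma floor_of_act {ξ : ℝ} {i : ℕ} {b : ℤ} (h : ⌊len l0 (i + 1) * ξ⌋ = 8 * b + 7) :
    ⌊len l0 i * ξ⌋ = b := by
  rw [floor_len_add ξ i 1, h]; omega

lemma lac_self (s : Tile) : Top.Lac l0 ⟨s.i, s.a, s.left l0⟩ s :=
  ⟨⟨le_rfl, by simp, floor_of_act s.floor_left⟩, s.floor_left⟩

lemma Size.coef_le (h : Size l0 c σ S) (hσ : 0 ≤ σ) {s : Tile} (hs : s ∈ S) :
    ‖c s‖ ≤ σ * √(len l0 s.i) := by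
  have h1 := h ⟨s.i, s.a, s.left l0⟩
  have h2 : ‖c s‖ ^ 2 ≤ σ ^ 2 * len l0 s.i :=
    (Finset.single_le_sum (f := fun s => ‖c s‖ ^ 2) (fun _ _ => sq_nonneg _)
      (Finset.mem_filter.2 ⟨hs, lac_self s⟩)).trans h1
  rw [← Real.sqrt_sq hσ, ← Real.sqrt_mul (sq_nonneg σ)]
  exact Real.le_sqrt_of_sq_le h2

/-- The estimate for a single tree. -/
lemma tree_le (h : Packets l0 φ K) (hS : ∀ s ∈ S, T.In l0 s ∧ s.Valid l0)
    (hD : Dens l0 E N δ S) (hσS : Size l0 c σ S) (hδ : 0 ≤ δ) (hσ : 0 ≤ σ) :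
    ∑ x ∈ E, ‖modelOp l0 N c φ S x‖ ≤ 2 ^ 40 * (K + K ^ 2) * (σ * δ * len l0 T.i) := by
  have hK := h.nonneg
  have hl := len_pos (l0 := l0) T.i
  obtain ⟨A, hAdef⟩ : ∃ A : ℤ → ℕ → Prop, A = fun x i => ⌊len l0 i * N x⌋ = ⌊len l0 i * T.ξ⌋ :=
    ⟨_, rfl⟩
  have hA : ∀ x i, A x (i + 1) → A x i := fun x i hx => by
    simp only [hAdef] at hx ⊢
    rw [floor_len_add (N x) i 1, floor_len_add T.ξ i 1, hx]
  have hDA : ∀ s ∈ S, ∀ j, s.i ≤ j →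
      ∑ x ∈ E with A x j, wt (len l0 j) (s.a / 8 ^ (j - s.i)) x ^ 10 ≤ δ * len l0 j := by
    intro s hs j hj
    refine le_trans (le_of_eq ?_) (hD s hs ⟨j, s.a / 8 ^ (j - s.i), ⌊len l0 j * T.ξ⌋⟩ ⟨hj, rfl, ?_⟩)
    · exact Finset.sum_congr (by ext; simp [hAdef]) fun _ _ => rfl
    rw [← (hS s hs).1.2.2, floor_len_le hj T.ξ]
  have hDA1 : ∀ s ∈ S, ∀ j, s.i ≤ j →
      ∑ x ∈ E with A x (j + 1), wt (len l0 j) (s.a / 8 ^ (j - s.i)) x ^ 10 ≤ δ * len l0 j := by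
    intro s hs j hj
    refine le_trans (Finset.sum_le_sum_of_subset_of_nonneg (fun x hx => ?_) fun _ _ _ =>
      pow_nonneg (wt_nonneg _ _ _) _) (hDA s hs j hj)
    rw [Finset.mem_filter] at hx ⊢
    exact ⟨hx.1, hA x j hx.2⟩
  have hc : ∀ s ∈ S, ‖c s‖ ≤ σ * √(len l0 s.i) := fun s hs => hσS.coef_le hσ hs
  set S1 := S.filter (fun s => T.Lac l0 s) with hS1
  set S2 := S.filter (fun s => ¬ T.Lac l0 s) with hS2
  have m1 : ∀ s ∈ S1, s ∈ S := fun s hs => (Finset.mem_filter.1 hs).1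
  have m2 : ∀ s ∈ S2, s ∈ S := fun s hs => (Finset.mem_filter.1 hs).1
  have hact : ∀ x, modelOp l0 N c φ S x = ∑ s ∈ S1 with A x (s.i + 1), c s * φ s x +
      ∑ s ∈ S2 with Act l0 N x s, c s * φ s x := by
    intro x
    rw [modelOp, ← Finset.sum_filter_add_sum_filter_not _ (fun s => T.Lac l0 s)]
    rw [Finset.filter_comm, Finset.filter_comm (p := fun s => ¬ T.Lac l0 s)]
    congr 1
    refine Finset.sum_congr (Finset.filter_congr fun s hs => ?_) fun _ _ => rfl
    simp only [hAdef, (Finset.mem_filter.1 hs).2.2, Act]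
  have hlac : ∑ x ∈ E, ‖∑ s ∈ S1 with A x (s.i + 1), c s * φ s x‖ ≤
      2 ^ 18 * K * (σ * δ * len l0 T.i) + 2 ^ 39 * K ^ 2 * (σ * δ * len l0 T.i) := by
    refine (sum_lac_le (P := fun x i => A x (i + 1)) h
      (fun s hs => ⟨(Finset.mem_filter.1 hs).2, (hS s (m1 s hs)).2⟩)
      (fun x i => hA x (i + 1)) (fun s hs => hDA1 s (m1 s hs)) hδ hσ
      (fun s hs => hc s (m1 s hs))).trans ?_
    have h1 : √(∑ s ∈ S1, ‖c s‖ ^ 2) ≤ σ * √(len l0 T.i) := by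
      refine (Real.sqrt_le_sqrt (hσS T)).trans (le_of_eq ?_)
      rw [Real.sqrt_mul (sq_nonneg _), Real.sqrt_sq hσ]
    have h2 : √(len l0 T.i) * √(∑ s ∈ S1, ‖c s‖ ^ 2) ≤ σ * len l0 T.i := by
      calc _ ≤ √(len l0 T.i) * (σ * √(len l0 T.i)) := by gcongr
        _ = σ * (√(len l0 T.i) * √(len l0 T.i)) := by ring
        _ = _ := by rw [Real.mul_self_sqrt hl.le]
    have : 2 ^ 39 * K ^ 2 * δ * (√(len l0 T.i) * √(∑ s ∈ S1, ‖c s‖ ^ 2)) ≤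
        2 ^ 39 * K ^ 2 * δ * (σ * len l0 T.i) := by gcongr
    linarith
  have hIn2 : ∀ s ∈ S2, T.In l0 s := fun s hs => (hS s (m2 s hs)).1
  have hQ : ∀ x s, (s ∈ S2 ∧ Act l0 N x s) → A x s.i ∧ ¬ A x (s.i + 1) := by
    rintro x s ⟨hs, hx⟩
    have h1 := hIn2 s hs
    refine ⟨?_, fun h2 => ?_⟩
    · simp only [hAdef]; rw [h1.2.2, floor_of_act hx]
    · exact (Finset.mem_filter.1 hs).2 ⟨h1, by simp only [hAdef] at h2; rw [← h2]; exact hx⟩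
  have hAm : ∀ x i j, i ≤ j → A x j → A x i := fun x i j hij => by
    induction j, hij using Nat.le_induction with
    | base => exact id
    | succ j _ ih => exact fun h => ih (hA x j h)
  have hone : ∀ x k, ‖∑ s ∈ S2 with k ≤ s.i ∧ Act l0 N x s, c s * φ s x‖ ≤ 4 * (K * σ) := by
    intro x k
    set V := S2.filter (fun s => k ≤ s.i ∧ Act l0 N x s) with hV
    have hVi : ∃ i, ∀ s ∈ V, s.i = i := by
      rcases V.eq_empty_or_nonempty with hv | ⟨s0, hs0⟩
      · exact ⟨0, by simp [hv]⟩
      · refine ⟨s0.i, fun s hs => ?_⟩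
        have q0 := hQ x s0 ⟨(Finset.mem_filter.1 hs0).1, (Finset.mem_filter.1 hs0).2.2⟩
        have q1 := hQ x s ⟨(Finset.mem_filter.1 hs).1, (Finset.mem_filter.1 hs).2.2⟩
        by_contra hne
        rcases Nat.lt_or_gt_of_ne hne with hlt | hlt
        · exact q1.2 (hAm x _ _ hlt q0.1)
        · exact q0.2 (hAm x _ _ hlt q1.1)
    obtain ⟨i, hi⟩ := hVi
    have hVS : ∀ s ∈ V, s ∈ S := fun s hs => m2 s (Finset.mem_filter.1 hs).1
    calc _ ≤ ∑ s ∈ V, K * σ * wt (len l0 s.i) s.a x ^ 2 :=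
          norm_sum_le_of_le _ fun s hs => (norm_coef_mul_le h (hc s (hVS s hs)) x).trans
            (mul_le_mul_of_nonneg_left (wt_pow_anti _ _ _ (by norm_num)) (by positivity))
      _ = K * σ * ∑ s ∈ V with s.i = i, wt (len l0 s.i) s.a x ^ 2 := by
          rw [Finset.mul_sum, Finset.filter_true_of_mem hi]
      _ ≤ K * σ * 4 := mul_le_mul_of_nonneg_left
          (sum_scale_le (fun s hs => (hS s (hVS s hs)).1) i x) (by positivity)
      _ = _ := by ring
  have hsmall := small_norm_le h hIn2 (fun s hs => hDA s (m2 s hs)) hδ hσ (fun s hs => hc s (m2 s hs))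
    (fun x s => s ∈ S2 ∧ Act l0 N x s) (fun x s hq => (hQ x s hq).1)
  have hsmall' : ∑ x ∈ E, ‖∑ s ∈ S2 with s.i < haltScale l0 S2 (T.i + 1) x ∧ Act l0 N x s, c s * φ s x‖ ≤
      2 ^ 18 * K * (σ * δ * len l0 T.i) := by
    refine le_trans (le_of_eq (Finset.sum_congr rfl fun x _ => ?_)) hsmall
    congr 1
    refine Finset.sum_congr (by ext s; simp only [Finset.mem_filter]; tauto) fun _ _ => rfl
  have hlarge := sum_large_le hIn2 (fun s hs => hDA s (m2 s hs)) hδ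
    (fun x => ‖∑ s ∈ S2 with haltScale l0 S2 (T.i + 1) x ≤ s.i ∧ Act l0 N x s, c s * φ s x‖)
    (fun _ => 4 * (K * σ)) (fun y => by positivity) (fun x y _ _ => hone x _)
  have hzero : ∑ x ∈ E, ‖∑ s ∈ S2 with haltScale l0 S2 (T.i + 1) x ≤ s.i ∧ Act l0 N x s, c s * φ s x‖ =
      ∑ x ∈ E with haltScale l0 S2 (T.i + 1) x < T.i + 1 ∧ A x (haltScale l0 S2 (T.i + 1) x),
        ‖∑ s ∈ S2 with haltScale l0 S2 (T.i + 1) x ≤ s.i ∧ Act l0 N x s, c s * φ s x‖ := by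
    rw [Finset.sum_filter_of_ne]
    intro x _ hne
    by_contra hcon
    apply hne
    rw [Finset.filter_false_of_mem, Finset.sum_empty, norm_zero]
    rintro s hs ⟨h1, h2⟩
    exact hcon ⟨by have := (hIn2 s hs).1; omega, hAm x _ _ h1 (hQ x s ⟨hs, h2⟩).1⟩
  have hnl : ∑ x ∈ E, ‖∑ s ∈ S2 with Act l0 N x s, c s * φ s x‖ ≤ 2 ^ 24 * K * (σ * δ * len l0 T.i) := by
    calc _ ≤ ∑ x ∈ E, (‖∑ s ∈ S2 with s.i < haltScale l0 S2 (T.i + 1) x ∧ Act l0 N x s, c s * φ s x‖ +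
          ‖∑ s ∈ S2 with haltScale l0 S2 (T.i + 1) x ≤ s.i ∧ Act l0 N x s, c s * φ s x‖) :=
          Finset.sum_le_sum fun x _ => norm_sum_split_le x _ _
      _ ≤ 2 ^ 18 * K * (σ * δ * len l0 T.i) + 2 ^ 19 * δ * ∑ y ∈ T.triple l0, 4 * (K * σ) := by
          rw [Finset.sum_add_distrib, hzero]
          exact add_le_add hsmall' hlarge
      _ = (2 ^ 18 + 2 ^ 19 * 12) * K * (σ * δ * len l0 T.i) := by
          rw [Finset.sum_const, nsmul_eq_mul, card_triple]; ring
      _ ≤ _ := by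
          have : 0 ≤ K * (σ * δ * len l0 T.i) := by positivity
          nlinarith
  calc _ ≤ ∑ x ∈ E, (‖∑ s ∈ S1 with A x (s.i + 1), c s * φ s x‖ +
        ‖∑ s ∈ S2 with Act l0 N x s, c s * φ s x‖) := by
        refine Finset.sum_le_sum fun x _ => ?_
        rw [hact]; exact norm_add_le _ _
    _ ≤ _ := by
        rw [Finset.sum_add_distrib]
        have p1 : 0 ≤ K * (σ * δ * len l0 T.i) := by positivity
        have p2 : 0 ≤ K ^ 2 * (σ * δ * len l0 T.i) := by positivity
        nlinarith

end

/-- The tiles are covered by trees of controlled total length. -/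
def Covered (l0 : ℕ) (S : Finset Tile) (L : ℝ) : Prop :=
  ∃ l : List Top, (∀ s ∈ S, ∃ T ∈ l, T.In l0 s) ∧ (l.map fun T => len l0 T.i).sum ≤ L

/-- The outcome of the greedy selection of lacunary trees. -/
structure Selection (l0 : ℕ) (c : Tile → ℂ) (σ : ℝ) (S S' : Finset Tile) (tops : Finset Top)
    (sel : Finset Tile) (τ : Tile → Top) : Prop where
  sub : S' ⊆ S
  sel_sub : sel ⊆ S
  cover : ∀ s ∈ S \ S', ∃ T ∈ tops, T.In l0 s
  size : Size l0 c σ S'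
  mem : ∀ s ∈ sel, τ s ∈ tops
  lac : ∀ s ∈ sel, (τ s).Lac l0 s
  bad : ∀ T ∈ tops, σ ^ 2 * len l0 T.i < ∑ s ∈ S with T.Lac l0 s, ‖c s‖ ^ 2
  total : ∑ T ∈ tops, σ ^ 2 * len l0 T.i ≤ ∑ s ∈ sel, ‖c s‖ ^ 2
  key : ∀ s ∈ sel, ∀ t ∈ sel, t.i < s.i → s.b / 8 ^ (s.i - t.i) = t.b →
    s.b / 8 ^ (s.i - t.i - 1) ≠ 8 * t.b + 7 → t.a / 8 ^ ((τ s).i - t.i) ≠ (τ s).a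

section
variable {l0 : ℕ} [NeZero l0] {c : Tile → ℂ} {σ : ℝ}

lemma exists_min_bad (S : Finset Tile)
    (hbad : ∃ T : Top, σ ^ 2 * len l0 T.i < ∑ s ∈ S with T.Lac l0 s, ‖c s‖ ^ 2) :
    ∃ T : Top, σ ^ 2 * len l0 T.i < ∑ s ∈ S with T.Lac l0 s, ‖c s‖ ^ 2 ∧
      ∀ T' : Top, σ ^ 2 * len l0 T'.i < ∑ s ∈ S with T'.Lac l0 s, ‖c s‖ ^ 2 → T.ξ ≤ T'.ξ := by
  have reduce : ∀ T : Top, σ ^ 2 * len l0 T.i < ∑ s ∈ S with T.Lac l0 s, ‖c s‖ ^ 2 →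
      ∃ T' : Top, σ ^ 2 * len l0 T'.i < ∑ s ∈ S with T'.Lac l0 s, ‖c s‖ ^ 2 ∧
        T'.ξ ∈ S.image (Tile.left l0) ∧ T'.ξ ≤ T.ξ := by
    intro T hT
    have hne : (S.filter (fun s => T.Lac l0 s)).Nonempty := by
      rw [Finset.nonempty_iff_ne_empty]
      intro h
      rw [h, Finset.sum_empty] at hT
      exact absurd hT (not_lt.2 (mul_nonneg (sq_nonneg _) (len_pos _).le))
    obtain ⟨u, hu, humax⟩ := Finset.exists_max_image _ Tile.i hne
    obtain ⟨huS, huL⟩ := Finset.mem_filter.1 hu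
    have e : ∀ j ≤ u.i + 1, ⌊len l0 j * u.left l0⌋ = ⌊len l0 j * T.ξ⌋ := fun j hj => by
      rw [floor_len_le hj, floor_len_le hj T.ξ, u.floor_left, huL.2]
    refine ⟨⟨T.i, T.a, u.left l0⟩, hT.trans_le ?_, Finset.mem_image_of_mem _ huS, ?_⟩
    · refine Finset.sum_le_sum_of_subset_of_nonneg (fun s hs => ?_) fun _ _ _ => sq_nonneg _
      have hsu := humax s hs
      obtain ⟨hsS, hsL⟩ := Finset.mem_filter.1 hs
      refine Finset.mem_filter.2 ⟨hsS, ⟨hsL.1.1, hsL.1.2.1, ?_⟩, ?_⟩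
      · show ⌊len l0 s.i * u.left l0⌋ = s.b
        rw [e _ (by omega)]; exact hsL.1.2.2
      · show ⌊len l0 (s.i + 1) * u.left l0⌋ = _
        rw [e _ (by omega)]; exact hsL.2
    · show u.left l0 ≤ T.ξ
      rw [Tile.left, div_le_iff₀ (len_pos _), mul_comm T.ξ]
      have := Int.floor_le (len l0 (u.i + 1) * T.ξ)
      rw [huL.2] at this
      exact_mod_cast this
  set X := (S.image (Tile.left l0)).filter (fun ξ => ∃ T : Top,
    σ ^ 2 * len l0 T.i < ∑ s ∈ S with T.Lac l0 s, ‖c s‖ ^ 2 ∧ T.ξ = ξ) with hX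
  have hXne : X.Nonempty := by
    obtain ⟨T, hT⟩ := hbad
    obtain ⟨T', h1, h2, -⟩ := reduce T hT
    exact ⟨T'.ξ, Finset.mem_filter.2 ⟨h2, T', h1, rfl⟩⟩
  obtain ⟨ξ, hξ, hmin⟩ := X.exists_min_image id hXne
  obtain ⟨-, T, hT, rfl⟩ := Finset.mem_filter.1 hξ
  refine ⟨T, hT, fun T' hT' => ?_⟩
  obtain ⟨T'', h1, h2, h3⟩ := reduce T' hT'
  exact (hmin T''.ξ (Finset.mem_filter.2 ⟨h2, T'', h1, rfl⟩)).trans h3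

lemma exists_selection (n : ℕ) : ∀ S : Finset Tile, S.card ≤ n →
    ∃ S' tops sel τ, Selection l0 c σ S S' tops sel τ := by
  induction n with
  | zero =>
    intro S hS
    rw [Nat.le_zero, Finset.card_eq_zero] at hS
    subst hS
    refine ⟨∅, ∅, ∅, fun _ => ⟨0, 0, 0⟩, ⟨by simp, by simp, by simp, fun T => ?_, by simp, by simp,
      by simp, by simp, by simp⟩⟩
    simpa using mul_nonneg (sq_nonneg σ) (len_pos (l0 := l0) T.i).le
  | succ n ih =>
    intro S hS
    by_cases hbad : ∃ T : Top, σ ^ 2 * len l0 T.i < ∑ s ∈ S with T.Lac l0 s, ‖c s‖ ^ 2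
    swap
    · push Not at hbad
      exact ⟨S, ∅, ∅, fun _ => ⟨0, 0, 0⟩, ⟨by simp, by simp, by simp, hbad, by simp, by simp,
        by simp, by simp, by simp⟩⟩
    obtain ⟨T, hT, hmin⟩ := exists_min_bad S hbad
    set V := S.filter (fun s => T.Lac l0 s) with hV
    set R := S.filter (fun s => ¬ T.In l0 s) with hR
    have hVR : Disjoint V R := by
      rw [Finset.disjoint_left]
      intro s h1 h2
      exact (Finset.mem_filter.1 h2).2 (Finset.mem_filter.1 h1).2.1
    have hVne : V.Nonempty := by
      rw [Finset.nonempty_iff_ne_empty]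
      intro h
      rw [h, Finset.sum_empty] at hT
      exact absurd hT (not_lt.2 (mul_nonneg (sq_nonneg _) (len_pos _).le))
    have hcard : R.card ≤ n := by
      obtain ⟨s, hs⟩ := hVne
      have : R.card < S.card := Finset.card_lt_card
        ((Finset.filter_ssubset).2 ⟨s, (Finset.mem_filter.1 hs).1,
          not_not.2 (Finset.mem_filter.1 hs).2.1⟩)
      omega
    obtain ⟨S', tops, sel, τ, hsel⟩ := ih R hcard
    have hRS : R ⊆ S := Finset.filter_subset _ _
    have hbad' : ∀ T' ∈ tops, σ ^ 2 * len l0 T'.i < ∑ s ∈ S with T'.Lac l0 s, ‖c s‖ ^ 2 :=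
      fun T' hT' => (hsel.bad T' hT').trans_le (Finset.sum_le_sum_of_subset_of_nonneg
        (Finset.filter_subset_filter _ hRS) fun _ _ _ => sq_nonneg _)
    have hdisj : Disjoint V sel := hVR.mono_right hsel.sel_sub
    have hnV : ∀ s ∈ sel, s ∉ V := fun s hs hs' => Finset.disjoint_left.1 hdisj hs' hs
    refine ⟨S', insert T tops, V ∪ sel, fun s => if s ∈ V then T else τ s,
      ⟨hsel.sub.trans hRS, Finset.union_subset (Finset.filter_subset _ _) (hsel.sel_sub.trans hRS),
        ?_, hsel.size, ?_, ?_, ?_, ?_, ?_⟩⟩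
    · intro s hs
      obtain ⟨h1, h2⟩ := Finset.mem_sdiff.1 hs
      by_cases hin : T.In l0 s
      · exact ⟨T, Finset.mem_insert_self _ _, hin⟩
      · obtain ⟨T', h3, h4⟩ := hsel.cover s
          (Finset.mem_sdiff.2 ⟨Finset.mem_filter.2 ⟨h1, hin⟩, h2⟩)
        exact ⟨T', Finset.mem_insert_of_mem h3, h4⟩
    · intro s hs
      split_ifs with h
      · exact Finset.mem_insert_self _ _
      · exact Finset.mem_insert_of_mem (hsel.mem s ((Finset.mem_union.1 hs).resolve_left h))
    · intro s hs
      split_ifs with h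
      · exact (Finset.mem_filter.1 h).2
      · exact hsel.lac s ((Finset.mem_union.1 hs).resolve_left h)
    · intro T' hT'
      rcases Finset.mem_insert.1 hT' with rfl | h
      · exact hT
      · exact hbad' T' h
    · rw [Finset.sum_union hdisj]
      have h0 : ∀ T : Top, 0 ≤ σ ^ 2 * len l0 T.i :=
        fun T => mul_nonneg (sq_nonneg _) (len_pos _).le
      have : ∑ T' ∈ insert T tops, σ ^ 2 * len l0 T'.i ≤
          σ ^ 2 * len l0 T.i + ∑ T' ∈ tops, σ ^ 2 * len l0 T'.i := by
        by_cases h : T ∈ tops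
        · rw [Finset.insert_eq_of_mem h]; linarith [h0 T]
        · rw [Finset.sum_insert h]
      linarith [hsel.total]
    · intro s hs t ht hlt hb hb'
      rcases Finset.mem_union.1 hs with hsV | hs'
      · simp only [hsV, if_true]
        have hsL := (Finset.mem_filter.1 hsV).2
        rcases Finset.mem_union.1 ht with htV | ht'
        · exfalso
          have htL := (Finset.mem_filter.1 htV).2
          apply hb'
          rw [← hsL.1.2.2, ← htL.2, floor_len_le (by omega : t.i + 1 ≤ s.i)]
          congr 2
        · intro hcon
          refine (Finset.mem_filter.1 (hsel.sel_sub ht')).2 ⟨hlt.le.trans hsL.1.1, hcon, ?_⟩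
          rw [← hb, ← hsL.1.2.2, floor_len_le hlt.le]
      · simp only [hnV s hs', if_false]
        rcases Finset.mem_union.1 ht with htV | ht'
        · exfalso
          have htL := (Finset.mem_filter.1 htV).2
          have hsL := hsel.lac s hs'
          have hle := hmin _ (hbad' _ (hsel.mem s hs'))
          have h1 : ⌊len l0 (t.i + 1) * (τ s).ξ⌋ = s.b / 8 ^ (s.i - t.i - 1) := by
            rw [← hsL.1.2.2, floor_len_le (by omega : t.i + 1 ≤ s.i)]
            congr 2
          have h2 : ⌊len l0 (t.i + 1) * T.ξ⌋ ≤ ⌊len l0 (t.i + 1) * (τ s).ξ⌋ :=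
            Int.floor_le_floor (mul_le_mul_of_nonneg_left hle (len_pos _).le)
          have h3 : ⌊len l0 t.i * (τ s).ξ⌋ = t.b := by
            rw [← hb, ← hsL.1.2.2, floor_len_le hlt.le]
          rw [floor_len_add (τ s).ξ t.i 1, h1] at h3
          rw [htL.2, h1] at h2
          omega
        · exact hsel.key s hs' t ht' hlt hb (by assumption)

/-- Tails of the tiles of a tree outside of the top interval. -/
lemma sum_tail_le {S : Finset Tile} {T : Top} (hS : ∀ s ∈ S, T.In l0 s) (Y : Finset ℤ)
    (hY : ∀ y ∈ Y, y / sc l0 T.i ≠ T.a) {n : ℕ} (hn : 4 ≤ n) :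
    ∑ s ∈ S, ∑ y ∈ Y, wt (len l0 s.i) s.a y ^ n ≤ 2 ^ 6 * len l0 T.i := by
  have hT := len_pos (l0 := l0) T.i
  set L := (T.a : ℝ) * len l0 T.i with hL
  set R := ((T.a : ℝ) + 1) * len l0 T.i with hR
  let q : ℕ → ℤ → ℝ := fun i y => ((1 + |(y : ℝ) / len l0 i - L / len l0 i|)⁻¹) ^ 2 +
    ((1 + |(y : ℝ) / len l0 i - R / len l0 i|)⁻¹) ^ 2
  have hq : ∀ s ∈ S, ∀ y ∈ Y, wt (len l0 s.i) s.a y ^ 2 ≤ q s.i y := by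
    intro s hs y hy
    have hi := len_pos (l0 := l0) s.i
    obtain ⟨h1, h2⟩ := anc_bounds (l0 := l0) (hS s hs).1 s.a
    rw [(hS s hs).2.1] at h1 h2
    have hnot := mt (mem_cell_iff (l0 := l0) T.i).2 (hY y hy)
    rw [not_and_or, not_le, not_lt] at hnot
    have gen : ∀ X : ℝ, |(y : ℝ) - X| ≤ |(y : ℝ) - s.a * len l0 s.i| →
        wt (len l0 s.i) s.a y ^ 2 ≤ ((1 + |(y : ℝ) / len l0 s.i - X / len l0 s.i|)⁻¹) ^ 2 := by
      intro X hX
      refine pow_le_pow_left₀ (wt_nonneg _ _ _) ?_ 2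
      rw [wt_eq, ← sub_div, abs_div, abs_of_pos hi]
      gcongr
    rcases hnot with h | h
    · refine (gen L ?_).trans (le_add_of_nonneg_right (by positivity))
      rw [abs_sub_comm, abs_of_pos (by linarith), abs_sub_comm]
      exact (by linarith : L - y ≤ s.a * len l0 s.i - y).trans (le_abs_self _)
    · refine (gen R ?_).trans (le_add_of_nonneg_left (by positivity))
      rw [abs_of_nonneg (by linarith)]
      exact (by nlinarith : (y : ℝ) - R ≤ y - s.a * len l0 s.i).trans (le_abs_self _)
  rw [← Finset.sum_fiberwise_of_maps_to (g := Tile.i) (t := Finset.range (T.i + 1))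
    (fun s hs => Finset.mem_range.2 (Nat.lt_succ_of_le (hS s hs).1))]
  calc _ ≤ ∑ i ∈ Finset.range (T.i + 1), 32 * len l0 i := by
        refine Finset.sum_le_sum fun i _ => ?_
        rw [Finset.sum_comm]
        calc _ ≤ ∑ y ∈ Y, q i y * ∑ s ∈ S with s.i = i, wt (len l0 s.i) s.a y ^ 2 := by
              refine Finset.sum_le_sum fun y hy => ?_
              rw [Finset.mul_sum]
              refine Finset.sum_le_sum fun s hs => ?_
              obtain ⟨hs1, hs2⟩ := Finset.mem_filter.1 hs
              refine (wt_pow_anti _ _ _ hn).trans ?_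
              have := hq s hs1 y hy
              rw [hs2] at this ⊢
              calc _ = wt (len l0 i) s.a y ^ 2 * wt (len l0 i) s.a y ^ 2 := by ring
                _ ≤ _ := mul_le_mul_of_nonneg_right this (sq_nonneg _)
          _ ≤ ∑ y ∈ Y, q i y * 4 := by
              refine Finset.sum_le_sum fun y _ => ?_
              exact mul_le_mul_of_nonneg_left (sum_scale_le hS i y) (by positivity)
          _ ≤ 32 * len l0 i := by
              rw [← Finset.sum_mul, Finset.sum_add_distrib]
              linarith [sum_inv_sq_le (one_le_len (l0 := l0) i) (L / len l0 i) Y,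
                sum_inv_sq_le (one_le_len (l0 := l0) i) (R / len l0 i) Y]
    _ ≤ _ := by
        rw [← Finset.mul_sum]
        linarith [sum_len_le (l0 := l0) T.i]

end

/-- The wave packet coefficients of a finite sequence. -/
noncomputable def coef (φ : Tile → ℤ → ℂ) (f : ℤ → ℂ) (Y : Finset ℤ) (s : Tile) : ℂ :=
  ∑ y ∈ Y, f y * starRingEnd ℂ (φ s y)

section
variable {l0 : ℕ} [NeZero l0] {φ : Tile → ℤ → ℂ} {K σ σ' : ℝ} {c : Tile → ℂ}

lemma mul_gram_le (h : Packets l0 φ K) {s t : Tile} (hts : t.i ≤ s.i)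
    (hs : ‖c s‖ ≤ σ * √(len l0 s.i)) (ht : ‖c t‖ ≤ σ * √(len l0 t.i)) (hσ : 0 ≤ σ) :
    ‖c s‖ * ‖c t‖ * ‖gram φ s t‖ ≤ 2 ^ 20 * K ^ 2 * σ ^ 2 *
      ∑ y ∈ cell l0 (t.a * sc l0 t.i) t.i, wt (len l0 s.i) s.a y ^ 18 := by
  have hls := len_pos (l0 := l0) s.i
  have hlt := len_pos (l0 := l0) t.i
  have hls' := Real.sqrt_pos.2 hls
  have hK := h.nonneg
  have hcell : (len l0 t.i) * ‖gram φ s t‖ ≤ ∑ y ∈ cell l0 (t.a * sc l0 t.i) t.i,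
      2 ^ 20 * K ^ 2 * (√(len l0 t.i) / √(len l0 s.i)) * wt (len l0 s.i) s.a y ^ 18 := by
    have e : len l0 t.i * ‖gram φ s t‖ = ∑ _y ∈ cell l0 (t.a * sc l0 t.i) t.i, ‖gram φ s t‖ := by
      rw [Finset.sum_const, nsmul_eq_mul, card_cell]
    rw [e]
    refine Finset.sum_le_sum fun y hy => ?_
    refine gram_le h s t hts ?_
    rw [mem_cell.1 hy, Int.mul_ediv_cancel _ (sc_pos _).ne']
  calc _ ≤ (σ * √(len l0 s.i)) * (σ * √(len l0 t.i)) * ‖gram φ s t‖ := by gcongr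
    _ = σ ^ 2 * √(len l0 s.i) / √(len l0 t.i) * (len l0 t.i * ‖gram φ s t‖) := by
        have : len l0 t.i = √(len l0 t.i) * √(len l0 t.i) := (Real.mul_self_sqrt hlt.le).symm
        have hp := Real.sqrt_pos.2 hlt
        field_simp
        rw [Real.sq_sqrt hlt.le]
        ring
    _ ≤ σ ^ 2 * √(len l0 s.i) / √(len l0 t.i) * ∑ y ∈ cell l0 (t.a * sc l0 t.i) t.i,
        2 ^ 20 * K ^ 2 * (√(len l0 t.i) / √(len l0 s.i)) * wt (len l0 s.i) s.a y ^ 18 :=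
        mul_le_mul_of_nonneg_left hcell (by positivity)
    _ = _ := by
        have hp := Real.sqrt_pos.2 hlt
        rw [← Finset.mul_sum]
        field_simp

lemma Selection.energy {S S' : Finset Tile} {tops : Finset Top} {sel : Finset Tile} {τ : Tile → Top}
    (H : Selection l0 c σ S S' tops sel τ) (h : Packets l0 φ K) (hV : ∀ s ∈ S, s.Valid l0)
    (hσ : 0 ≤ σ) (hc : ∀ s ∈ S, ‖c s‖ ≤ 2 * σ * √(len l0 s.i)) (Z : Finset ℤ) :
    ∑ z ∈ Z, ‖∑ s ∈ sel, c s * φ s z‖ ^ 2 ≤ 2 ^ 30 * K ^ 2 * ∑ s ∈ sel, ‖c s‖ ^ 2 := by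
  have hK := h.nonneg
  have hVs : ∀ s ∈ sel, s.Valid l0 := fun s hs => hV s (H.sel_sub hs)
  let D : Tile → Tile → Prop := fun s t => t.i < s.i ∧ s.b / 8 ^ (s.i - t.i) = t.b ∧
    s.b / 8 ^ (s.i - t.i - 1) ≠ 8 * t.b + 7
  let g0 : Tile → Tile → ℝ := fun s t => if s.i = t.i then ‖gram φ s t‖ else 0
  let g1 : Tile → Tile → ℝ := fun s t => if D s t then ‖gram φ s t‖ else 0
  have hsplit : ∀ s ∈ sel, ∀ t ∈ sel, ‖gram φ s t‖ ≤ g0 s t + (g1 s t + g1 t s) := by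
    have aux : ∀ s ∈ sel, ∀ t ∈ sel, t.i < s.i → ‖gram φ s t‖ ≤ g1 s t := by
      intro s hs t ht hlt
      simp only [g1]
      split_ifs with hD
      · exact le_rfl
      · rw [h.orth s t (hVs s hs) (hVs t ht) hlt, norm_zero]
        by_contra hcon
        push Not at hcon
        exact hD ⟨hlt, hcon.1, hcon.2⟩
    have g0n : ∀ s t, 0 ≤ g0 s t := fun s t => by simp only [g0]; split_ifs <;> positivity
    have g1n : ∀ s t, 0 ≤ g1 s t := fun s t => by simp only [g1]; split_ifs <;> positivity
    intro s hs t ht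
    rcases lt_trichotomy s.i t.i with hlt | heq | hlt
    · have := aux t ht s hs hlt
      rw [norm_gram_comm]
      linarith [g0n s t, g1n s t]
    · have : g0 s t = ‖gram φ s t‖ := by simp only [g0, heq, if_true]
      linarith [g1n s t, g1n t s]
    · have := aux s hs t ht hlt
      linarith [g0n s t, g1n t s]
  have hdiag : ∑ s ∈ sel, ∑ t ∈ sel, ‖c s‖ * ‖c t‖ * g0 s t ≤
      2 ^ 22 * K ^ 2 * ∑ s ∈ sel, ‖c s‖ ^ 2 := by
    refine schur_le sel (fun s => ‖c s‖) g0 (fun s t => by simp only [g0]; split_ifs <;> positivity)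
      (fun s t => by simp only [g0, eq_comm, norm_gram_comm s t]) fun s hs => ?_
    rw [← Finset.sum_filter]
    rw [← Finset.sum_filter_add_sum_filter_not _ (fun t => t.b = s.b)]
    have h0 : ∑ t ∈ (sel.filter (fun t => s.i = t.i)) with ¬ t.b = s.b, ‖gram φ s t‖ = 0 := by
      refine Finset.sum_eq_zero fun t ht => ?_
      simp only [Finset.mem_filter] at ht
      rw [h.orth_same s t (hVs s hs) (hVs t ht.1.1) ht.1.2 (Ne.symm ht.2), norm_zero]
    rw [h0, add_zero]
    refine sum_gram_same_le h s _ fun t ht => ?_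
    simp only [Finset.mem_filter] at ht
    exact ⟨ht.1.2.symm, ht.2⟩
  let Y : Tile → Finset ℤ := fun s =>
    (sel.filter (fun t => D s t)).biUnion fun t => cell l0 (t.a * sc l0 t.i) t.i
  have hcellmem : ∀ (t : Tile) (y : ℤ), y ∈ cell l0 (t.a * sc l0 t.i) t.i ↔ y / sc l0 t.i = t.a :=
    fun t y => by rw [mem_cell, Int.mul_ediv_cancel _ (sc_pos _).ne']
  have hcross1 : ∀ s ∈ sel, ∑ t ∈ sel, ‖c s‖ * ‖c t‖ * g1 s t ≤
      2 ^ 22 * K ^ 2 * σ ^ 2 * ∑ y ∈ Y s, wt (len l0 s.i) s.a y ^ 18 := by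
    intro s hs
    have e : ∑ t ∈ sel, ‖c s‖ * ‖c t‖ * g1 s t = ∑ t ∈ sel with D s t, ‖c s‖ * ‖c t‖ * ‖gram φ s t‖ := by
      rw [Finset.sum_filter]
      exact Finset.sum_congr rfl fun t _ => by simp only [g1, mul_ite, mul_zero]
    rw [e, Finset.sum_biUnion, Finset.mul_sum]
    · refine Finset.sum_le_sum fun t ht => ?_
      obtain ⟨ht1, ht2⟩ := Finset.mem_filter.1 ht
      refine (mul_gram_le h ht2.1.le (hc s (H.sel_sub hs)) (hc t (H.sel_sub ht1))
        (by positivity)).trans (le_of_eq (by ring))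
    · have aux : ∀ t ∈ sel, ∀ u ∈ sel, D s t → D s u → u.i < t.i →
          ∀ y, y / sc l0 t.i = t.a → y / sc l0 u.i = u.a → False := by
        intro t ht u hu hDt hDu hlt y h1 h2
        have e1 : t.b / 8 ^ (t.i - u.i) = u.b := by
          rw [← hDt.2.1, ← hDu.2.1, Int.ediv_ediv_of_nonneg (by positivity), ← pow_add]
          congr 2; have := hDt.1; omega
        have e2 : t.b / 8 ^ (t.i - u.i - 1) ≠ 8 * u.b + 7 := by
          rw [← hDt.2.1, Int.ediv_ediv_of_nonneg (by positivity), ← pow_add]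
          have : s.i - t.i + (t.i - u.i - 1) = s.i - u.i - 1 := by have := hDt.1; omega
          rw [this]; exact hDu.2.2
        have hL := (H.lac t ht).1
        refine H.key t ht u hu hlt e1 e2 ?_
        rw [← h2, ← ediv_sc_le (hlt.le.trans hL.1), ediv_sc_le hL.1, h1, hL.2.1]
      intro t ht u hu htu
      obtain ⟨ht1, ht2⟩ := Finset.mem_filter.1 (Finset.mem_coe.1 ht)
      obtain ⟨hu1, hu2⟩ := Finset.mem_filter.1 (Finset.mem_coe.1 hu)
      refine Finset.disjoint_left.2 fun y hy1 hy2 => ?_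
      rw [hcellmem] at hy1 hy2
      rcases lt_trichotomy t.i u.i with hlt | heq | hlt
      · exact aux u hu1 t ht1 hu2 ht2 hlt y hy2 hy1
      · apply htu
        ext
        · exact heq
        · rw [← hy1, ← hy2, heq]
        · rw [← ht2.2.1, ← hu2.2.1, heq]
      · exact aux t ht1 u hu1 ht2 hu2 hlt y hy1 hy2
  have hYout : ∀ s ∈ sel, ∀ y ∈ Y s, y / sc l0 (τ s).i ≠ (τ s).a := by
    intro s hs y hy
    obtain ⟨t, ht, hyt⟩ := Finset.mem_biUnion.1 hy
    obtain ⟨ht1, ht2⟩ := Finset.mem_filter.1 ht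
    rw [hcellmem] at hyt
    have hL := (H.lac s hs).1
    rw [ediv_sc_le (ht2.1.le.trans hL.1), hyt]
    exact H.key s hs t ht1 ht2.1 ht2.2.1 ht2.2.2
  have hcross : ∑ s ∈ sel, ∑ t ∈ sel, ‖c s‖ * ‖c t‖ * g1 s t ≤
      2 ^ 28 * K ^ 2 * ∑ s ∈ sel, ‖c s‖ ^ 2 := by
    calc _ ≤ ∑ s ∈ sel, 2 ^ 22 * K ^ 2 * σ ^ 2 * ∑ y ∈ Y s, wt (len l0 s.i) s.a y ^ 18 :=
          Finset.sum_le_sum hcross1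
      _ = 2 ^ 22 * K ^ 2 * σ ^ 2 * ∑ T ∈ tops, ∑ s ∈ sel with τ s = T,
            ∑ y ∈ Y s, wt (len l0 s.i) s.a y ^ 18 := by
          rw [← Finset.mul_sum, ← Finset.sum_fiberwise_of_maps_to H.mem]
      _ ≤ 2 ^ 22 * K ^ 2 * σ ^ 2 * ∑ T ∈ tops, 2 ^ 6 * len l0 T.i := by
          gcongr with T hT
          set YT := (sel.filter (fun s => τ s = T)).biUnion Y with hYT
          refine le_trans (Finset.sum_le_sum fun s hs => ?_)
            (sum_tail_le (l0 := l0) (S := sel.filter (fun s => τ s = T)) (T := T) (Y := YT) ?_ ?_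
              (n := 18) (by norm_num))
          · exact Finset.sum_le_sum_of_subset_of_nonneg (Finset.subset_biUnion_of_mem Y hs)
              fun _ _ _ => pow_nonneg (wt_nonneg _ _ _) _
          · intro s hs
            obtain ⟨hs1, rfl⟩ := Finset.mem_filter.1 hs
            exact (H.lac s hs1).1
          · intro y hy
            obtain ⟨s, hs, hys⟩ := Finset.mem_biUnion.1 hy
            obtain ⟨hs1, rfl⟩ := Finset.mem_filter.1 hs
            exact hYout s hs1 y hys
      _ = 2 ^ 28 * K ^ 2 * ∑ T ∈ tops, σ ^ 2 * len l0 T.i := by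
          rw [← Finset.mul_sum, ← Finset.mul_sum]; ring
      _ ≤ _ := by
          have := H.total
          gcongr
  calc _ ≤ ∑ s ∈ sel, ∑ t ∈ sel, ‖c s‖ * ‖c t‖ * ‖gram φ s t‖ := sum_sq_le_gram h sel c Z
    _ ≤ ∑ s ∈ sel, ∑ t ∈ sel, (‖c s‖ * ‖c t‖ * g0 s t + (‖c s‖ * ‖c t‖ * g1 s t +
          ‖c t‖ * ‖c s‖ * g1 t s)) := by
        refine Finset.sum_le_sum fun s hs => Finset.sum_le_sum fun t ht => ?_
        have := mul_le_mul_of_nonneg_left (hsplit s hs t ht)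
          (mul_nonneg (norm_nonneg (c s)) (norm_nonneg (c t)))
        linarith
    _ = ∑ s ∈ sel, ∑ t ∈ sel, ‖c s‖ * ‖c t‖ * g0 s t + 2 *
          ∑ s ∈ sel, ∑ t ∈ sel, ‖c s‖ * ‖c t‖ * g1 s t := by
        simp_rw [Finset.sum_add_distrib]
        rw [Finset.sum_comm (f := fun s t => ‖c t‖ * ‖c s‖ * g1 t s)]
        ring
    _ ≤ _ := by
        have : 0 ≤ K ^ 2 * ∑ s ∈ sel, ‖c s‖ ^ 2 := by positivity
        nlinarith

/-- The size lemma. -/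
lemma size_lemma (h : Packets l0 φ K) (f : ℤ → ℂ) (Y : Finset ℤ) (S : Finset Tile)
    (hV : ∀ s ∈ S, s.Valid l0) (hσ : 0 < σ) (hS : Size l0 (coef φ f Y) σ S) :
    ∃ S' ⊆ S, Size l0 (coef φ f Y) (σ / 2) S' ∧
      Covered l0 (S \ S') (2 ^ 32 * K ^ 2 / σ ^ 2 * ∑ y ∈ Y, ‖f y‖ ^ 2) := by
  obtain ⟨S', tops, sel, τ, H⟩ := exists_selection (l0 := l0) (c := coef φ f Y) (σ := σ / 2)
    S.card S le_rfl
  refine ⟨S', H.sub, H.size, tops.toList, ?_, ?_⟩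
  · intro s hs
    obtain ⟨T, hT, h1⟩ := H.cover s hs
    exact ⟨T, Finset.mem_toList.2 hT, h1⟩
  rw [Finset.sum_map_toList]
  set A := ∑ s ∈ sel, ‖coef φ f Y s‖ ^ 2 with hA
  set B := ∑ y ∈ Y, ‖f y‖ ^ 2 with hB
  have hA0 : 0 ≤ A := Finset.sum_nonneg fun _ _ => sq_nonneg _
  have hB0 : 0 ≤ B := Finset.sum_nonneg fun _ _ => sq_nonneg _
  have hen := H.energy h hV (by positivity) (fun s hs => by
    have := hS.coef_le hσ.le hs
    rwa [mul_div_cancel₀ _ (two_ne_zero)]) Y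
  have hdual : A ≤ √B * √(2 ^ 30 * K ^ 2 * A) := by
    have e : (A : ℂ) = ∑ y ∈ Y, f y * starRingEnd ℂ (∑ s ∈ sel, coef φ f Y s * φ s y) := by
      simp only [map_sum, map_mul, Finset.mul_sum]
      rw [Finset.sum_comm, hA]
      push_cast
      refine Finset.sum_congr rfl fun s _ => ?_
      rw [← Complex.mul_conj']
      conv_lhs => rw [coef, Finset.sum_mul]
      refine Finset.sum_congr rfl fun y _ => ?_
      rw [coef]; ring
    calc A = ‖(A : ℂ)‖ := by rw [Complex.norm_real, Real.norm_of_nonneg hA0]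
      _ ≤ ∑ y ∈ Y, ‖f y‖ * ‖∑ s ∈ sel, coef φ f Y s * φ s y‖ := by
          rw [e]
          refine (norm_sum_le _ _).trans (le_of_eq (Finset.sum_congr rfl fun y _ => ?_))
          rw [norm_mul, RCLike.norm_conj]
      _ ≤ √B * √(∑ y ∈ Y, ‖∑ s ∈ sel, coef φ f Y s * φ s y‖ ^ 2) :=
          Real.sum_mul_le_sqrt_mul_sqrt _ _ _
      _ ≤ _ := by gcongr
  have hA2 : A ≤ 2 ^ 30 * K ^ 2 * B := by
    have h1 : A ^ 2 ≤ B * (2 ^ 30 * K ^ 2 * A) := by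
      calc A ^ 2 ≤ (√B * √(2 ^ 30 * K ^ 2 * A)) ^ 2 := by gcongr
        _ = _ := by rw [mul_pow, Real.sq_sqrt hB0, Real.sq_sqrt (by positivity)]
    rcases hA0.eq_or_lt with h0 | h0
    · rw [← h0]; positivity
    · nlinarith
  have htot := H.total
  rw [← Finset.mul_sum] at htot
  rw [div_mul_eq_mul_div, le_div_iff₀ (by positivity)]
  nlinarith

end

section
variable {l0 : ℕ} {S S' : Finset Tile} {L L' : ℝ}

lemma Covered.of_finset {ι : Type*} (I : Finset ι) (f : ι → Top)
    (h : ∀ s ∈ S, ∃ j ∈ I, (f j).In l0 s) (hL : ∑ j ∈ I, len l0 (f j).i ≤ L) : Covered l0 S L := by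
  refine ⟨I.toList.map f, fun s hs => ?_, ?_⟩
  · obtain ⟨j, hj, hjs⟩ := h s hs
    exact ⟨f j, List.mem_map.2 ⟨j, Finset.mem_toList.2 hj, rfl⟩, hjs⟩
  · rw [List.map_map]
    refine le_trans (le_of_eq ?_) hL
    exact Finset.sum_map_toList I (fun j => len l0 (f j).i)

lemma modelOp_sdiff (N : ℤ → ℝ) (c : Tile → ℂ) (ψ : Tile → ℤ → ℂ) (h : S' ⊆ S) (x : ℤ) :
    modelOp l0 N c ψ S x = modelOp l0 N c ψ S' x + modelOp l0 N c ψ (S \ S') x := by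
  unfold modelOp
  rw [← Finset.sum_union (Finset.disjoint_filter_filter Finset.disjoint_sdiff),
    ← Finset.filter_union, Finset.union_sdiff_of_subset h]

variable [NeZero l0] {N : ℤ → ℝ} {E : Finset ℤ} {δ σ K : ℝ} {φ : Tile → ℤ → ℂ} {c : Tile → ℂ}

lemma Covered.modelOp_le (h : Packets l0 φ K) (hC : Covered l0 S L) (hV : ∀ s ∈ S, s.Valid l0)
    (hD : Dens l0 E N δ S) (hσS : Size l0 c σ S) (hδ : 0 ≤ δ) (hσ : 0 ≤ σ) :
    ∑ x ∈ E, ‖modelOp l0 N c φ S x‖ ≤ 2 ^ 40 * (K + K ^ 2) * (σ * δ * L) := by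
  have hK := h.nonneg
  obtain ⟨l, hl, hL⟩ := hC
  refine le_trans ?_ (mul_le_mul_of_nonneg_left (mul_le_mul_of_nonneg_left hL
    (mul_nonneg hσ hδ)) (by positivity))
  clear hL
  induction l generalizing S with
  | nil =>
    have : S = ∅ := Finset.eq_empty_of_forall_notMem fun s hs => by simpa using hl s hs
    subst this
    simp [modelOp]
  | cons T l ih =>
    have h1 := tree_le (S := S.filter fun s => T.In l0 s) h
      (fun s hs => ⟨(Finset.mem_filter.1 hs).2, hV s (Finset.mem_filter.1 hs).1⟩)
      (hD.mono (Finset.filter_subset _ _)) (hσS.mono (Finset.filter_subset _ _)) hδ hσ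
    have h2 := ih (S := S \ S.filter fun s => T.In l0 s)
      (fun s hs => hV s (Finset.sdiff_subset hs)) (hD.mono Finset.sdiff_subset)
      (hσS.mono Finset.sdiff_subset) fun s hs => by
        rw [Finset.mem_sdiff, Finset.mem_filter] at hs
        obtain ⟨T', hT', hTs⟩ := hl s hs.1
        rcases List.mem_cons.1 hT' with rfl | hT'
        · exact absurd ⟨hs.1, hTs⟩ hs.2
        · exact ⟨T', hT', hTs⟩
    calc ∑ x ∈ E, ‖modelOp l0 N c φ S x‖
        ≤ ∑ x ∈ E, (‖modelOp l0 N c φ (S.filter fun s => T.In l0 s) x‖ +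
          ‖modelOp l0 N c φ (S \ S.filter fun s => T.In l0 s) x‖) := by
          refine Finset.sum_le_sum fun x _ => ?_
          rw [modelOp_sdiff N c φ (Finset.filter_subset (fun s => T.In l0 s) S)]
          exact norm_add_le _ _
      _ ≤ _ := by
          rw [Finset.sum_add_distrib, List.map_cons, List.sum_cons]
          refine (add_le_add h1 h2).trans (le_of_eq ?_)
          ring

lemma TileLE.refl (s : Tile) : TileLE s s := ⟨le_rfl, by simp, by simp⟩

lemma TileLE.trans {s t u : Tile} (h : TileLE s t) (h' : TileLE t u) : TileLE s u := by
  obtain ⟨h1, h2, h3⟩ := h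
  obtain ⟨g1, g2, g3⟩ := h'
  have e : u.i - s.i = (t.i - s.i) + (u.i - t.i) := by omega
  refine ⟨h1.trans g1, ?_, ?_⟩
  · rw [e, pow_add, ← Int.ediv_ediv_of_nonneg (by positivity), h2, g2]
  · rw [e, add_comm, pow_add, ← Int.ediv_ediv_of_nonneg (by positivity), g3, h3]

lemma TileLE.eq_of_scale {s t : Tile} (h : TileLE s t) (h' : t.i = s.i) : t = s := by
  obtain ⟨h1, h2, h3⟩ := h
  rw [h'] at h2 h3
  simp at h2 h3
  exact Tile.ext h' h2.symm h3

lemma exists_maximal (B : Finset Tile) : ∃ M ⊆ B, (∀ t ∈ B, ∃ u ∈ M, TileLE t u) ∧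
    ∀ t ∈ M, ∀ u ∈ M, TileLE t u → u = t := by
  refine ⟨B.filter fun t => ∀ u ∈ B, TileLE t u → u = t, Finset.filter_subset _ _, fun t ht => ?_,
    fun t ht u hu htu => (Finset.mem_filter.1 ht).2 u (Finset.mem_filter.1 hu).1 htu⟩
  obtain ⟨u, hu, hmax⟩ := Finset.exists_max_image (B.filter fun u => TileLE t u) Tile.i
    ⟨t, Finset.mem_filter.2 ⟨ht, TileLE.refl t⟩⟩
  obtain ⟨huB, htu⟩ := Finset.mem_filter.1 hu
  refine ⟨u, Finset.mem_filter.2 ⟨huB, fun w hw huw => ?_⟩, htu⟩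
  have := hmax w (Finset.mem_filter.2 ⟨hw, htu.trans huw⟩)
  exact huw.eq_of_scale (le_antisymm this huw.1)

/-- The points of `E` in a tile. -/
noncomputable def tilePts (l0 : ℕ) (E : Finset ℤ) (N : ℤ → ℝ) (t : Tile) : Finset ℤ :=
  E.filter fun x => x / sc l0 t.i = t.a ∧ ⌊len l0 t.i * N x⌋ = t.b

lemma sum_card_tilePts_le {M : Finset Tile} (hM : ∀ t ∈ M, ∀ u ∈ M, TileLE t u → u = t) :
    ∑ t ∈ M, ((tilePts l0 E N t).card : ℝ) ≤ E.card := by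
  rw [← Nat.cast_sum, ← Finset.card_biUnion]
  · exact_mod_cast Finset.card_le_card (Finset.biUnion_subset.2 fun t _ => Finset.filter_subset _ _)
  · intro t ht u hu htu
    refine Finset.disjoint_left.2 ?_
    intro x hx hx'
    obtain ⟨-, h1, h2⟩ := Finset.mem_filter.1 hx
    obtain ⟨-, h3, h4⟩ := Finset.mem_filter.1 hx'
    rcases le_total t.i u.i with hle | hle
    · refine htu (hM t ht u hu ⟨hle, ?_, ?_⟩).symm
      · rw [← h1, ← h3, ediv_sc_le hle]
      · rw [← h2, ← h4, floor_len_le hle]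
    · refine htu (hM u hu t ht ⟨hle, ?_, ?_⟩)
      · rw [← h1, ← h3, ediv_sc_le hle]
      · rw [← h2, ← h4, floor_len_le hle]

/-- The tile shifted in space. -/
def Tile.shift (t : Tile) (m : ℤ) : Tile := ⟨t.i, t.a + m, t.b⟩

lemma sum_inv_int_sq_le (M : Finset ℤ) : ∑ m ∈ M, ((1 + |(m : ℝ)|)⁻¹) ^ 2 ≤ 4 := by
  have := sum_wt_sq_le' 1 0 M
  simpa [wt] using this

lemma wt_shift_le {i : ℕ} {a m x : ℤ} (hx : x / sc l0 i = a + m) :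
    wt (len l0 i) a x ≤ 2 * (1 + |(m : ℝ)|)⁻¹ := by
  have hl := len_pos (l0 := l0) i
  obtain ⟨h1, h2⟩ := (mem_cell_iff (l0 := l0) i).1 hx
  rw [← le_div_iff₀ hl] at h1
  rw [← div_lt_iff₀ hl] at h2
  push_cast at h1 h2
  unfold wt
  rw [← div_eq_mul_inv, ← one_div, div_le_div_iff₀ (by positivity) (by positivity)]
  have h4 : |(m : ℝ)| ≤ 1 + 2 * |(x : ℝ) / len l0 i - a| := by
    rcases le_or_gt 0 m with hm | hm
    · rw [abs_of_nonneg (by exact_mod_cast hm)]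
      have := le_abs_self ((x : ℝ) / len l0 i - a)
      have := abs_nonneg ((x : ℝ) / len l0 i - a)
      linarith
    · have h5 : (m : ℝ) ≤ -1 := by exact_mod_cast (by omega : m ≤ -1)
      rw [abs_of_neg (by linarith)]
      have := neg_abs_le ((x : ℝ) / len l0 i - a)
      linarith
  linarith

lemma exists_shift_of_mass {t : Tile} (hδ : 0 < δ) (h : δ * len l0 t.i < mass l0 E N t) :
    ∃ m : ℤ, δ * (1 + |(m : ℝ)|) ^ 8 * len l0 t.i ≤ 2 ^ 12 * (tilePts l0 E N (t.shift m)).card := by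
  by_contra hcon
  push Not at hcon
  refine absurd h (not_lt.2 ?_)
  have hl := len_pos (l0 := l0) t.i
  set E' := E.filter fun x => ⌊len l0 t.i * N x⌋ = t.b with hE'
  have e : mass l0 E N t = ∑ m ∈ E'.image (fun x => x / sc l0 t.i - t.a),
      ∑ x ∈ E' with x / sc l0 t.i - t.a = m, wt (len l0 t.i) t.a x ^ 10 := by
    rw [Finset.sum_fiberwise_of_maps_to fun x hx => Finset.mem_image_of_mem _ hx]
    rfl
  rw [e]
  calc _ ≤ ∑ m ∈ E'.image (fun x => x / sc l0 t.i - t.a),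
        (δ * len l0 t.i / 4) * ((1 + |(m : ℝ)|)⁻¹) ^ 2 := by
        refine Finset.sum_le_sum fun m _ => ?_
        have hsub : (E'.filter fun x => x / sc l0 t.i - t.a = m) ⊆ tilePts l0 E N (t.shift m) := by
          intro x hx
          simp only [hE', Finset.mem_filter] at hx
          refine Finset.mem_filter.2 ⟨hx.1.1, ?_, hx.1.2⟩
          show x / sc l0 t.i = t.a + m
          omega
        have hm := hcon m
        have hp : 0 < 1 + |(m : ℝ)| := by positivity
        calc _ ≤ ∑ x ∈ E' with x / sc l0 t.i - t.a = m, (2 * (1 + |(m : ℝ)|)⁻¹) ^ 10 := by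
              refine Finset.sum_le_sum fun x hx => ?_
              have := (Finset.mem_filter.1 hx).2
              exact pow_le_pow_left₀ (wt_nonneg _ _ _) (wt_shift_le (by omega)) _
          _ ≤ (tilePts l0 E N (t.shift m)).card * (2 * (1 + |(m : ℝ)|)⁻¹) ^ 10 := by
              rw [Finset.sum_const, nsmul_eq_mul]
              gcongr
          _ ≤ (δ * (1 + |(m : ℝ)|) ^ 8 * len l0 t.i / 2 ^ 12) * (2 * (1 + |(m : ℝ)|)⁻¹) ^ 10 := by
              gcongr
              linarith
          _ = _ := by field_simp; norm_num
    _ ≤ (δ * len l0 t.i / 4) * 4 := by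
        rw [← Finset.mul_sum]
        exact mul_le_mul_of_nonneg_left (sum_inv_int_sq_le _) (by positivity)
    _ = _ := by ring

lemma abs_ediv_shift_le (a m : ℤ) (d : ℕ) : |a / 8 ^ d - (a + m) / 8 ^ d| ≤ |m| := by
  have hq : (0 : ℤ) < 8 ^ d := by positivity
  have hq1 : (1 : ℤ) ≤ 8 ^ d := hq
  have h1 : (a + m) / 8 ^ d ≤ a / 8 ^ d + |m| := by
    rw [← Int.add_mul_ediv_right a |m| hq.ne']
    refine Int.ediv_le_ediv hq ?_
    nlinarith [le_abs_self m, abs_nonneg m]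
  have h2 : a / 8 ^ d + -|m| ≤ (a + m) / 8 ^ d := by
    rw [← Int.add_mul_ediv_right a (-|m|) hq.ne']
    refine Int.ediv_le_ediv hq ?_
    nlinarith [neg_abs_le m, abs_nonneg m]
  rw [abs_le]
  constructor <;> linarith

/-- Decomposition of a family according to density. -/
lemma mass_lemma (E : Finset ℤ) (N : ℤ → ℝ) (S : Finset Tile) (hδ : 0 < δ) :
    ∃ S' ⊆ S, Dens l0 E N δ S' ∧ Covered l0 (S \ S') (2 ^ 15 / δ * E.card) := by
  set S' := S.filter fun s => ∀ t, TileLE s t → mass l0 E N t ≤ δ * len l0 t.i with hS'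
  refine ⟨S', Finset.filter_subset _ _, fun s hs => (Finset.mem_filter.1 hs).2, ?_⟩
  have hbad : ∀ s : Tile, s ∈ S \ S' → ∃ t : Tile, ∃ m : ℤ, TileLE s t ∧
      δ * (1 + |(m : ℝ)|) ^ 8 * len l0 t.i ≤ 2 ^ 12 * (tilePts l0 E N (t.shift m)).card := by
    intro s hs
    rw [Finset.mem_sdiff, hS', Finset.mem_filter] at hs
    have h1 : ∃ t, TileLE s t ∧ δ * len l0 t.i < mass l0 E N t := by
      by_contra hcon
      push Not at hcon
      exact hs.2 ⟨hs.1, hcon⟩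
    obtain ⟨t, hst, ht⟩ := h1
    obtain ⟨m, hm⟩ := exists_shift_of_mass hδ ht
    exact ⟨t, m, hst, hm⟩
  choose! t m hst hm using hbad
  let B : ℤ → Finset Tile := fun k => ((S \ S').filter fun s => m s = k).image
    fun s => (t s).shift (m s)
  choose M hMB hMcov hMmax using fun k => exists_maximal (B k)
  let Ms := (S \ S').image m
  refine Covered.of_finset (Ms.sigma fun k => M k ×ˢ Finset.Icc (-|k|) |k|)
    (fun p => ⟨p.2.1.i, p.2.1.a + p.2.2, p.2.1.b / len l0 p.2.1.i⟩) (fun s hs => ?_) ?_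
  · have hsB : (t s).shift (m s) ∈ B (m s) :=
      Finset.mem_image.2 ⟨s, Finset.mem_filter.2 ⟨hs, rfl⟩, rfl⟩
    obtain ⟨u, hu, hle⟩ := hMcov _ _ hsB
    obtain ⟨h1, h2, h3⟩ := hle
    obtain ⟨g1, g2, g3⟩ := hst s hs
    simp only [Tile.shift] at h1 h2 h3
    have e : u.i - s.i = ((t s).i - s.i) + (u.i - (t s).i) := by omega
    have hn := abs_le.1 (abs_ediv_shift_le (t s).a (m s) (u.i - (t s).i))
    refine ⟨⟨m s, u, (t s).a / 8 ^ (u.i - (t s).i) - u.a⟩, ?_, ?_⟩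
    · simp only [Finset.mem_sigma, Finset.mem_product, Finset.mem_Icc]
      refine ⟨Finset.mem_image_of_mem _ hs, hu, ?_⟩
      rw [← h2]
      exact hn
    · refine ⟨g1.trans h1, ?_, ?_⟩
      · show s.a / 8 ^ (u.i - s.i) = u.a + ((t s).a / 8 ^ (u.i - (t s).i) - u.a)
        rw [e, pow_add, ← Int.ediv_ediv_of_nonneg (by positivity), g2]
        ring
      · show ⌊len l0 s.i * (u.b / len l0 u.i)⌋ = s.b
        rw [floor_len_le (g1.trans h1), mul_div_cancel₀ _ (len_pos _).ne', Int.floor_intCast,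
          e, add_comm, pow_add, ← Int.ediv_ediv_of_nonneg (by positivity), h3, g3]
  · rw [Finset.sum_sigma]
    calc _ ≤ ∑ k ∈ Ms, (2 ^ 13 / δ * E.card) * ((1 + |(k : ℝ)|)⁻¹) ^ 2 := by
          refine Finset.sum_le_sum fun k _ => ?_
          rw [Finset.sum_product]
          simp only [Finset.sum_const, nsmul_eq_mul, Int.card_Icc]
          rw [← Finset.mul_sum]
          have hp : 1 ≤ 1 + |(k : ℝ)| := by linarith [abs_nonneg (k : ℝ)]
          have hp0 : 0 < 1 + |(k : ℝ)| := by linarith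
          have hcard : (((|k| + 1 - -|k|).toNat : ℕ) : ℝ) ≤ 2 * (1 + |(k : ℝ)|) := by
            have h0 : (((|k| + 1 - -|k|).toNat : ℤ) : ℝ) = |(k : ℝ)| + 1 + |(k : ℝ)| := by
              rw [Int.toNat_of_nonneg (by have := abs_nonneg k; omega)]
              push_cast
              ring
            have h0' : (((|k| + 1 - -|k|).toNat : ℕ) : ℝ) = |(k : ℝ)| + 1 + |(k : ℝ)| := by
              exact_mod_cast h0
            rw [h0']
            linarith
          have hsum : ∑ u ∈ M k, len l0 u.i ≤
              2 ^ 12 / (δ * (1 + |(k : ℝ)|) ^ 8) * E.card := by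
            calc _ ≤ ∑ u ∈ M k, 2 ^ 12 / (δ * (1 + |(k : ℝ)|) ^ 8) * (tilePts l0 E N u).card := by
                  refine Finset.sum_le_sum fun u hu => ?_
                  obtain ⟨s, hs, rfl⟩ := Finset.mem_image.1 (hMB k hu)
                  obtain ⟨hs1, rfl⟩ := Finset.mem_filter.1 hs
                  have := hm s hs1
                  rw [div_mul_eq_mul_div, le_div_iff₀ (by positivity), mul_comm]
                  exact this
              _ ≤ _ := by
                  rw [← Finset.mul_sum]
                  exact mul_le_mul_of_nonneg_left (sum_card_tilePts_le (hMmax k)) (by positivity)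
          calc _ ≤ (2 * (1 + |(k : ℝ)|)) * (2 ^ 12 / (δ * (1 + |(k : ℝ)|) ^ 8) * E.card) :=
                mul_le_mul hcard hsum (Finset.sum_nonneg fun _ _ => (len_pos _).le) (by positivity)
            _ = (2 ^ 13 / δ * E.card) * ((1 + |(k : ℝ)|)⁻¹) ^ 7 := by field_simp
            _ ≤ _ := by
                refine mul_le_mul_of_nonneg_left ?_ (by positivity)
                exact pow_le_pow_of_le_one (by positivity) (inv_le_one_of_one_le₀ hp) (by norm_num)
      _ ≤ (2 ^ 13 / δ * E.card) * 4 := by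
          rw [← Finset.mul_sum]
          exact mul_le_mul_of_nonneg_left (sum_inv_int_sq_le _) (by positivity)
      _ = _ := by ring

end

section
variable {l0 : ℕ} [NeZero l0] {N : ℤ → ℝ} {E F : Finset ℤ} {A K : ℝ} {φ ψ : Tile → ℤ → ℂ}
  {c : Tile → ℂ} {f : ℤ → ℂ} {S : Finset Tile}

lemma norm_coef_le (h : Packets l0 φ K) (hf : ∀ y ∈ F, ‖f y‖ ≤ 1) (s : Tile) :
    ‖coef φ f F s‖ ≤ K / √(len l0 s.i) * ∑ y ∈ F, wt (len l0 s.i) s.a y ^ 10 := by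
  rw [Finset.mul_sum]
  refine (norm_sum_le _ _).trans (Finset.sum_le_sum fun y hy => ?_)
  rw [norm_mul, RCLike.norm_conj]
  calc ‖f y‖ * ‖φ s y‖ ≤ 1 * ‖φ s y‖ := by gcongr; exact hf y hy
    _ ≤ _ := by rw [one_mul]; exact h.decay' s y (by norm_num)

/-- Size bound for tiles whose ancestors all meet `F` in low density. -/
lemma size_le (h : Packets l0 φ K) (hK : 1 ≤ K) (hf : ∀ y ∈ F, ‖f y‖ ≤ 1) (hA : 0 ≤ A)
    (hV : ∀ s ∈ S, s.Valid l0)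
    (hS : ∀ s ∈ S, ∀ j, s.i ≤ j →
      ∑ x ∈ F, wt (len l0 j) (s.a / 8 ^ (j - s.i)) x ^ 10 ≤ A * len l0 j) :
    Size l0 (coef φ f F) (2 ^ 40 * K ^ 2 * A) S := by
  intro T
  set c := coef φ f F with hc
  set ST := S.filter fun s => T.Lac l0 s with hST
  have hl := len_pos (l0 := l0) T.i
  have hcs : ∀ s ∈ ST, ‖c s‖ ≤ K * A * √(len l0 s.i) := by
    intro s hs
    have h1 := hS s (Finset.mem_filter.1 hs).1 s.i le_rfl
    have hls := len_pos (l0 := l0) s.i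
    have hp := Real.sqrt_pos.2 hls
    simp only [Nat.sub_self, pow_zero, Int.ediv_one] at h1
    calc _ ≤ K / √(len l0 s.i) * ∑ y ∈ F, wt (len l0 s.i) s.a y ^ 10 := norm_coef_le h hf s
      _ ≤ K / √(len l0 s.i) * (A * (√(len l0 s.i) * √(len l0 s.i))) := by
          rw [Real.mul_self_sqrt hls.le]; gcongr
      _ = _ := by field_simp
  have key := sum_lac_le (S := ST) (T := T) (E := F) (P := fun _ _ => True) (c := c) (σ := K * A) h
    (fun s hs => ⟨(Finset.mem_filter.1 hs).2, hV s (Finset.mem_filter.1 hs).1⟩) (fun _ _ h => h)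
    (fun s hs j hj => by simpa using hS s (Finset.mem_filter.1 hs).1 j hj) hA (by positivity) hcs
  simp only [Finset.filter_true] at key
  set X := √(∑ s ∈ ST, ‖c s‖ ^ 2) with hX
  have hX2 : X ^ 2 = ∑ s ∈ ST, ‖c s‖ ^ 2 := Real.sq_sqrt (Finset.sum_nonneg fun _ _ => sq_nonneg _)
  have hle : X ^ 2 ≤ ∑ x ∈ F, ‖∑ s ∈ ST, c s * φ s x‖ := by
    have e : ((X ^ 2 : ℝ) : ℂ) = ∑ y ∈ F, f y * starRingEnd ℂ (∑ s ∈ ST, c s * φ s y) := by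
      rw [hX2]
      push_cast
      calc _ = ∑ s ∈ ST, c s * starRingEnd ℂ (c s) :=
            Finset.sum_congr rfl fun s _ => by rw [Complex.mul_conj, Complex.normSq_eq_norm_sq]; simp
        _ = ∑ s ∈ ST, ∑ y ∈ F, f y * starRingEnd ℂ (c s * φ s y) := by
            refine Finset.sum_congr rfl fun s _ => ?_
            change (∑ y ∈ F, f y * starRingEnd ℂ (φ s y)) * starRingEnd ℂ (c s) = _
            rw [Finset.sum_mul]
            refine Finset.sum_congr rfl fun y _ => ?_
            rw [map_mul]
            ring
        _ = _ := by
            rw [Finset.sum_comm]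
            exact Finset.sum_congr rfl fun y _ => by rw [map_sum, Finset.mul_sum]
    have e2 : X ^ 2 = ‖((X ^ 2 : ℝ) : ℂ)‖ := by
      rw [Complex.norm_real, Real.norm_of_nonneg (sq_nonneg _)]
    rw [e2, e]
    refine (norm_sum_le _ _).trans (Finset.sum_le_sum fun y hy => ?_)
    rw [norm_mul, RCLike.norm_conj]
    exact mul_le_of_le_one_left (norm_nonneg _) (hf y hy)
  have h1 := hle.trans key
  rw [← hX2]
  set w := √(len l0 T.i) with hw
  have hw2 : len l0 T.i = w ^ 2 := (Real.sq_sqrt hl.le).symm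
  rw [hw2] at h1 ⊢
  have hw0 : 0 ≤ w := Real.sqrt_nonneg _
  have hX0 : 0 ≤ X := Real.sqrt_nonneg _
  have h2 : 2 ^ 39 * K ^ 2 * A * (w * X) ≤ X ^ 2 / 2 + (2 ^ 39 * K ^ 2 * A * w) ^ 2 / 2 := by
    nlinarith [sq_nonneg (X - 2 ^ 39 * K ^ 2 * A * w)]
  have h3 : K ^ 2 ≤ K ^ 4 := pow_le_pow_right₀ hK (by norm_num)
  have h4 : K ^ 2 * (A ^ 2 * w ^ 2) ≤ K ^ 4 * (A ^ 2 * w ^ 2) := by gcongr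
  have h5 : 0 ≤ K ^ 4 * (A ^ 2 * w ^ 2) := by positivity
  nlinarith

lemma mass_le (E : Finset ℤ) (N : ℤ → ℝ) (S : Finset Tile) : Dens l0 E N 4 S :=
  fun _ _ t _ => sum_wt_pow_le (one_le_len t.i) t.a _ (by norm_num)

lemma card_le_of_cover (l : List Top) (X : Finset ℤ) (h : ∀ x ∈ X, ∃ T ∈ l, x / sc l0 T.i = T.a) :
    (X.card : ℝ) ≤ (l.map fun T => len l0 T.i).sum := by
  induction l generalizing X with
  | nil =>
    have : X = ∅ := Finset.eq_empty_of_forall_notMem fun x hx => by simpa using h x hx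
    simp [this]
  | cons T l ih =>
    rw [← Finset.card_filter_add_card_filter_not (s := X) (fun x => x / sc l0 T.i = T.a), List.map_cons,
      List.sum_cons]
    push_cast
    refine add_le_add ?_ (ih _ fun x hx => ?_)
    · rw [← card_cell (l0 := l0) (T.a * sc l0 T.i) T.i]
      refine Nat.cast_le.2 (Finset.card_le_card fun x hx => ?_)
      rw [mem_cell, Int.mul_ediv_cancel _ (sc_pos _).ne']
      exact (Finset.mem_filter.1 hx).2
    · obtain ⟨hxX, hx⟩ := Finset.mem_filter.1 hx
      obtain ⟨T', hT', h'⟩ := h x hxX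
      rcases List.mem_cons.1 hT' with rfl | hT'
      · exact absurd h' hx
      · exact ⟨T', hT', by assumption⟩

/-- Maximal intervals on which `F` has density at least `A`. -/
lemma exists_heavy (hA : 0 < A) (F : Finset ℤ) (S : Finset Tile) : ∃ M : Finset Tile,
    ∑ u ∈ M, len l0 u.i ≤ 2 ^ 15 / A * F.card ∧ ∀ s ∈ S,
      (∀ j, s.i ≤ j → ∑ x ∈ F, wt (len l0 j) (s.a / 8 ^ (j - s.i)) x ^ 10 ≤ A * len l0 j) ∨
      ∃ u ∈ M, s.i ≤ u.i ∧ s.a / 8 ^ (u.i - s.i) = u.a ∧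
        ∑ x ∈ F, wt (len l0 (u.i + 1)) (u.a / 8) x ^ 10 ≤ A * len l0 (u.i + 1) := by
  let H : ℕ → ℤ → Prop := fun j a => A * len l0 j < ∑ x ∈ F, wt (len l0 j) a x ^ 10
  have hHb : ∀ j a, H j a → (j : ℝ) ≤ F.card / A := by
    intro j a hH
    rw [le_div_iff₀ hA]
    have h1 : ∑ x ∈ F, wt (len l0 j) a x ^ 10 ≤ F.card := by
      calc _ ≤ ∑ x ∈ F, (1 : ℝ) :=
            Finset.sum_le_sum fun x _ => pow_le_one₀ (wt_nonneg _ _ _) (wt_le_one _ _ _)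
        _ = _ := by simp
    have h2 : (j : ℝ) ≤ len l0 j := by
      have h3 : (1 : ℝ) ≤ l0 := by exact_mod_cast NeZero.one_le
      have h4 : (j : ℝ) ≤ 8 ^ j := by
        exact_mod_cast (Nat.lt_pow_self (by norm_num : 1 < 8)).le
      unfold len
      nlinarith
    have h3 : A * len l0 j < F.card := hH.trans_le h1
    nlinarith
  let bad : Tile → Prop := fun s => ∃ j, s.i ≤ j ∧ H j (s.a / 8 ^ (j - s.i))
  have hex : ∀ s, bad s → ∃ j, (s.i ≤ j ∧ H j (s.a / 8 ^ (j - s.i))) ∧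
      ∀ k, s.i ≤ k → H k (s.a / 8 ^ (k - s.i)) → k ≤ j := by
    intro s hs
    have hbdd : BddAbove {j | s.i ≤ j ∧ H j (s.a / 8 ^ (j - s.i))} := by
      refine ⟨⌊F.card / A⌋₊, fun j hj => ?_⟩
      exact Nat.le_floor (hHb _ _ hj.2)
    exact ⟨_, Nat.sSup_mem hs hbdd, fun k h1 h2 => le_csSup hbdd ⟨h1, h2⟩⟩
  choose! j hj hjmax using hex
  let M := (S.filter bad).image fun s => (⟨j s, s.a / 8 ^ (j s - s.i), 0⟩ : Tile)
  have hM : ∀ u ∈ M, H u.i u.a := by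
    intro u hu
    obtain ⟨s, hs, rfl⟩ := Finset.mem_image.1 hu
    exact (hj s (Finset.mem_filter.1 hs).2).2
  have hanti : ∀ t ∈ M, ∀ u ∈ M, TileLE t u → u = t := by
    intro t ht u hu htu
    refine htu.eq_of_scale (le_antisymm ?_ htu.1)
    obtain ⟨s, hs, rfl⟩ := Finset.mem_image.1 ht
    have hb := (Finset.mem_filter.1 hs).2
    refine hjmax s hb _ ((hj s hb).1.trans htu.1) ?_
    have e : u.i - s.i = (j s - s.i) + (u.i - j s) := by
      have := (hj s hb).1
      have := htu.1
      simp only at this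
      omega
    have := htu.2.1
    simp only at this
    rw [e, pow_add, ← Int.ediv_ediv_of_nonneg (by positivity), this]
    exact hM u hu
  refine ⟨M, ?_, fun s hs => ?_⟩
  · obtain ⟨M', hM', hD, l, hl, hL⟩ := mass_lemma (l0 := l0) F (fun _ => 0) M hA
    have hempty : M' = ∅ := Finset.eq_empty_of_forall_notMem fun u hu => by
      have h1 := hD u hu u (TileLE.refl u)
      have h2 := hM u (hM' hu)
      have hb : u.b = 0 := by
        obtain ⟨s, hs, rfl⟩ := Finset.mem_image.1 (hM' hu)
        rfl
      simp only [mass, mul_zero, Int.floor_zero, hb, Finset.filter_true] at h1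
      exact absurd h2 (not_lt.2 h1)
    rw [hempty, Finset.sdiff_empty] at hl
    refine le_trans ?_ hL
    have e : ∑ u ∈ M, len l0 u.i = ((M.biUnion fun u => cell l0 (u.a * sc l0 u.i) u.i).card : ℝ) := by
      rw [Finset.card_biUnion]
      · push_cast
        exact Finset.sum_congr rfl fun u _ => (card_cell _ _).symm
      · intro t ht u hu htu
        refine Finset.disjoint_left.2 fun x hx hx' => htu ?_
        rw [mem_cell, Int.mul_ediv_cancel _ (sc_pos _).ne'] at hx hx'
        have hb : ∀ u ∈ M, u.b = 0 := fun u hu => by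
          obtain ⟨s, hs, rfl⟩ := Finset.mem_image.1 hu
          rfl
        rcases le_total t.i u.i with hle | hle
        · exact (hanti t ht u hu ⟨hle, by rw [← hx, ← hx', ediv_sc_le hle], by
            rw [hb t ht, hb u hu, Int.zero_ediv]⟩).symm
        · exact hanti u hu t ht ⟨hle, by rw [← hx, ← hx', ediv_sc_le hle], by
            rw [hb t ht, hb u hu, Int.zero_ediv]⟩
    rw [e]
    refine card_le_of_cover l _ fun x hx => ?_
    obtain ⟨u, hu, hxu⟩ := Finset.mem_biUnion.1 hx
    rw [mem_cell, Int.mul_ediv_cancel _ (sc_pos _).ne'] at hxu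
    obtain ⟨T, hT, hTu⟩ := hl u hu
    exact ⟨T, hT, by rw [ediv_sc_le hTu.1, hxu, hTu.2.1]⟩
  · by_cases hb : bad s
    · right
      refine ⟨_, Finset.mem_image.2 ⟨s, Finset.mem_filter.2 ⟨hs, hb⟩, rfl⟩, (hj s hb).1, rfl, ?_⟩
      by_contra hcon
      push Not at hcon
      have h1 := (hj s hb).1
      have := hjmax s hb (j s + 1) (by omega) (by
        have e : j s + 1 - s.i = (j s - s.i) + 1 := by omega
        rw [e, pow_succ, ← Int.ediv_ediv_of_nonneg (by positivity)]
        exact hcon)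
      omega
    · left
      intro k hk
      by_contra hcon
      push Not at hcon
      exact hb ⟨k, hk, hcon⟩

end

section
variable {l0 : ℕ} [NeZero l0] {N : ℤ → ℝ} {E F : Finset ℤ} {A K : ℝ} {φ ψ : Tile → ℤ → ℂ}
  {c : Tile → ℂ} {f : ℤ → ℂ} {S : Finset Tile}

lemma wt_le_of_far {i : ℕ} {a : ℤ} {u : Tile} {x : ℤ} (hi : i ≤ u.i) (ha : a / 8 ^ (u.i - i) = u.a)
    (hx : 1 < |u.a - x / sc l0 u.i|) : wt (len l0 i) a x ≤ len l0 i / len l0 u.i := by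
  have hl := len_pos (l0 := l0) i
  have hL := len_pos (l0 := l0) u.i
  obtain ⟨h1, h2⟩ := anc_bounds (l0 := l0) hi a
  obtain ⟨h3, h4⟩ := (mem_cell_iff (l0 := l0) u.i).1 (rfl : x / sc l0 u.i = x / sc l0 u.i)
  rw [ha] at h1 h2
  set q := x / sc l0 u.i
  have key : len l0 u.i ≤ |(x : ℝ) - a * len l0 i| := by
    rcases lt_abs.1 hx with h | h
    · have h5 : (q : ℝ) ≤ u.a - 2 := by exact_mod_cast (by omega : q ≤ u.a - 2)
      have := neg_abs_le ((x : ℝ) - a * len l0 i)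
      nlinarith
    · have h5 : (u.a : ℝ) + 2 ≤ q := by exact_mod_cast (by omega : u.a + 2 ≤ q)
      have := le_abs_self ((x : ℝ) - a * len l0 i)
      nlinarith
  have e : |(x : ℝ) / len l0 i - a| = |(x : ℝ) - a * len l0 i| / len l0 i := by
    rw [← abs_of_pos hl, ← abs_div, abs_of_pos hl]
    congr 1
    field_simp
  unfold wt
  rw [← inv_div (len l0 u.i)]
  refine inv_anti₀ (div_pos hL hl) ?_
  rw [e]
  have : len l0 u.i / len l0 i ≤ |(x : ℝ) - a * len l0 i| / len l0 i := by gcongr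
  linarith

/-- The contribution of the tiles below a heavy interval, away from that interval. -/
lemma sum_below_heavy_le (hφ : Packets l0 φ K) (hψ : Packets l0 ψ K) (hA : 0 ≤ A)
    (hf : ∀ y ∈ F, ‖f y‖ ≤ 1) {u : Tile}
    (hS : ∀ s ∈ S, s.i ≤ u.i ∧ s.a / 8 ^ (u.i - s.i) = u.a)
    (hu : ∑ x ∈ F, wt (len l0 (u.i + 1)) (u.a / 8) x ^ 10 ≤ A * len l0 (u.i + 1))
    (hE : ∀ x ∈ E, 1 < |u.a - x / sc l0 u.i|) :
    ∑ x ∈ E, ∑ s ∈ S with Act l0 N x s, ‖coef φ f F s * ψ s x‖ ≤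
      2 ^ 16 * K ^ 2 * A * len l0 u.i := by
  have hK := hφ.nonneg
  have hL := len_pos (l0 := l0) u.i
  let g : ℕ × ℤ → ℤ → ℝ := fun p x =>
    2 ^ 13 * K ^ 2 * A * (len l0 p.1 / len l0 u.i) ^ 17 * wt (len l0 p.1) p.2 x ^ 2
  have hg0 : ∀ p x, 0 ≤ g p x := fun p x => by
    have := len_pos (l0 := l0) p.1
    have := wt_nonneg (len l0 p.1) p.2 x
    simp only [g]
    positivity
  have hpt : ∀ x ∈ E, ∀ s ∈ S, ‖coef φ f F s * ψ s x‖ ≤ g (s.i, s.a) x := by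
    intro x hx s hs
    obtain ⟨hi, ha⟩ := hS s hs
    have hl := len_pos (l0 := l0) s.i
    have hp := Real.sqrt_pos.2 hl
    have hw := wt_nonneg (len l0 s.i) s.a x
    have h1 : ∑ y ∈ F, wt (len l0 s.i) s.a y ^ 10 ≤ 2 ^ 10 * (A * (8 * len l0 u.i)) := by
      rw [← len_succ]
      refine le_trans ?_ (mul_le_mul_of_nonneg_left hu (by norm_num))
      rw [Finset.mul_sum]
      refine Finset.sum_le_sum fun y _ => ?_
      rw [← mul_pow]
      refine pow_le_pow_left₀ (wt_nonneg _ _ _) ?_ _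
      have := wt_le_anc (l0 := l0) (i := s.i) (j := u.i + 1) (by omega) s.a y
      have e : u.i + 1 - s.i = (u.i - s.i) + 1 := by omega
      rw [e, pow_succ, ← Int.ediv_ediv_of_nonneg (by positivity), ha] at this
      exact this
    have h2 := wt_le_of_far (l0 := l0) hi ha (hE x hx)
    calc _ = ‖coef φ f F s‖ * ‖ψ s x‖ := norm_mul _ _
      _ ≤ (K / √(len l0 s.i) * (2 ^ 10 * (A * (8 * len l0 u.i)))) *
          (K / √(len l0 s.i) * (wt (len l0 s.i) s.a x ^ 18 * wt (len l0 s.i) s.a x ^ 2)) := by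
          refine mul_le_mul ((norm_coef_le hφ hf s).trans ?_) ?_ (norm_nonneg _) (by positivity)
          · gcongr
          · rw [← pow_add]
            exact hψ.decay s x
      _ ≤ (K / √(len l0 s.i) * (2 ^ 10 * (A * (8 * len l0 u.i)))) *
          (K / √(len l0 s.i) * ((len l0 s.i / len l0 u.i) ^ 18 * wt (len l0 s.i) s.a x ^ 2)) := by
          gcongr
      _ = g (s.i, s.a) x := by
          simp only [g]
          have e : len l0 s.i = √(len l0 s.i) ^ 2 := (Real.sq_sqrt hl.le).symm
          generalize wt (len l0 s.i) s.a x = w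
          set r := √(len l0 s.i)
          rw [e]
          field_simp
          ring
  let I : Finset (Σ _ : ℕ, ℤ) := (Finset.range (u.i + 1)).sigma fun i =>
    Finset.Ico (u.a * 8 ^ (u.i - i)) ((u.a + 1) * 8 ^ (u.i - i))
  have hI : ∀ x ∈ E, ∑ s ∈ S with Act l0 N x s, ‖coef φ f F s * ψ s x‖ ≤
      ∑ p ∈ I, g (p.1, p.2) x := by
    intro x hx
    calc _ ≤ ∑ s ∈ S with Act l0 N x s, g (s.i, s.a) x :=
          Finset.sum_le_sum fun s hs => hpt x hx s (Finset.mem_filter.1 hs).1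
      _ = ∑ p ∈ (S.filter fun s => Act l0 N x s).image (fun s => (⟨s.i, s.a⟩ : Σ _ : ℕ, ℤ)),
          g (p.1, p.2) x := by
          rw [Finset.sum_image]
          intro s hs t ht hst
          have hs' := (Finset.mem_filter.1 hs).2
          have ht' := (Finset.mem_filter.1 ht).2
          simp only [Sigma.mk.injEq, heq_eq_eq] at hst
          unfold Act at hs' ht'
          rw [hst.1] at hs'
          exact Tile.ext hst.1 hst.2 (by omega)
      _ ≤ _ := by
          refine Finset.sum_le_sum_of_subset_of_nonneg (fun p hp => ?_) fun p _ _ => hg0 _ _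
          obtain ⟨s, hs, rfl⟩ := Finset.mem_image.1 hp
          obtain ⟨hi, ha⟩ := hS s (Finset.mem_filter.1 hs).1
          simp only [I, Finset.mem_sigma, Finset.mem_range, Finset.mem_Ico]
          have h8 : (0 : ℤ) < 8 ^ (u.i - s.i) := by positivity
          refine ⟨by omega, ?_, ?_⟩
          · rw [← ha]; exact Int.ediv_mul_le _ h8.ne'
          · rw [← ha]; exact Int.lt_ediv_add_one_mul_self _ h8
  refine (Finset.sum_le_sum hI).trans ?_
  rw [Finset.sum_comm, Finset.sum_sigma]
  calc _ ≤ ∑ i ∈ Finset.range (u.i + 1), 2 ^ 15 * K ^ 2 * A * len l0 i := by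
        refine Finset.sum_le_sum fun i hi => ?_
        have hiu : i ≤ u.i := by have := Finset.mem_range.1 hi; omega
        have hl := len_pos (l0 := l0) i
        have h1 : ∀ a, ∑ x ∈ E, g (i, a) x ≤
            2 ^ 13 * K ^ 2 * A * (len l0 i / len l0 u.i) ^ 17 * (4 * len l0 i) := fun a => by
          simp only [g]
          rw [← Finset.mul_sum]
          exact mul_le_mul_of_nonneg_left (sum_wt_sq_le (one_le_len i) a E) (by positivity)
        have e8 : (8 : ℝ) ^ (u.i - i) = len l0 u.i / len l0 i := by
          have := len_add (l0 := l0) i (u.i - i)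
          rw [Nat.add_sub_cancel' hiu] at this
          rw [this]
          field_simp
        have hcard : (((u.a + 1) * 8 ^ (u.i - i) - u.a * 8 ^ (u.i - i)).toNat : ℝ) =
            len l0 u.i / len l0 i := by
          rw [← e8]
          have : (u.a + 1) * 8 ^ (u.i - i) - u.a * 8 ^ (u.i - i) = ((8 ^ (u.i - i) : ℕ) : ℤ) := by
            push_cast; ring
          rw [this, Int.toNat_natCast]
          push_cast
          rfl
        calc _ ≤ ∑ a ∈ Finset.Ico (u.a * 8 ^ (u.i - i)) ((u.a + 1) * 8 ^ (u.i - i)),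
              2 ^ 13 * K ^ 2 * A * (len l0 i / len l0 u.i) ^ 17 * (4 * len l0 i) :=
              Finset.sum_le_sum fun a _ => h1 a
          _ = 2 ^ 15 * K ^ 2 * A * len l0 i * (len l0 i / len l0 u.i) ^ 16 := by
              rw [Finset.sum_const, Int.card_Ico, nsmul_eq_mul, hcard]
              field_simp
              ring
          _ ≤ 2 ^ 15 * K ^ 2 * A * len l0 i * 1 := by
              gcongr
              exact pow_le_one₀ (by positivity) ((div_le_one hL).2 (len_mono hiu))
          _ = _ := mul_one _
    _ ≤ 2 ^ 15 * K ^ 2 * A * (2 * len l0 u.i) := by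
        rw [← Finset.mul_sum]
        exact mul_le_mul_of_nonneg_left (sum_len_le _) (by positivity)
    _ = _ := by ring

lemma sum_min_le {D a ρ : ℝ} (hD : 0 ≤ D) (ha : 0 ≤ a) (hρ : 0 ≤ ρ) (n : ℕ) :
    ∑ k ∈ Finset.range n, min (D * a) (D * ρ * (1 / 2) ^ k) ≤ 4 * (D * √(a * ρ)) := by
  have hgeo : ∑ k ∈ Finset.range n, (3 / 4 : ℝ) ^ k ≤ 4 := by
    rw [geom_sum_eq (by norm_num)]
    have : (0 : ℝ) ≤ (3 / 4) ^ n := by positivity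
    rw [div_le_iff_of_neg (by norm_num)]
    linarith
  calc _ ≤ ∑ k ∈ Finset.range n, D * √(a * ρ) * (3 / 4 : ℝ) ^ k := by
        refine Finset.sum_le_sum fun k _ => ?_
        have h1 : (1 / 2 : ℝ) ^ k ≤ ((3 / 4) ^ k) ^ 2 := by
          rw [← pow_mul, mul_comm, pow_mul]
          exact pow_le_pow_left₀ (by norm_num) (by norm_num) _
        refine abs_le_of_sq_le_sq' ?_ (by positivity) |>.2
        calc _ = min (D * a) (D * ρ * (1 / 2) ^ k) * min (D * a) (D * ρ * (1 / 2) ^ k) := sq _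
          _ ≤ (D * a) * (D * ρ * (1 / 2) ^ k) :=
              mul_le_mul (min_le_left _ _) (min_le_right _ _)
                (le_min (by positivity) (by positivity)) (by positivity)
          _ ≤ (D * a) * (D * ρ * ((3 / 4) ^ k) ^ 2) := by gcongr
          _ = _ := by rw [mul_pow, mul_pow, Real.sq_sqrt (by positivity)]; ring
    _ ≤ D * √(a * ρ) * 4 := by
        rw [← Finset.mul_sum]
        exact mul_le_mul_of_nonneg_left hgeo (by positivity)
    _ = _ := by ring

/-- One step of the simultaneous size and density decomposition. -/
lemma exists_step (hφ : Packets l0 φ K) (hψ : Packets l0 ψ K) (hK : 1 ≤ K)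
    (hf : ∀ y ∈ F, ‖f y‖ ≤ 1) (hV : ∀ s ∈ S, s.Valid l0) {σ δ m : ℝ} (hσ : 0 < σ) (hδ : 0 < δ)
    (hm : 0 ≤ m) (hS : Size l0 (coef φ f F) σ S) (hSm : Size l0 (coef φ f F) m S)
    (hD : Dens l0 E N δ S) (hrel : K ^ 2 * δ * F.card ≤ 4 * σ ^ 2 * E.card) :
    ∃ S' ⊆ S, Size l0 (coef φ f F) (σ / 2) S' ∧ Dens l0 E N (δ / 4) S' ∧
      ∑ x ∈ E, ‖modelOp l0 N (coef φ f F) ψ S x‖ ≤ 2 ^ 76 * K ^ 2 * m * E.card +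
        ∑ x ∈ E, ‖modelOp l0 N (coef φ f F) ψ S' x‖ := by
  obtain ⟨S1, hS1, hsz, hC1⟩ := size_lemma hφ f F S hV hσ hS
  obtain ⟨S2, hS2, hden, hC2⟩ := mass_lemma (l0 := l0) E N S1 (show 0 < δ / 4 by positivity)
  refine ⟨S2, hS2.trans hS1, hsz.mono hS2, hden, ?_⟩
  have hsub1 : S \ S1 ⊆ S := Finset.sdiff_subset
  have hsub2 : S1 \ S2 ⊆ S := Finset.sdiff_subset.trans hS1
  have h1 := hC1.modelOp_le hψ (fun s hs => hV s (hsub1 hs)) (hD.mono hsub1) (hSm.mono hsub1) hδ.le hm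
  have h2 := hC2.modelOp_le hψ (fun s hs => hV s (hsub2 hs)) (hD.mono hsub2) (hSm.mono hsub2) hδ.le hm
  have hsum : ∑ y ∈ F, ‖f y‖ ^ 2 ≤ F.card := by
    calc _ ≤ ∑ y ∈ F, (1 : ℝ) :=
          Finset.sum_le_sum fun y hy => pow_le_one₀ (norm_nonneg _) (hf y hy)
      _ = _ := by simp
  have hL1 : δ * (2 ^ 32 * K ^ 2 / σ ^ 2 * ∑ y ∈ F, ‖f y‖ ^ 2) ≤ 2 ^ 34 * E.card := by
    calc _ ≤ δ * (2 ^ 32 * K ^ 2 / σ ^ 2 * F.card) := by gcongr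
      _ = 2 ^ 32 * (K ^ 2 * δ * F.card) / σ ^ 2 := by ring
      _ ≤ 2 ^ 32 * (4 * σ ^ 2 * E.card) / σ ^ 2 := by gcongr
      _ = _ := by field_simp; ring
  have hL2 : δ * (2 ^ 15 / (δ / 4) * E.card) = 2 ^ 17 * E.card := by field_simp; ring
  have hsplit : ∑ x ∈ E, ‖modelOp l0 N (coef φ f F) ψ S x‖ ≤
      ∑ x ∈ E, ‖modelOp l0 N (coef φ f F) ψ S2 x‖ +
      (∑ x ∈ E, ‖modelOp l0 N (coef φ f F) ψ (S1 \ S2) x‖ +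
      ∑ x ∈ E, ‖modelOp l0 N (coef φ f F) ψ (S \ S1) x‖) := by
    rw [← Finset.sum_add_distrib, ← Finset.sum_add_distrib]
    refine Finset.sum_le_sum fun x _ => ?_
    rw [modelOp_sdiff N _ ψ hS1, modelOp_sdiff N _ ψ hS2, ← add_assoc]
    exact norm_add₃_le
  have hKK : K + K ^ 2 ≤ 2 * K ^ 2 := by nlinarith
  have h1' : 2 ^ 40 * (K + K ^ 2) * (m * δ * (2 ^ 32 * K ^ 2 / σ ^ 2 * ∑ y ∈ F, ‖f y‖ ^ 2)) ≤
      2 ^ 75 * K ^ 2 * m * E.card := by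
    calc _ = 2 ^ 40 * (K + K ^ 2) * (m * (δ * (2 ^ 32 * K ^ 2 / σ ^ 2 * ∑ y ∈ F, ‖f y‖ ^ 2))) := by
          ring
      _ ≤ 2 ^ 40 * (2 * K ^ 2) * (m * (2 ^ 34 * E.card)) := by gcongr
      _ = _ := by ring
  have h2' : 2 ^ 40 * (K + K ^ 2) * (m * δ * (2 ^ 15 / (δ / 4) * E.card)) ≤
      2 ^ 75 * K ^ 2 * m * E.card := by
    calc _ = 2 ^ 40 * (K + K ^ 2) * (m * (δ * (2 ^ 15 / (δ / 4) * E.card))) := by ring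
      _ ≤ 2 ^ 40 * (2 * K ^ 2) * (m * (2 ^ 34 * E.card)) := by rw [hL2]; gcongr <;> norm_num
      _ = _ := by ring
  linarith

/-- The model operator on a family of given initial size. -/
lemma sum_modelOp_le (hφ : Packets l0 φ K) (hψ : Packets l0 ψ K) (hK : 1 ≤ K)
    (hf : ∀ y ∈ F, ‖f y‖ ≤ 1) (hV : ∀ s ∈ S, s.Valid l0) (hE : E.Nonempty) (hF : F.Nonempty)
    {D a ρ : ℝ} (hρ : ρ = √F.card / √E.card) (hD : K ≤ D) (ha : 0 ≤ a) (haρ : a ≤ ρ)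
    (hS : Size l0 (coef φ f F) (D * a) S) :
    ∑ x ∈ E, ‖modelOp l0 N (coef φ f F) ψ S x‖ ≤ 2 ^ 78 * K ^ 2 * D * √(a * ρ) * E.card := by
  have hE0 : (0 : ℝ) < E.card := by exact_mod_cast hE.card_pos
  have hF0 : (0 : ℝ) < F.card := by exact_mod_cast hF.card_pos
  have hD0 : 0 < D := by linarith
  have hρ0 : 0 < ρ := by rw [hρ]; positivity
  have hρ2 : ρ ^ 2 * E.card = F.card := by
    rw [hρ, div_pow, Real.sq_sqrt hF0.le, Real.sq_sqrt hE0.le]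
    field_simp
  have hit : ∀ n : ℕ, ∃ S' ⊆ S, Size l0 (coef φ f F) (D * ρ * (1 / 2) ^ n) S' ∧
      Dens l0 E N (4 * (1 / 4) ^ n) S' ∧ ∑ x ∈ E, ‖modelOp l0 N (coef φ f F) ψ S x‖ ≤
        2 ^ 76 * K ^ 2 * (∑ k ∈ Finset.range n, min (D * a) (D * ρ * (1 / 2) ^ k)) * E.card +
        ∑ x ∈ E, ‖modelOp l0 N (coef φ f F) ψ S' x‖ := by
    intro n
    induction n with
    | zero =>
      refine ⟨S, subset_rfl, fun T => (hS T).trans ?_, by simpa using mass_le E N S, by simp⟩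
      have hl := len_pos (l0 := l0) T.i
      rw [pow_zero, mul_one]
      gcongr
    | succ n ih =>
      obtain ⟨S', hS', hsz, hden, hle⟩ := ih
      have hSm : Size l0 (coef φ f F) (min (D * a) (D * ρ * (1 / 2) ^ n)) S' := by
        rcases min_choice (D * a) (D * ρ * (1 / 2) ^ n) with h | h <;> rw [h]
        · exact hS.mono hS'
        · exact hsz
      obtain ⟨S'', hS'', hsz', hden', hle'⟩ := exists_step hφ hψ hK hf (fun s hs => hV s (hS' hs))
        (E := E) (N := N) (by positivity) (by positivity) (le_min (by positivity) (by positivity))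
        hsz hSm hden (by
          rw [← hρ2]
          have : ((1 / 2 : ℝ) ^ n) ^ 2 = (1 / 4) ^ n := by
            rw [← pow_mul, mul_comm, pow_mul]; norm_num
          calc K ^ 2 * (4 * (1 / 4) ^ n) * (ρ ^ 2 * E.card)
              ≤ D ^ 2 * (4 * (1 / 4) ^ n) * (ρ ^ 2 * E.card) := by gcongr
            _ = _ := by rw [mul_pow, mul_pow, this]; ring)
      refine ⟨S'', hS''.trans hS', ?_, ?_, ?_⟩
      · convert hsz' using 1; ring
      · convert hden' using 1; ring
      · rw [Finset.sum_range_succ]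
        linarith
  set B := ∑ x ∈ E, ∑ s ∈ S, √(len l0 s.i) * ‖ψ s x‖ with hB
  have hrem : ∀ n : ℕ, ∑ x ∈ E, ‖modelOp l0 N (coef φ f F) ψ S x‖ ≤
      2 ^ 78 * K ^ 2 * D * √(a * ρ) * E.card + (D * ρ * B) * (1 / 2) ^ n := by
    intro n
    obtain ⟨S', hS', hsz, -, hle⟩ := hit n
    have h1 := sum_min_le hD0.le ha hρ0.le n
    have h2 : ∑ x ∈ E, ‖modelOp l0 N (coef φ f F) ψ S' x‖ ≤ (D * ρ * B) * (1 / 2) ^ n := by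
      calc _ ≤ ∑ x ∈ E, ∑ s ∈ S, D * ρ * (1 / 2) ^ n * (√(len l0 s.i) * ‖ψ s x‖) := by
            refine Finset.sum_le_sum fun x _ => (norm_sum_le _ _).trans ?_
            refine (Finset.sum_le_sum fun s hs => ?_).trans
              (Finset.sum_le_sum_of_subset_of_nonneg ((Finset.filter_subset _ _).trans hS')
                fun s _ _ => by positivity)
            rw [norm_mul, ← mul_assoc]
            exact mul_le_mul_of_nonneg_right
              (hsz.coef_le (by positivity) (Finset.mem_filter.1 hs).1) (norm_nonneg _)
        _ = _ := by
            rw [hB, Finset.mul_sum, Finset.sum_mul]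
            refine Finset.sum_congr rfl fun x _ => ?_
            rw [← Finset.mul_sum]
            ring
    have h3 : 2 ^ 76 * K ^ 2 * (∑ k ∈ Finset.range n, min (D * a) (D * ρ * (1 / 2) ^ k)) * E.card ≤
        2 ^ 76 * K ^ 2 * (4 * (D * √(a * ρ))) * E.card := by gcongr
    linarith
  refine ge_of_tendsto' (x := Filter.atTop) ?_ hrem
  have : Filter.Tendsto (fun n : ℕ => (1 / 2 : ℝ) ^ n) Filter.atTop (nhds 0) :=
    tendsto_pow_atTop_nhds_zero_of_lt_one (by norm_num) (by norm_num)
  simpa using (this.const_mul (D * ρ * B)).const_add (2 ^ 78 * K ^ 2 * D * √(a * ρ) * E.card)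

end

section
variable {l0 : ℕ} [NeZero l0] {N : ℤ → ℝ} {E F : Finset ℤ} {A K : ℝ} {φ ψ : Tile → ℤ → ℂ}
  {c : Tile → ℂ} {f : ℤ → ℂ} {S : Finset Tile}

lemma restricted_of_card_le (hφ : Packets l0 φ K) (hψ : Packets l0 ψ K) (hK : 1 ≤ K)
    (hf : ∀ y ∈ F, ‖f y‖ ≤ 1) (hV : ∀ s ∈ S, s.Valid l0) (hEF : E.card ≤ F.card) :
    ∑ x ∈ E, ‖modelOp l0 N (coef φ f F) ψ S x‖ ≤
      2 ^ 139 * K ^ 4 * (√(√E.card * √F.card) * √E.card) := by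
  rcases E.eq_empty_or_nonempty with rfl | hE
  · simp
  have hE0 : (0 : ℝ) < E.card := by exact_mod_cast hE.card_pos
  have hEF' : (E.card : ℝ) ≤ F.card := by exact_mod_cast hEF
  have hF0 : (0 : ℝ) < F.card := hE0.trans_le hEF'
  have hF : F.Nonempty := Finset.card_pos.1 (by exact_mod_cast hF0)
  set X := √(E.card : ℝ) with hX
  set Y := √(F.card : ℝ) with hY
  have hX0 : 0 < X := Real.sqrt_pos.2 hE0
  have hY0 : 0 < Y := Real.sqrt_pos.2 hF0
  have hXY : X ≤ Y := Real.sqrt_le_sqrt hEF'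
  have hX2 : (E.card : ℝ) = X ^ 2 := (Real.sq_sqrt hE0.le).symm
  clear_value X Y
  have hsz := size_le (A := 4) hφ hK hf (by norm_num) hV fun s _ j _ =>
    sum_wt_pow_le (one_le_len (l0 := l0) j) _ F (by norm_num)
  have key := sum_modelOp_le (N := N) hφ hψ hK hf hV hE hF (D := 2 ^ 61 * K ^ 2) (a := 1)
    (ρ := Y / X) (by rw [hX, hY]) (by nlinarith) (by norm_num) (by rwa [one_le_div hX0]) (fun T => (hsz T).trans (by
      have := (len_pos (l0 := l0) T.i).le
      gcongr ?_ ^ 2 * _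
      nlinarith [sq_nonneg K]))
  refine key.trans (le_of_eq ?_)
  have e : √(1 * (Y / X)) = √(X * Y) / X := by
    rw [show 1 * (Y / X) = (X * Y) / X ^ 2 by field_simp, Real.sqrt_div (by positivity),
      Real.sqrt_sq hX0.le]
  rw [e, hX2]
  field_simp

lemma restricted_of_le_card (hφ : Packets l0 φ K) (hψ : Packets l0 ψ K) (hK : 1 ≤ K)
    (hf : ∀ y ∈ F, ‖f y‖ ≤ 1) (hV : ∀ s ∈ S, s.Valid l0) (n : ℕ) : ∀ E : Finset ℤ, E.card ≤ n →
    F.card ≤ E.card →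
    ∑ x ∈ E, ‖modelOp l0 N (coef φ f F) ψ S x‖ ≤
      2 ^ 141 * K ^ 4 * (√(√E.card * √F.card) * √F.card) := by
  induction n with
  | zero =>
    intro E hE _
    rw [Finset.card_eq_zero.1 (Nat.le_zero.1 hE)]
    simp
  | succ n ih =>
    intro E hEn hFE
    rcases F.eq_empty_or_nonempty with rfl | hF
    · simp [modelOp, coef]
    have hF0 : (0 : ℝ) < F.card := by exact_mod_cast hF.card_pos
    have hFE' : (F.card : ℝ) ≤ E.card := by exact_mod_cast hFE
    have hE0 : (0 : ℝ) < E.card := hF0.trans_le hFE'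
    have hE : E.Nonempty := Finset.card_pos.1 (by exact_mod_cast hE0)
    set X := √(E.card : ℝ) with hX
    set Y := √(F.card : ℝ) with hY
    have hX0 : 0 < X := Real.sqrt_pos.2 hE0
    have hY0 : 0 < Y := Real.sqrt_pos.2 hF0
    have hYX : Y ≤ X := Real.sqrt_le_sqrt hFE'
    have hX2 : (E.card : ℝ) = X ^ 2 := (Real.sq_sqrt hE0.le).symm
    have hY2 : (F.card : ℝ) = Y ^ 2 := (Real.sq_sqrt hF0.le).symm
    clear_value X Y
    set A : ℝ := 2 ^ 21 * (Y / X) ^ 2 with hA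
    have hA0 : 0 < A := by positivity
    obtain ⟨M, hM, hMS⟩ := exists_heavy (l0 := l0) hA0 F S
    have hM' : ∑ u ∈ M, len l0 u.i ≤ X ^ 2 / 2 ^ 6 := by
      refine hM.trans (le_of_eq ?_)
      rw [hA, hY2]
      field_simp
    set Sg := S.filter fun s => ∀ j, s.i ≤ j →
      ∑ x ∈ F, wt (len l0 j) (s.a / 8 ^ (j - s.i)) x ^ 10 ≤ A * len l0 j with hSg
    set B := E.filter fun x => ∃ u ∈ M, |u.a - x / sc l0 u.i| ≤ 1 with hB
    have hBE : B ⊆ E := Finset.filter_subset _ _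
    have hBcard : (B.card : ℝ) ≤ X ^ 2 / 16 := by
      have h1 : B ⊆ M.biUnion fun u => Top.triple l0 ⟨u.i, u.a, 0⟩ := by
        intro x hx
        obtain ⟨u, hu, hux⟩ := (Finset.mem_filter.1 hx).2
        exact Finset.mem_biUnion.2 ⟨u, hu, mem_triple.2 hux⟩
      have h2 : (B.card : ℝ) ≤ ∑ u ∈ M, ((Top.triple l0 ⟨u.i, u.a, 0⟩).card : ℝ) := by
        exact_mod_cast (Finset.card_le_card h1).trans Finset.card_biUnion_le
      simp only [card_triple] at h2
      rw [← Finset.mul_sum] at h2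
      linarith [sq_nonneg X]
    set R := √(X * Y) with hR
    have hR0 : 0 < R := Real.sqrt_pos.2 (by positivity)
    have hR2 : R ^ 2 = X * Y := Real.sq_sqrt (by positivity)
    have hYR : Y ≤ R := by
      rw [hR]
      exact Real.le_sqrt_of_sq_le (by nlinarith)
    -- the good tiles
    have hgood : ∑ x ∈ E, ‖modelOp l0 N (coef φ f F) ψ Sg x‖ ≤ 2 ^ 139 * K ^ 4 * (R * Y) := by
      have hsz := size_le (S := Sg) hφ hK hf hA0.le
        (fun s hs => hV s (Finset.mem_filter.1 hs).1) fun s hs => (Finset.mem_filter.1 hs).2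
      have key := sum_modelOp_le (N := N) (S := Sg) hφ hψ hK hf
        (fun s hs => hV s (Finset.mem_filter.1 hs).1) hE hF
        (D := 2 ^ 61 * K ^ 2) (a := (Y / X) ^ 2)
        (ρ := Y / X) (by rw [hX, hY]) (by nlinarith) (by positivity)
        (pow_le_of_le_one (by positivity) ((div_le_one hX0).2 hYX) (by norm_num))
        (fun T => (hsz T).trans (by
          refine le_of_eq ?_
          rw [hA]
          ring))
      refine key.trans (le_of_eq ?_)
      have e : √((Y / X) ^ 2 * (Y / X)) = R * Y / X ^ 2 := by
        rw [show (Y / X) ^ 2 * (Y / X) = (X * Y) * (Y / X ^ 2) ^ 2 by field_simp,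
          Real.sqrt_mul (by positivity), Real.sqrt_sq (by positivity)]
        ring
      rw [e, hX2]
      field_simp
    -- the bad tiles away from the exceptional set
    have hbad : ∑ x ∈ E \ B, ‖modelOp l0 N (coef φ f F) ψ (S \ Sg) x‖ ≤
        2 ^ 139 * K ^ 4 * (R * Y) := by
      let P : Tile → Tile → Prop := fun u s => s.i ≤ u.i ∧ s.a / 8 ^ (u.i - s.i) = u.a
      obtain ⟨M', hM'⟩ : ∃ M', M' = M.filter fun u =>
        ∑ x ∈ F, wt (len l0 (u.i + 1)) (u.a / 8) x ^ 10 ≤ A * len l0 (u.i + 1) := ⟨_, rfl⟩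
      have hpt : ∀ x, ‖modelOp l0 N (coef φ f F) ψ (S \ Sg) x‖ ≤
          ∑ u ∈ M', ∑ s ∈ (S.filter (P u)) with Act l0 N x s, ‖coef φ f F s * ψ s x‖ := by
        intro x
        refine (norm_sum_le _ _).trans ?_
        have hex : ∀ s ∈ (S \ Sg).filter fun s => Act l0 N x s, ∃ u ∈ M', P u s := by
          intro s hs
          obtain ⟨hs1, hs2⟩ := Finset.mem_sdiff.1 (Finset.mem_filter.1 hs).1
          rcases hMS s hs1 with hg | ⟨u, hu, h1, h2, h3⟩
          · exact absurd (Finset.mem_filter.2 ⟨hs1, hg⟩) hs2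
          · rw [hM']
            exact ⟨u, Finset.mem_filter.2 ⟨hu, h3⟩, h1, h2⟩
        calc _ ≤ ∑ s ∈ S with Act l0 N x s, ∑ u ∈ M' with P u s, ‖coef φ f F s * ψ s x‖ := by
              refine (Finset.sum_le_sum fun s hs => ?_).trans (Finset.sum_le_sum_of_subset_of_nonneg
                (Finset.filter_subset_filter _ Finset.sdiff_subset) fun s _ _ =>
                  Finset.sum_nonneg fun _ _ => norm_nonneg _)
              obtain ⟨u, hu, hP⟩ := hex s hs
              exact Finset.single_le_sum (f := fun _ : Tile => ‖coef φ f F s * ψ s x‖)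
                (fun _ _ => norm_nonneg _) (Finset.mem_filter.2 ⟨hu, hP⟩)
          _ = _ := by
              refine Finset.sum_comm' fun s u => ?_
              simp only [Finset.mem_filter]
              tauto
      calc _ ≤ ∑ u ∈ M', ∑ x ∈ E \ B, ∑ s ∈ (S.filter (P u)) with Act l0 N x s,
            ‖coef φ f F s * ψ s x‖ := by
            rw [Finset.sum_comm]
            exact Finset.sum_le_sum fun x _ => hpt x
        _ ≤ ∑ u ∈ M', 2 ^ 16 * K ^ 2 * A * len l0 u.i := by
            refine Finset.sum_le_sum fun u hu => ?_
            rw [hM'] at hu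
            obtain ⟨huM, hu⟩ := Finset.mem_filter.1 hu
            refine sum_below_heavy_le hφ hψ hA0.le hf (fun s hs => (Finset.mem_filter.1 hs).2) hu ?_
            intro x hx
            obtain ⟨hxE, hxB⟩ := Finset.mem_sdiff.1 hx
            by_contra hcon
            exact hxB (Finset.mem_filter.2 ⟨hxE, u, huM, not_lt.1 hcon⟩)
        _ ≤ ∑ u ∈ M, 2 ^ 16 * K ^ 2 * A * len l0 u.i := by
            rw [hM']
            refine Finset.sum_le_sum_of_subset_of_nonneg (Finset.filter_subset _ _) fun u _ _ => ?_
            have := len_pos (l0 := l0) u.i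
            positivity
        _ ≤ 2 ^ 16 * K ^ 2 * A * (2 ^ 15 / A * F.card) := by
            rw [← Finset.mul_sum]
            exact mul_le_mul_of_nonneg_left hM (by positivity)
        _ = 2 ^ 31 * K ^ 2 * (Y * Y) := by rw [hY2]; field_simp
        _ ≤ 2 ^ 139 * K ^ 4 * (R * Y) := by
            gcongr
            · norm_num
            · norm_num
            · norm_num
    -- the exceptional set
    have hexc : ∑ x ∈ B, ‖modelOp l0 N (coef φ f F) ψ S x‖ ≤ 2 ^ 140 * K ^ 4 * (R * Y) := by
      have hsqB : √(B.card : ℝ) ≤ X / 4 := by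
        refine Real.sqrt_le_iff.2 ⟨by positivity, ?_⟩
        linarith
      have hRB : √(√(B.card : ℝ) * Y) ≤ R / 2 := by
        refine Real.sqrt_le_iff.2 ⟨by positivity, ?_⟩
        have : (R / 2) ^ 2 = X / 4 * Y := by rw [div_pow, hR2]; ring
        rw [this]
        gcongr
      rcases le_total B.card F.card with hBF | hBF
      · have hr := restricted_of_card_le (N := N) hφ hψ hK hf hV hBF
        rw [← hY] at hr
        refine hr.trans ?_
        have h1 : √(B.card : ℝ) ≤ Y := hY ▸ Real.sqrt_le_sqrt (by exact_mod_cast hBF)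
        calc _ ≤ 2 ^ 139 * K ^ 4 * (R / 2 * Y) :=
              mul_le_mul_of_nonneg_left (mul_le_mul hRB h1 (Real.sqrt_nonneg _) (by linarith))
                (by positivity)
          _ ≤ _ := by
            have : 0 ≤ K ^ 4 * (R * Y) := by positivity
            linarith
      · have hlt : B.card < E.card := by
          have : (B.card : ℝ) < E.card := by rw [hX2]; nlinarith
          exact_mod_cast this
        have hr := ih B (by omega) hBF
        refine hr.trans ?_
        calc _ ≤ 2 ^ 141 * K ^ 4 * (R / 2 * Y) := by gcongr
          _ = _ := by ring
    have hSgS : Sg ⊆ S := Finset.filter_subset _ _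
    have hsplit : ∑ x ∈ E \ B, ‖modelOp l0 N (coef φ f F) ψ S x‖ ≤
        ∑ x ∈ E, ‖modelOp l0 N (coef φ f F) ψ Sg x‖ +
        ∑ x ∈ E \ B, ‖modelOp l0 N (coef φ f F) ψ (S \ Sg) x‖ := by
      calc _ ≤ ∑ x ∈ E \ B, ‖modelOp l0 N (coef φ f F) ψ Sg x‖ +
            ∑ x ∈ E \ B, ‖modelOp l0 N (coef φ f F) ψ (S \ Sg) x‖ := by
            rw [← Finset.sum_add_distrib]
            refine Finset.sum_le_sum fun x _ => ?_
            rw [modelOp_sdiff N _ ψ hSgS]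
            exact norm_add_le _ _
        _ ≤ _ := by
            gcongr
            exact Finset.sdiff_subset
    rw [← Finset.sum_sdiff hBE]
    linarith

/-- Restricted estimate for the model operator. -/
lemma restricted_le (hφ : Packets l0 φ K) (hψ : Packets l0 ψ K) (hK : 1 ≤ K)
    (hf : ∀ y ∈ F, ‖f y‖ ≤ 1) (hV : ∀ s ∈ S, s.Valid l0) :
    ∑ x ∈ E, ‖modelOp l0 N (coef φ f F) ψ S x‖ ≤
      2 ^ 141 * K ^ 4 * (√(√E.card * √F.card) * min √E.card √F.card) := by
  rcases le_total E.card F.card with h | h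
  · rw [min_eq_left (Real.sqrt_le_sqrt (by exact_mod_cast h))]
    refine (restricted_of_card_le hφ hψ hK hf hV h).trans ?_
    gcongr <;> norm_num
  · rw [min_eq_right (Real.sqrt_le_sqrt (by exact_mod_cast h))]
    exact restricted_of_le_card hφ hψ hK hf hV _ E le_rfl h

end

lemma sum_half_pow_natAbs_le (I : Finset ℤ) (l : ℤ) :
    ∑ k ∈ I, (1 / 2 : ℝ) ^ (k - l).natAbs ≤ 4 := by
  have key : ∀ J : Finset ℤ, Set.InjOn (fun k : ℤ => (k - l).natAbs) J →
      ∑ k ∈ J, (1 / 2 : ℝ) ^ (k - l).natAbs ≤ 2 := by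
    intro J hJ
    rw [← Finset.sum_image (f := fun n : ℕ => (1 / 2 : ℝ) ^ n) hJ]
    refine le_of_le_of_eq ?_ tsum_geometric_two
    exact summable_geometric_two.sum_le_tsum _ fun _ _ => by positivity
  rw [← Finset.sum_filter_add_sum_filter_not I fun k => l ≤ k]
  have h1 := key (I.filter fun k => l ≤ k) (by
    intro a ha b hb hab
    have h1 := (Finset.mem_filter.1 (Finset.mem_coe.1 ha)).2
    have h2 := (Finset.mem_filter.1 (Finset.mem_coe.1 hb)).2
    simp only at hab
    omega)
  have h2 := key (I.filter fun k => ¬ l ≤ k) (by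
    intro a ha b hb hab
    have h1 := (Finset.mem_filter.1 (Finset.mem_coe.1 ha)).2
    have h2 := (Finset.mem_filter.1 (Finset.mem_coe.1 hb)).2
    simp only at hab
    omega)
  linarith

lemma four_zpow (k : ℤ) : (4 : ℝ) ^ k = (2 ^ k) ^ 2 := by
  rw [← zpow_natCast, ← zpow_mul, mul_comm, zpow_mul]
  norm_num

lemma level_le_aux {e f : ℝ} (he : 0 ≤ e) (hf : 0 ≤ f) {k l : ℤ} (h : l ≤ k) :
    (4 : ℝ) ^ l * 4 ^ k * (√(√e * √f) * √f) ≤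
      (1 / 2) ^ (k - l).natAbs * ((4 ^ k) ^ 2 * f + (4 ^ l) ^ 2 * e) := by
  obtain ⟨n, rfl⟩ : ∃ n : ℕ, k = l + n := ⟨(k - l).toNat, by omega⟩
  rw [show (l + n - l : ℤ).natAbs = n by omega]
  set a : ℝ := 2 ^ l with ha
  have ha0 : 0 < a := by positivity
  have hk : (2 : ℝ) ^ (l + (n : ℤ)) = a * 2 ^ n := by rw [zpow_add₀ (by norm_num), zpow_natCast]
  rw [four_zpow, four_zpow, hk, ← ha]
  set b : ℝ := 2 ^ n with hb
  have hb0 : 0 < b := by positivity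
  have hbn : (1 / 2 : ℝ) ^ n = 1 / b := by rw [hb, div_pow, one_pow]
  rw [hbn]
  set p := a ^ 2 * √e with hp
  set q := (a * b) ^ 2 * √f with hq
  have hp0 : 0 ≤ p := by positivity
  have hq0 : 0 ≤ q := by positivity
  have h1 : √(√e * √f) * (a * (a * b)) = √(p * q) := by
    rw [hp, hq, show a ^ 2 * √e * ((a * b) ^ 2 * √f) = √e * √f * (a * (a * b)) ^ 2 by ring,
      Real.sqrt_mul (by positivity) ((a * (a * b)) ^ 2), Real.sqrt_sq (by positivity)]
  have h2 : a ^ 2 * (a * b) ^ 2 * (√(√e * √f) * √f) = 1 / b * (√(p * q) * q) := by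
    rw [← h1, hq]
    field_simp
  have h3 : ((a * b) ^ 2) ^ 2 * f = q ^ 2 := by rw [hq, mul_pow _ (√f), Real.sq_sqrt hf]
  have h4 : (a ^ 2) ^ 2 * e = p ^ 2 := by rw [hp, mul_pow _ (√e), Real.sq_sqrt he]
  rw [h2, h3, h4]
  refine mul_le_mul_of_nonneg_left ?_ (by positivity)
  have h5 : √(p * q) ≤ (p + q) / 2 := Real.sqrt_le_iff.2 ⟨by positivity, by nlinarith [sq_nonneg (p - q)]⟩
  calc √(p * q) * q ≤ (p + q) / 2 * q := by gcongr
    _ ≤ _ := by nlinarith [sq_nonneg (p - q)]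

lemma level_le {e f : ℝ} (he : 0 ≤ e) (hf : 0 ≤ f) (k l : ℤ) :
    (4 : ℝ) ^ l * 4 ^ k * (√(√e * √f) * min √e √f) ≤
      (1 / 2) ^ (k - l).natAbs * ((4 ^ k) ^ 2 * f + (4 ^ l) ^ 2 * e) := by
  rcases le_total l k with h | h
  · refine le_trans ?_ (level_le_aux he hf h)
    gcongr
    exact min_le_right _ _
  · have := level_le_aux hf he h
    rw [show (l - k).natAbs = (k - l).natAbs by omega, mul_comm √f, add_comm,
      mul_comm ((4 : ℝ) ^ k) (4 ^ l)] at this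
    refine le_trans ?_ this
    gcongr
    exact min_le_left _ _

section
variable {l0 : ℕ} [NeZero l0] {N : ℤ → ℝ} {E F : Finset ℤ} {K : ℝ} {φ ψ : Tile → ℤ → ℂ}
  {f : ℤ → ℂ} {S : Finset Tile}

lemma modelOp_sum {ι : Type*} (I : Finset ι) (c : ι → Tile → ℂ) (x : ℤ) :
    modelOp l0 N (fun s => ∑ k ∈ I, c k s) ψ S x = ∑ k ∈ I, modelOp l0 N (c k) ψ S x := by
  simp only [modelOp, Finset.sum_mul]
  exact Finset.sum_comm

lemma modelOp_smul (a : ℂ) (c : Tile → ℂ) (x : ℤ) :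
    modelOp l0 N (fun s => a * c s) ψ S x = a * modelOp l0 N c ψ S x := by
  simp only [modelOp, Finset.mul_sum, mul_assoc]

lemma restricted_scaled (hφ : Packets l0 φ K) (hψ : Packets l0 ψ K) (hK : 1 ≤ K) {M : ℝ}
    (hM : 0 < M) (hf : ∀ y ∈ F, ‖f y‖ ≤ M) (hV : ∀ s ∈ S, s.Valid l0) :
    ∑ x ∈ E, ‖modelOp l0 N (coef φ f F) ψ S x‖ ≤
      2 ^ 141 * K ^ 4 * (M * (√(√E.card * √F.card) * min √E.card √F.card)) := by
  have hM' : (M : ℂ) ≠ 0 := by exact_mod_cast hM.ne'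
  have h1 : coef φ f F = fun s => (M : ℂ) * coef φ (fun y => f y / M) F s := by
    ext s
    rw [coef, coef, Finset.mul_sum]
    refine Finset.sum_congr rfl fun y _ => ?_
    field_simp
  have h2 : ∀ x, ‖modelOp l0 N (coef φ f F) ψ S x‖ =
      M * ‖modelOp l0 N (coef φ (fun y => f y / M) F) ψ S x‖ := by
    intro x
    rw [h1, modelOp_smul, norm_mul, Complex.norm_real, Real.norm_of_nonneg hM.le]
  simp only [h2]
  rw [← Finset.mul_sum]
  have h3 := restricted_le (E := E) (N := N) (f := fun y => f y / M) hφ hψ hK (fun y hy => by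
    rw [norm_div, Complex.norm_real, Real.norm_of_nonneg hM.le]
    exact (div_le_one hM).2 (hf y hy)) hV
  refine (mul_le_mul_of_nonneg_left h3 hM.le).trans (le_of_eq ?_)
  ring

lemma sq_clog_le {v : ℝ} (hv : 0 < v) : ((4 : ℝ) ^ Int.clog 4 v) ^ 2 ≤ 16 * v ^ 2 := by
  have h := Int.zpow_pred_clog_lt_self (b := 4) (by norm_num) hv
  rw [zpow_sub₀ (by norm_num)] at h
  push_cast at h
  have : (4 : ℝ) ^ Int.clog 4 v ≤ 4 * v := by
    have := (div_lt_iff₀ (by norm_num)).1 h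
    norm_num at this
    linarith
  calc _ ≤ (4 * v) ^ 2 := by gcongr
    _ = _ := by ring

lemma sum_level_le {v : ℤ → ℝ} (hv : ∀ y ∈ F, 0 < v y) :
    ∑ k ∈ F.image (fun y => Int.clog 4 (v y)),
      ((4 : ℝ) ^ k) ^ 2 * ((F.filter fun y => Int.clog 4 (v y) = k).card : ℝ) ≤
      16 * ∑ y ∈ F, v y ^ 2 := by
  rw [Finset.mul_sum, ← Finset.sum_fiberwise_of_maps_to
    (g := fun y => Int.clog 4 (v y)) (t := F.image fun y => Int.clog 4 (v y))
    fun y hy => Finset.mem_image_of_mem _ hy]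
  refine Finset.sum_le_sum fun k _ => ?_
  rw [mul_comm, ← nsmul_eq_mul, ← Finset.sum_const]
  refine Finset.sum_le_sum fun y hy => ?_
  obtain ⟨h1, rfl⟩ := Finset.mem_filter.1 hy
  exact sq_clog_le (hv y h1)

/-- Dual form of the `ℓ²` estimate for the model operator. -/
lemma dual_le (hφ : Packets l0 φ K) (hψ : Packets l0 ψ K) (hK : 1 ≤ K)
    (hf : ∀ y ∈ F, 0 < ‖f y‖) (hV : ∀ s ∈ S, s.Valid l0) {w : ℤ → ℝ} (hw : ∀ x ∈ E, 0 < w x) :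
    ∑ x ∈ E, w x * ‖modelOp l0 N (coef φ f F) ψ S x‖ ≤
      2 ^ 147 * K ^ 4 * (∑ y ∈ F, ‖f y‖ ^ 2 + ∑ x ∈ E, w x ^ 2) := by
  set I := F.image fun y => Int.clog 4 ‖f y‖ with hI
  set J := E.image fun x => Int.clog 4 (w x) with hJ
  set Fk : ℤ → Finset ℤ := fun k => F.filter fun y => Int.clog 4 ‖f y‖ = k with hFk
  set El : ℤ → Finset ℤ := fun l => E.filter fun x => Int.clog 4 (w x) = l with hEl
  have hcoef : coef φ f F = fun s => ∑ k ∈ I, coef φ f (Fk k) s := by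
    ext s
    exact (Finset.sum_fiberwise_of_maps_to (fun y hy => Finset.mem_image_of_mem _ hy) _).symm
  have hpt : ∀ x, ‖modelOp l0 N (coef φ f F) ψ S x‖ ≤
      ∑ k ∈ I, ‖modelOp l0 N (coef φ f (Fk k)) ψ S x‖ := by
    intro x
    rw [hcoef, modelOp_sum]
    exact norm_sum_le _ _
  have hlev : ∀ l k, ∑ x ∈ El l, ‖modelOp l0 N (coef φ f (Fk k)) ψ S x‖ ≤
      2 ^ 141 * K ^ 4 * (4 ^ k * (√(√(El l).card * √(Fk k).card) *
        min √(El l).card √(Fk k).card)) := by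
    intro l k
    refine restricted_scaled hφ hψ hK (by positivity) (fun y hy => ?_) hV
    obtain ⟨hy, rfl⟩ := Finset.mem_filter.1 hy
    exact_mod_cast Int.self_le_zpow_clog (b := 4) (by norm_num) ‖f y‖
  have hK0 : (0 : ℝ) ≤ 2 ^ 141 * K ^ 4 := by positivity
  calc _ = ∑ l ∈ J, ∑ x ∈ El l, w x * ‖modelOp l0 N (coef φ f F) ψ S x‖ :=
        (Finset.sum_fiberwise_of_maps_to (fun y hy => Finset.mem_image_of_mem _ hy) _).symm
    _ ≤ ∑ l ∈ J, ∑ x ∈ El l, 4 ^ l * ∑ k ∈ I, ‖modelOp l0 N (coef φ f (Fk k)) ψ S x‖ := by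
        refine Finset.sum_le_sum fun l _ => Finset.sum_le_sum fun x hx => ?_
        obtain ⟨hx, rfl⟩ := Finset.mem_filter.1 hx
        have : w x ≤ (4 : ℝ) ^ Int.clog 4 (w x) := by
          exact_mod_cast Int.self_le_zpow_clog (b := 4) (by norm_num) (w x)
        exact mul_le_mul this (hpt x) (norm_nonneg _) (by positivity)
    _ = ∑ l ∈ J, ∑ k ∈ I, 4 ^ l * ∑ x ∈ El l, ‖modelOp l0 N (coef φ f (Fk k)) ψ S x‖ := by
        refine Finset.sum_congr rfl fun l _ => ?_
        simp only [Finset.mul_sum]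
        exact Finset.sum_comm
    _ ≤ ∑ l ∈ J, ∑ k ∈ I, 2 ^ 141 * K ^ 4 * ((1 / 2) ^ (k - l).natAbs *
          (((4 : ℝ) ^ k) ^ 2 * (Fk k).card + (4 ^ l) ^ 2 * (El l).card)) := by
        refine Finset.sum_le_sum fun l _ => Finset.sum_le_sum fun k _ => ?_
        refine (mul_le_mul_of_nonneg_left (hlev l k) (by positivity)).trans ?_
        have := mul_le_mul_of_nonneg_left
          (level_le (Nat.cast_nonneg (El l).card) (Nat.cast_nonneg (Fk k).card) k l) hK0
        refine le_trans (le_of_eq ?_) this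
        ring
    _ = 2 ^ 141 * K ^ 4 * (∑ k ∈ I, ((4 : ℝ) ^ k) ^ 2 * (Fk k).card *
          ∑ l ∈ J, (1 / 2) ^ (l - k).natAbs +
        ∑ l ∈ J, ((4 : ℝ) ^ l) ^ 2 * (El l).card * ∑ k ∈ I, (1 / 2) ^ (k - l).natAbs) := by
        rw [mul_add]
        simp only [Finset.mul_sum]
        rw [Finset.sum_comm (s := I), ← Finset.sum_add_distrib]
        refine Finset.sum_congr rfl fun l _ => ?_
        rw [← Finset.sum_add_distrib]
        refine Finset.sum_congr rfl fun k _ => ?_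
        rw [show (l - k).natAbs = (k - l).natAbs by omega]
        ring
    _ ≤ 2 ^ 141 * K ^ 4 * (∑ k ∈ I, ((4 : ℝ) ^ k) ^ 2 * (Fk k).card * 4 +
        ∑ l ∈ J, ((4 : ℝ) ^ l) ^ 2 * (El l).card * 4) := by
        refine mul_le_mul_of_nonneg_left (add_le_add ?_ ?_) hK0
        · exact Finset.sum_le_sum fun k _ =>
            mul_le_mul_of_nonneg_left (sum_half_pow_natAbs_le _ _) (by positivity)
        · exact Finset.sum_le_sum fun k _ =>
            mul_le_mul_of_nonneg_left (sum_half_pow_natAbs_le _ _) (by positivity)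
    _ ≤ 2 ^ 141 * K ^ 4 * (16 * (∑ y ∈ F, ‖f y‖ ^ 2) * 4 + 16 * (∑ x ∈ E, w x ^ 2) * 4) := by
        rw [← Finset.sum_mul, ← Finset.sum_mul]
        refine mul_le_mul_of_nonneg_left (add_le_add ?_ ?_) hK0
        · exact mul_le_mul_of_nonneg_right (sum_level_le hf) (by norm_num)
        · exact mul_le_mul_of_nonneg_right (sum_level_le hw) (by norm_num)
    _ = _ := by ring

/-- The `ℓ²` estimate for the model operator. -/
lemma strong_le (hφ : Packets l0 φ K) (hψ : Packets l0 ψ K) (hK : 1 ≤ K)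
    (hV : ∀ s ∈ S, s.Valid l0) :
    ∑ x ∈ E, ‖modelOp l0 N (coef φ f F) ψ S x‖ ^ 2 ≤
      (2 ^ 148 * K ^ 4) ^ 2 * ∑ y ∈ F, ‖f y‖ ^ 2 := by
  set T := modelOp l0 N (coef φ f F) ψ S with hT
  set F' := F.filter fun y => f y ≠ 0 with hF'
  set E' := E.filter fun x => T x ≠ 0 with hE'
  have hsub : coef φ f F = coef φ f F' := by
    ext s
    rw [coef, coef, hF', Finset.sum_filter_of_ne]
    intro y _ hy h0
    exact hy (by rw [h0, zero_mul])
  have hF2 : ∑ y ∈ F, ‖f y‖ ^ 2 = ∑ y ∈ F', ‖f y‖ ^ 2 := by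
    rw [hF', Finset.sum_filter_of_ne]
    intro y _ hy h0
    exact hy (by simp [h0])
  have hE2 : ∑ x ∈ E, ‖T x‖ ^ 2 = ∑ x ∈ E', ‖T x‖ ^ 2 := by
    rw [hE', Finset.sum_filter_of_ne]
    intro y _ hy h0
    exact hy (by simp [h0])
  rw [hF2, hE2]
  obtain ⟨C, hC⟩ : ∃ C, C = 2 ^ 147 * K ^ 4 := ⟨_, rfl⟩
  have hC0 : 0 < C := by rw [hC]; positivity
  have key := dual_le (N := N) (E := E') (F := F') (f := f) (w := fun x => ‖T x‖ / (2 * C))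
    hφ hψ hK (fun y hy => norm_pos_iff.2 (Finset.mem_filter.1 hy).2) hV
    (fun x hx => div_pos (norm_pos_iff.2 (Finset.mem_filter.1 hx).2) (by positivity))
  rw [← hsub, ← hT, ← hC] at key
  have e1 : ∑ x ∈ E', ‖T x‖ / (2 * C) * ‖T x‖ = (∑ x ∈ E', ‖T x‖ ^ 2) / (2 * C) := by
    rw [Finset.sum_div]
    exact Finset.sum_congr rfl fun x _ => by ring
  have e2 : ∑ x ∈ E', (‖T x‖ / (2 * C)) ^ 2 = (∑ x ∈ E', ‖T x‖ ^ 2) / (2 * C) ^ 2 := by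
    rw [Finset.sum_div]
    exact Finset.sum_congr rfl fun x _ => by ring
  rw [e1, e2] at key
  have e3 : (2 ^ 148 * K ^ 4) ^ 2 = 4 * C ^ 2 := by rw [hC]; ring
  rw [e3]
  generalize ∑ x ∈ E', ‖T x‖ ^ 2 = Q at key ⊢
  generalize ∑ y ∈ F', ‖f y‖ ^ 2 = P at key ⊢
  rw [div_le_iff₀ (by positivity)] at key
  have : C * (P + Q / (2 * C) ^ 2) * (2 * C) = 2 * C ^ 2 * P + Q / 2 := by
    field_simp
  linarith

end

/-- The character `t ↦ exp (i π t)` of the real line. -/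
noncomputable def ee (t : ℝ) : ℂ := Complex.exp (Complex.I * (Real.pi * t))

/-- The Fourier transform over the fundamental domain `[-1/2, 3/2]` of `ℝ / 2ℤ`. -/
noncomputable def FT (X : ℝ → ℂ) (u : ℝ) : ℂ := ∫ t in (-1 / 2 : ℝ)..(3 / 2), X t * ee (u * t)

lemma norm_ee (t : ℝ) : ‖ee t‖ = 1 := by
  rw [ee, show Complex.I * (Real.pi * t) = ((Real.pi * t : ℝ) : ℂ) * Complex.I by push_cast; ring]
  exact Complex.norm_exp_ofReal_mul_I _

lemma ee_add (s t : ℝ) : ee (s + t) = ee s * ee t := by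
  rw [ee, ee, ee, ← Complex.exp_add]
  congr 1
  push_cast
  ring

lemma ee_neg (t : ℝ) : ee (-t) = starRingEnd ℂ (ee t) := by
  rw [ee, ee, ← Complex.exp_conj]
  simp

@[fun_prop]
lemma continuous_ee : Continuous ee := by
  unfold ee
  fun_prop

/-- Square integrability on the fundamental domain. -/
abbrev SqInt (X : ℝ → ℂ) : Prop :=
  MemLp X 2 (volume.restrict (Set.Ioc (-1 / 2 : ℝ) (3 / 2)))

lemma SqInt.intervalIntegrable {X : ℝ → ℂ} (h : SqInt X) :
    IntervalIntegrable X volume (-1 / 2) (3 / 2) := by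
  rw [intervalIntegrable_iff_integrableOn_Ioc_of_le (by norm_num)]
  exact h.integrable (by norm_num)

lemma SqInt.mul_bdd {X Y : ℝ → ℂ} (h : SqInt X) (hY : Measurable Y) {C : ℝ}
    (hC : ∀ t, ‖Y t‖ ≤ C) : SqInt fun t => X t * Y t := by
  refine h.of_le_mul (c := C) (h.1.mul hY.aestronglyMeasurable) (Filter.Eventually.of_forall
    fun t => ?_)
  rw [norm_mul, mul_comm]
  exact mul_le_mul_of_nonneg_right (hC t) (norm_nonneg _)

lemma SqInt.mul_ee {X : ℝ → ℂ} (h : SqInt X) (u : ℝ) : SqInt fun t => X t * ee (u * t) :=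
  h.mul_bdd (by fun_prop) (C := 1) fun t => (norm_ee _).le

lemma sqInt_of_continuous {X : ℝ → ℂ} (h : Continuous X) : SqInt X := by
  obtain ⟨C, hC⟩ := (isCompact_Icc (a := (-1 / 2 : ℝ)) (b := 3 / 2)).exists_bound_of_continuousOn
    h.continuousOn
  refine MemLp.of_bound h.aestronglyMeasurable C ?_
  exact (ae_restrict_iff' measurableSet_Ioc).2 (Filter.Eventually.of_forall fun t ht =>
    hC t (Set.Ioc_subset_Icc_self ht))

lemma FT_eq_fourierCoeffOn (X : ℝ → ℂ) (n : ℤ) :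
    FT X n = 2 * fourierCoeffOn (show (-1 / 2 : ℝ) < 3 / 2 by norm_num) X (-n) := by
  rw [fourierCoeffOn_eq_integral, FT, Complex.real_smul, ← mul_assoc]
  norm_num
  congr 1
  ext t
  rw [mul_comm, ee]
  congr 2
  push_cast
  ring

lemma hasSum_sq_FT {X : ℝ → ℂ} (h : SqInt X) :
    HasSum (fun n : ℤ => ‖FT X n‖ ^ 2) (2 * ∫ t in (-1 / 2 : ℝ)..(3 / 2), ‖X t‖ ^ 2) := by
  have h1 := (hasSum_sq_fourierCoeffOn (show (-1 / 2 : ℝ) < 3 / 2 by norm_num) h).mul_left 4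
  rw [← (Equiv.neg ℤ).hasSum_iff] at h1
  have e : 2 * ∫ t in (-1 / 2 : ℝ)..(3 / 2), ‖X t‖ ^ 2 =
      4 * (3 / 2 - -1 / 2 : ℝ)⁻¹ • ∫ t in (-1 / 2 : ℝ)..(3 / 2), ‖X t‖ ^ 2 := by
    rw [smul_eq_mul, ← mul_assoc]
    norm_num
  have e' : (fun n : ℤ => ‖FT X n‖ ^ 2) = (fun n : ℤ => 4 * ‖fourierCoeffOn
      (show (-1 / 2 : ℝ) < 3 / 2 by norm_num) X n‖ ^ 2) ∘ Equiv.neg ℤ := by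
    ext n
    rw [FT_eq_fourierCoeffOn, norm_mul, mul_pow, Function.comp_apply, Equiv.neg_apply]
    norm_num
  rw [e, e']
  exact h1

lemma polarization (z w : ℂ) : starRingEnd ℂ z * w = (1 / 4 : ℂ) *
    (((‖z + w‖ ^ 2 : ℝ) - (‖z + (-1) * w‖ ^ 2 : ℝ) : ℂ) -
      Complex.I * ((‖z + Complex.I * w‖ ^ 2 : ℝ) - (‖z + (-Complex.I) * w‖ ^ 2 : ℝ))) := by
  simp only [← Complex.normSq_eq_norm_sq, Complex.normSq_apply]
  apply Complex.ext <;> simp <;> ring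

lemma FT_add_mul {X Y : ℝ → ℂ} (hX : SqInt X) (hY : SqInt Y) (c : ℂ) (u : ℝ) :
    FT (fun t => X t + c * Y t) u = FT X u + c * FT Y u := by
  rw [FT, FT, FT, ← intervalIntegral.integral_const_mul, ← intervalIntegral.integral_add
    (hX.mul_ee u).intervalIntegrable ((hY.mul_ee u).intervalIntegrable.const_mul c)]
  congr 1
  ext t
  ring

/-- Parseval's identity. -/
lemma hasSum_FT {X Y : ℝ → ℂ} (hX : SqInt X) (hY : SqInt Y) :
    HasSum (fun n : ℤ => starRingEnd ℂ (FT X n) * FT Y n)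
      (2 * ∫ t in (-1 / 2 : ℝ)..(3 / 2), starRingEnd ℂ (X t) * Y t) := by
  have hs : ∀ c : ℂ, SqInt fun t => X t + c * Y t := fun c => hX.add (hY.const_mul c)
  have key : ∀ c : ℂ, HasSum (fun n : ℤ => ((‖FT X n + c * FT Y n‖ ^ 2 : ℝ) : ℂ))
      (2 * ∫ t in (-1 / 2 : ℝ)..(3 / 2), ((‖X t + c * Y t‖ ^ 2 : ℝ) : ℂ)) := by
    intro c
    have h := hasSum_sq_FT (hs c)
    simp only [FT_add_mul hX hY] at h
    have h' := Complex.hasSum_ofReal.2 h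
    rw [intervalIntegral.integral_ofReal]
    push_cast at h' ⊢
    exact h'
  have hint : ∀ c : ℂ, IntervalIntegrable (fun t => ((‖X t + c * Y t‖ ^ 2 : ℝ) : ℂ)) volume
      (-1 / 2) (3 / 2) := by
    intro c
    rw [intervalIntegrable_iff_integrableOn_Ioc_of_le (by norm_num)]
    exact (hs c).integrable_norm_pow (by norm_num) |>.ofReal
  have h1 := key 1
  have hi1 := hint 1
  simp only [one_mul] at h1 hi1
  have h := ((h1.sub (key (-1))).sub (((key Complex.I).sub (key (-Complex.I))).mul_left
    Complex.I)).mul_left (1 / 4 : ℂ)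
  have e : ∀ A B C D : ℂ, 2 * (1 / 4 * (A - B - Complex.I * (C - D))) =
      1 / 4 * (2 * A - 2 * B - Complex.I * (2 * C - 2 * D)) := fun A B C D => by ring
  simp only [polarization]
  rw [intervalIntegral.integral_const_mul, intervalIntegral.integral_sub
    (hi1.sub (hint (-1))) (((hint Complex.I).sub (hint (-Complex.I))).const_mul _),
    intervalIntegral.integral_sub hi1 (hint (-1)), intervalIntegral.integral_const_mul,
    intervalIntegral.integral_sub (hint Complex.I) (hint (-Complex.I)), e]
  exact h

/-- Rapid decay of the Fourier transform of a smooth bump function. -/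
lemma exists_decay {χ : ℝ → ℝ} (hχ : ContDiff ℝ (⊤ : ℕ∞) χ)
    (hs : ∀ t, t ∉ Set.Icc (-1 / 2 : ℝ) (3 / 2) → χ t = 0) :
    ∃ K : ℝ, 1 ≤ K ∧ ∀ u, ‖FT (fun t => (χ t : ℂ)) u‖ ≤ K * ((1 + |u|)⁻¹) ^ 20 := by
  have hc : HasCompactSupport fun t => (χ t : ℂ) :=
    HasCompactSupport.intro (isCompact_Icc (a := (-1 / 2 : ℝ)) (b := 3 / 2)) fun t ht => by
      rw [hs t ht, Complex.ofReal_zero]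
  have hd : ContDiff ℝ (⊤ : ℕ∞) fun t => (χ t : ℂ) := Complex.ofRealCLM.contDiff.comp hχ
  obtain ⟨f, hf⟩ : ∃ f : SchwartzMap ℝ ℂ, f = hc.toSchwartzMap hd := ⟨_, rfl⟩
  obtain ⟨g, hg⟩ : ∃ g : SchwartzMap ℝ ℂ, g = FourierTransform.fourier f := ⟨_, rfl⟩
  have hFT : ∀ u, FT (fun t => (χ t : ℂ)) u = g (-(u / 2)) := by
    intro u
    rw [hg, SchwartzMap.fourier_coe, Real.fourier_real_eq_integral_exp_smul, FT,
      intervalIntegral.integral_of_le (by norm_num), ← integral_Icc_eq_integral_Ioc,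
      setIntegral_eq_integral_of_forall_compl_eq_zero]
    · congr 1
      ext t
      rw [hf, HasCompactSupport.toSchwartzMap_toFun, smul_eq_mul, mul_comm, ee]
      congr 2
      push_cast
      ring
    · intro t ht
      rw [hs t ht, Complex.ofReal_zero, zero_mul]
  obtain ⟨C, hC⟩ : ∃ C : ℝ, ∀ v, (1 + ‖v‖) ^ 20 * ‖g v‖ ≤ C := by
    refine ⟨_, fun v => le_trans (le_of_eq ?_)
      (SchwartzMap.one_add_le_sup_seminorm_apply (𝕜 := ℝ) (m := (20, 0)) (k := 20) (n := 0)
        le_rfl le_rfl g v)⟩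
    rw [norm_iteratedFDeriv_zero]
  refine ⟨max 1 (2 ^ 20 * C), le_max_left _ _, fun u => ?_⟩
  rw [hFT, inv_pow, ← div_eq_mul_inv, le_div_iff₀ (by positivity)]
  refine le_trans ?_ (le_max_right _ _)
  have h1 := hC (-(u / 2))
  rw [Real.norm_eq_abs, abs_neg, abs_div, abs_two] at h1
  have h2 : (1 + |u|) ^ 20 ≤ 2 ^ 20 * (1 + |u| / 2) ^ 20 := by
    rw [← mul_pow]
    exact pow_le_pow_left₀ (by positivity) (by linarith [abs_nonneg u]) _
  calc _ ≤ ‖g (-(u / 2))‖ * (2 ^ 20 * (1 + |u| / 2) ^ 20) := by gcongr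
    _ = 2 ^ 20 * ((1 + |u| / 2) ^ 20 * ‖g (-(u / 2))‖) := by ring
    _ ≤ _ := by gcongr

lemma FT_eq_integral {X : ℝ → ℂ} (hX : ∀ t, t ∉ Set.Ioo (-1 / 2 : ℝ) (3 / 2) → X t = 0) (u : ℝ) :
    FT X u = ∫ t, X t * ee (u * t) := by
  refine intervalIntegral.integral_eq_integral_of_support_subset fun t ht => ?_
  by_contra h
  refine ht ?_
  simp only
  rw [hX t fun h' => h (Set.Ioo_subset_Ioc_self h'), zero_mul]

lemma affine_zero {χ : ℝ → ℝ} (hs : ∀ t, t ∉ Set.Ioo (-1 / 2 : ℝ) (3 / 2) → χ t = 0)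
    {l b : ℝ} (hl : 1 ≤ l) (hb : 0 ≤ b) (hbl : b + 1 ≤ l) (t : ℝ)
    (ht : t ∉ Set.Ioo (-1 / 2 : ℝ) (3 / 2)) : χ (l * t - b) = 0 := by
  refine hs _ fun h => ht ⟨?_, ?_⟩
  · by_contra h1
    push Not at h1
    nlinarith [h.1]
  · by_contra h1
    push Not at h1
    nlinarith [h.2]

lemma FT_affine {χ : ℝ → ℝ} (hs : ∀ t, t ∉ Set.Ioo (-1 / 2 : ℝ) (3 / 2) → χ t = 0)
    {l b : ℝ} (hl : 1 ≤ l) (hb : 0 ≤ b) (hbl : b + 1 ≤ l) (u : ℝ) :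
    FT (fun t => (χ (l * t - b) : ℂ)) u
      = (l : ℂ)⁻¹ * ee (b * (u / l)) * FT (fun t => (χ t : ℂ)) (u / l) := by
  have hl0 : l ≠ 0 := by positivity
  rw [FT_eq_integral (fun t ht => by simp [affine_zero hs hl hb hbl t ht]),
    FT_eq_integral (fun t ht => by simp [hs t ht])]
  set G : ℝ → ℂ := fun s => (χ s : ℂ) * ee (u / l * s) with hG
  have h1 : (fun t => (χ (l * t - b) : ℂ) * ee (u * t))
      = fun t => ee (b * (u / l)) * G (l * t - b) := by
    funext t
    simp only [hG]
    rw [mul_left_comm, ← ee_add]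
    congr 2
    field_simp
    ring
  rw [h1, integral_const_mul, Measure.integral_comp_mul_left (fun y => G (y - b)),
    integral_sub_right_eq_self G b, abs_of_pos (by positivity)]
  rw [Complex.real_smul]
  push_cast
  ring

/-- The Fourier side of a wave packet. -/
noncomputable def tf (l0 : ℕ) (χ : ℝ → ℝ) (s : Tile) (t : ℝ) : ℂ :=
  √(len l0 s.i) * χ (len l0 s.i * t - s.b) * ee (-(s.a * len l0 s.i) * t)

/-- Wave packets built from a bump function. -/
noncomputable def packet (l0 : ℕ) (χ : ℝ → ℝ) (s : Tile) (x : ℤ) : ℂ :=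
  (√(len l0 s.i) : ℂ)⁻¹ * ee (s.b * (x / len l0 s.i - s.a)) *
    FT (fun t => (χ t : ℂ)) (x / len l0 s.i - s.a)

section
variable {l0 : ℕ} [NeZero l0] {χ : ℝ → ℝ}

lemma valid_bounds {s : Tile} (hv : s.Valid l0) :
    (0 : ℝ) ≤ s.b ∧ (s.b : ℝ) + 1 ≤ len l0 s.i := by
  refine ⟨by exact_mod_cast hv.1, ?_⟩
  rw [← sc_cast]
  exact_mod_cast hv.2

lemma packet_eq (hs : ∀ t, t ∉ Set.Ioo (-1 / 2 : ℝ) (3 / 2) → χ t = 0) {s : Tile}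
    (hv : s.Valid l0) (x : ℤ) : packet l0 χ s x = FT (tf l0 χ s) x := by
  obtain ⟨h0, h1⟩ := valid_bounds hv
  have hl := one_le_len (l0 := l0) s.i
  have hl0 : len l0 s.i ≠ 0 := by positivity
  have e : FT (tf l0 χ s) x = √(len l0 s.i) *
      FT (fun t => (χ (len l0 s.i * t - s.b) : ℂ)) (x - s.a * len l0 s.i) := by
    unfold FT
    rw [← intervalIntegral.integral_const_mul]
    congr 1
    funext t
    rw [tf, mul_assoc, mul_assoc, ← ee_add]
    simp only
    congr 4
    ring
  rw [e, FT_affine hs hl h0 h1, packet]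
  have e2 : ((x : ℝ) - s.a * len l0 s.i) / len l0 s.i = x / len l0 s.i - s.a := by
    field_simp
  rw [e2, ← mul_assoc, ← mul_assoc]
  congr 2
  have h3 : (√(len l0 s.i) : ℂ) * √(len l0 s.i) = len l0 s.i := by
    exact_mod_cast Real.mul_self_sqrt (by positivity)
  have h4 : (√(len l0 s.i) : ℂ) ≠ 0 := by
    exact_mod_cast (Real.sqrt_pos.2 (by positivity : 0 < len l0 s.i)).ne'
  rw [← h3]
  field_simp

lemma norm_packet_le {K : ℝ}
    (hd : ∀ u, ‖FT (fun t => (χ t : ℂ)) u‖ ≤ K * ((1 + |u|)⁻¹) ^ 20) (s : Tile) (x : ℤ) :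
    ‖packet l0 χ s x‖ ≤ K / √(len l0 s.i) * wt (len l0 s.i) s.a x ^ 20 := by
  rw [packet, norm_mul, norm_mul, norm_ee, mul_one, norm_inv, Complex.norm_real,
    Real.norm_of_nonneg (Real.sqrt_nonneg _), div_eq_inv_mul K, mul_assoc]
  exact mul_le_mul_of_nonneg_left (hd _) (by positivity)

@[fun_prop]
lemma continuous_tf (hχ : Continuous χ) (s : Tile) : Continuous (tf l0 χ s) := by
  unfold tf
  fun_prop

lemma gram_packet (hχ : Continuous χ) (hs : ∀ t, t ∉ Set.Ioo (-1 / 2 : ℝ) (3 / 2) → χ t = 0)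
    {s t : Tile} (hv : s.Valid l0) (hv' : t.Valid l0) : gram (packet l0 χ) s t
      = 2 * ∫ u in (-1 / 2 : ℝ)..(3 / 2), starRingEnd ℂ (tf l0 χ s u) * tf l0 χ t u := by
  rw [gram, ← (hasSum_FT (sqInt_of_continuous (continuous_tf hχ s))
    (sqInt_of_continuous (continuous_tf hχ t))).tsum_eq]
  refine tsum_congr fun x => ?_
  rw [packet_eq hs hv, packet_eq hs hv']

lemma gram_packet_eq_zero (hχ : Continuous χ)
    (hs : ∀ t, t ∉ Set.Ioo (-1 / 2 : ℝ) (3 / 2) → χ t = 0)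
    {s t : Tile} (hv : s.Valid l0) (hv' : t.Valid l0)
    (h : ∀ u, χ (len l0 s.i * u - s.b) ≠ 0 → χ (len l0 t.i * u - t.b) ≠ 0 → False) :
    gram (packet l0 χ) s t = 0 := by
  rw [gram_packet hχ hs hv hv']
  have : ∀ u, starRingEnd ℂ (tf l0 χ s u) * tf l0 χ t u = 0 := by
    intro u
    by_cases h1 : χ (len l0 s.i * u - s.b) = 0
    · simp [tf, h1]
    by_cases h2 : χ (len l0 t.i * u - t.b) = 0
    · simp [tf, h2]
    exact (h u h1 h2).elim
  simp [this]

/-- A smooth cutoff equal to one on `[0, 1]` and supported in `(-1/2, 3/2)`. -/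
noncomputable def plateau (t : ℝ) : ℝ :=
  Real.smoothTransition (2 * t + 1) * Real.smoothTransition (3 - 2 * t)

lemma contDiff_plateau : ContDiff ℝ (⊤ : ℕ∞) plateau := by
  unfold plateau
  have h1 : ContDiff ℝ (⊤ : ℕ∞) Real.smoothTransition := Real.smoothTransition.contDiff
  exact (h1.comp (by fun_prop)).mul (h1.comp (by fun_prop))

lemma plateau_eq_one {t : ℝ} (h0 : 0 ≤ t) (h1 : t ≤ 1) : plateau t = 1 := by
  rw [plateau, Real.smoothTransition.one_of_one_le (by linarith),
    Real.smoothTransition.one_of_one_le (by linarith), one_mul]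

lemma plateau_eq_zero (t : ℝ) (h : t ∉ Set.Ioo (-1 / 2 : ℝ) (3 / 2)) : plateau t = 0 := by
  rw [Set.mem_Ioo, not_and_or, not_lt, not_lt] at h
  rcases h with h | h
  · rw [plateau, Real.smoothTransition.zero_of_nonpos (by linarith), zero_mul]
  · rw [plateau, mul_comm, Real.smoothTransition.zero_of_nonpos (by linarith), zero_mul]

/-- Convolution with the kernel of a real Fourier multiplier. -/
lemma hasSum_convolution {W X : ℝ → ℂ} (hW : Continuous W) (hWr : ∀ t, starRingEnd ℂ (W t) = W t)
    (hX : SqInt X) (x : ℤ) :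
    HasSum (fun z : ℤ => FT X z * (1 / 2 * FT W ((x : ℝ) - z))) (FT (fun t => W t * X t) x) := by
  have h := (hasSum_FT (X := fun t => W t * ee (-x * t)) (Y := X)
    (sqInt_of_continuous (by fun_prop)) hX).mul_left (1 / 2 : ℂ)
  have e1 : (fun z : ℤ => FT X z * (1 / 2 * FT W ((x : ℝ) - z)))
      = fun z : ℤ => (1 / 2 : ℂ) *
        (starRingEnd ℂ (FT (fun t => W t * ee (-x * t)) z) * FT X z) := by
    funext z
    have : starRingEnd ℂ (FT (fun t => W t * ee (-x * t)) z) = FT W ((x : ℝ) - z) := by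
      unfold FT
      rw [intervalIntegral.integral_of_le (by norm_num), ← integral_conj,
        intervalIntegral.integral_of_le (by norm_num)]
      congr 1
      funext t
      rw [map_mul, map_mul, hWr, ← ee_neg, ← ee_neg, mul_assoc, ← ee_add]
      congr 2
      ring
    rw [this]
    ring
  have e2 : FT (fun t => W t * X t) x = 1 / 2 *
      (2 * ∫ t in (-1 / 2 : ℝ)..(3 / 2), starRingEnd ℂ (W t * ee (-x * t)) * X t) := by
    rw [← mul_assoc, show (1 / 2 : ℂ) * 2 = 1 by norm_num, one_mul]
    unfold FT
    congr 1
    funext t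
    rw [map_mul, hWr, ← ee_neg, neg_mul, neg_neg]
    ring
  rw [e1, e2]
  exact h

lemma floor_eq_of_bump (h38 : ∀ t, t ∉ Set.Ico (3 / 8 : ℝ) (13 / 16) → χ t = 0) {i : ℕ} {b : ℤ}
    {u : ℝ} (h : χ (len l0 i * u - b) ≠ 0) : ⌊len l0 i * u⌋ = b := by
  have := not_imp_comm.1 (h38 _) h
  rw [Int.floor_eq_iff]
  constructor <;> linarith [this.1, this.2]

lemma packets_repro (hχ : Continuous χ) (h38 : ∀ t, t ∉ Set.Ico (3 / 8 : ℝ) (13 / 16) → χ t = 0)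
    {K : ℝ} (hd : ∀ u, ‖FT (fun t => (plateau t : ℂ)) u‖ ≤ K * ((1 + |u|)⁻¹) ^ 20)
    (k : ℕ) {ξ : ℝ} (h0 : 0 ≤ ξ) (h1 : ξ < 1) : ∃ L : ℤ → ℂ,
    (∀ z, ‖L z‖ ≤ K * ((len l0 k)⁻¹ * ((1 + |(z : ℝ)| / len l0 k)⁻¹) ^ 2)) ∧
    ∀ s : Tile, s.Valid l0 → ⌊len l0 s.i * ξ⌋ = s.b →
      (k ≤ s.i → ∀ x, HasSum (fun z => packet l0 χ s z * L (x - z)) (packet l0 χ s x)) ∧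
      (s.i < k → ⌊len l0 (s.i + 1) * ξ⌋ = 8 * s.b + 7 →
        ∀ x, HasSum (fun z => packet l0 χ s z * L (x - z)) 0) := by
  have hs : ∀ t, t ∉ Set.Ioo (-1 / 2 : ℝ) (3 / 2) → χ t = 0 := fun t ht =>
    h38 t fun h => ht ⟨by linarith [h.1], by linarith [h.2]⟩
  have hl := one_le_len (l0 := l0) k
  have hl0 : 0 < len l0 k := by positivity
  set b : ℤ := ⌊len l0 k * ξ⌋ with hb
  have hb0 : (0 : ℝ) ≤ b := by
    exact_mod_cast Int.floor_nonneg.2 (by positivity)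
  have hb1 : (b : ℝ) + 1 ≤ len l0 k := by
    rw [← sc_cast]
    have : b < sc l0 k := by
      rw [hb, Int.floor_lt, sc_cast]
      nlinarith
    exact_mod_cast this
  set W : ℝ → ℂ := fun t => (plateau (len l0 k * t - b) : ℂ) with hW
  have hWc : Continuous W := by
    have := contDiff_plateau.continuous
    fun_prop
  refine ⟨fun z => 1 / 2 * FT W z, fun z => ?_, fun s hv hsξ => ?_⟩
  · simp only [hW]
    rw [FT_affine plateau_eq_zero hl hb0 hb1, norm_mul, norm_mul, norm_mul, norm_ee, mul_one,
      norm_inv, Complex.norm_real, Real.norm_of_nonneg hl0.le]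
    have h2 := hd ((z : ℝ) / len l0 k)
    rw [abs_div, abs_of_pos hl0] at h2
    have h3 : ((1 + |(z : ℝ)| / len l0 k)⁻¹) ^ 20 ≤ ((1 + |(z : ℝ)| / len l0 k)⁻¹) ^ 2 :=
      pow_le_pow_of_le_one (by positivity) (inv_le_one_of_one_le₀ (by
        have : 0 ≤ |(z : ℝ)| / len l0 k := by positivity
        linarith)) (by norm_num)
    have hK : 0 ≤ K := by
      have := (norm_nonneg _).trans (hd 0)
      simpa using this
    have h4 := h2.trans (mul_le_mul_of_nonneg_left h3 hK)
    have h5 : ‖(1 / 2 : ℂ)‖ = 1 / 2 := by norm_num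
    rw [h5]
    have h6 : 0 ≤ (len l0 k)⁻¹ * ‖FT (fun t => (plateau t : ℂ)) ((z : ℝ) / len l0 k)‖ := by positivity
    calc 1 / 2 * ((len l0 k)⁻¹ * ‖FT (fun t => (plateau t : ℂ)) ((z : ℝ) / len l0 k)‖)
        ≤ (len l0 k)⁻¹ * ‖FT (fun t => (plateau t : ℂ)) ((z : ℝ) / len l0 k)‖ := by linarith
      _ ≤ (len l0 k)⁻¹ * _ := mul_le_mul_of_nonneg_left h4 (by positivity)
      _ = _ := by ring
  have key : ∀ x : ℤ, HasSum (fun z : ℤ => packet l0 χ s z * (1 / 2 * FT W ((x - z : ℤ) : ℝ)))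
      (FT (fun t => W t * tf l0 χ s t) x) := by
    intro x
    have h := hasSum_convolution hWc (fun t => by simp [hW]) 
      (sqInt_of_continuous (continuous_tf (l0 := l0) hχ s)) x
    have e : (fun z : ℤ => packet l0 χ s z * (1 / 2 * FT W ((x - z : ℤ) : ℝ)))
        = fun z : ℤ => FT (tf l0 χ s) z * (1 / 2 * FT W ((x : ℝ) - z)) := by
      funext z
      rw [packet_eq hs hv, Int.cast_sub]
    rw [e]
    exact h
  refine ⟨fun hk x => ?_, fun hk hc x => ?_⟩
  · have e : (fun t => W t * tf l0 χ s t) = tf l0 χ s := by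
      funext t
      by_cases h2 : χ (len l0 s.i * t - s.b) = 0
      · simp [tf, h2]
      have h3 := floor_eq_of_bump h38 h2
      have h4 : ⌊len l0 k * t⌋ = b := by
        rw [floor_len_le hk, h3, ← hsξ, hb, ← floor_len_le hk]
      rw [Int.floor_eq_iff] at h4
      rw [hW]
      simp only
      rw [plateau_eq_one (by linarith [h4.1]) (by linarith [h4.2])]
      simp
    have := key x
    rw [e, ← packet_eq hs hv] at this
    exact this
  · have e : (fun t => W t * tf l0 χ s t) = fun _ => 0 := by
      funext t
      by_cases h2 : χ (len l0 s.i * t - s.b) = 0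
      · simp [tf, h2]
      by_cases h3 : plateau (len l0 k * t - b) = 0
      · simp [hW, h3]
      exfalso
      have h4 := (not_imp_comm.1 (h38 _) h2).2
      have h5 := (not_imp_comm.1 (plateau_eq_zero _) h3).1
      obtain ⟨d, rfl⟩ : ∃ d, k = s.i + 1 + d := ⟨k - (s.i + 1), by omega⟩
      have h6 : b / 8 ^ d = 8 * s.b + 7 := by
        rw [← hc, hb, ← floor_len_add]
      have h7 : (8 * s.b + 7) * 8 ^ d ≤ b := by
        rw [← h6]
        exact Int.ediv_mul_le _ (by positivity)
      have h8 : ((8 * s.b + 7 : ℝ)) * 8 ^ d ≤ b := by exact_mod_cast h7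
      rw [len_add, len_succ] at h5
      have h9 : (1 : ℝ) ≤ 8 ^ d := one_le_pow₀ (by norm_num)
      nlinarith
    have := key x
    rw [e] at this
    simpa [FT] using this

lemma packets_packet {K : ℝ} (hχ : Continuous χ)
    (h38 : ∀ t, t ∉ Set.Ico (3 / 8 : ℝ) (13 / 16) → χ t = 0)
    (hd : ∀ u, ‖FT (fun t => (χ t : ℂ)) u‖ ≤ K * ((1 + |u|)⁻¹) ^ 20)
    (hd' : ∀ u, ‖FT (fun t => (plateau t : ℂ)) u‖ ≤ K * ((1 + |u|)⁻¹) ^ 20) :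
    Packets l0 (packet l0 χ) K := by
  have hs : ∀ t, t ∉ Set.Ioo (-1 / 2 : ℝ) (3 / 2) → χ t = 0 := fun t ht =>
    h38 t fun h => ht ⟨by linarith [h.1], by linarith [h.2]⟩
  refine ⟨norm_packet_le hd, fun s t hs' ht' hi hb => ?_, fun s t hs' ht' hi hb => ?_,
    fun k ξ h0 h1 => packets_repro hχ h38 hd' k h0 h1⟩
  · refine gram_packet_eq_zero hχ hs hs' ht' fun u h1 h2 => hb ?_
    rw [← floor_eq_of_bump h38 h1, ← floor_eq_of_bump h38 h2, hi]
  · refine gram_packet_eq_zero hχ hs hs' ht' fun u h1 h2 => ?_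
    have e1 := floor_eq_of_bump h38 h1
    have e2 := floor_eq_of_bump h38 h2
    rcases hb with hb | hb
    · exact hb (by rw [← e1, ← e2, ← floor_len_le hi.le])
    · have e3 : ⌊len l0 (t.i + 1) * u⌋ = 8 * t.b + 7 := by
        rw [floor_len_le (show t.i + 1 ≤ s.i from hi), e1, ← hb]
        congr 2
      rw [Int.floor_eq_iff, len_succ] at e3
      have h4 := (not_imp_comm.1 (h38 _) h2).2
      push_cast at e3
      linarith [e3.1]

end

/-- A bump function gives wave packets at every base scale, with a uniform constant. -/
theorem exists_packets {χ ρ : ℝ → ℝ} (hχ : ContDiff ℝ (⊤ : ℕ∞) χ) (hρ : ContDiff ℝ (⊤ : ℕ∞) ρ)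
    (h38 : ∀ t, t ∉ Set.Ico (3 / 8 : ℝ) (13 / 16) → χ t = 0)
    (h38' : ∀ t, t ∉ Set.Ico (3 / 8 : ℝ) (13 / 16) → ρ t = 0) :
    ∃ K, 1 ≤ K ∧ ∀ l0 : ℕ, l0 ≠ 0 →
      Packets l0 (packet l0 χ) K ∧ Packets l0 (packet l0 ρ) K := by
  have hz : ∀ {t : ℝ}, t ∉ Set.Icc (-1 / 2 : ℝ) (3 / 2) → t ∉ Set.Ico (3 / 8 : ℝ) (13 / 16) :=
    fun {t} ht h => ht ⟨by linarith [h.1], by linarith [h.2]⟩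
  obtain ⟨K1, hK1, h1⟩ := exists_decay hχ fun t ht => h38 t (hz ht)
  obtain ⟨K2, hK2, h2⟩ := exists_decay hρ fun t ht => h38' t (hz ht)
  obtain ⟨K3, hK3, h3⟩ := exists_decay contDiff_plateau fun t ht =>
    plateau_eq_zero t fun h => ht (Set.Ioo_subset_Icc_self h)
  have hm : ∀ {K : ℝ} {z : ℂ} {u : ℝ}, K ≤ K1 + K2 + K3 → ‖z‖ ≤ K * ((1 + |u|)⁻¹) ^ 20 →
      ‖z‖ ≤ (K1 + K2 + K3) * ((1 + |u|)⁻¹) ^ 20 := fun hK hz =>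
    hz.trans (mul_le_mul_of_nonneg_right hK (by positivity))
  refine ⟨K1 + K2 + K3, by linarith, fun l0 h0 => ?_⟩
  have : NeZero l0 := ⟨h0⟩
  exact ⟨packets_packet hχ.continuous h38 (fun u => hm (by linarith) (h1 u))
      fun u => hm (by linarith) (h3 u),
    packets_packet hρ.continuous h38' (fun u => hm (by linarith) (h2 u))
      fun u => hm (by linarith) (h3 u)⟩

/-- The multiplier of the active tile of length `l` at frequency `N`. -/
noncomputable def actMul (ρ : ℝ → ℝ) (l N t : ℝ) : ℝ :=
  if 7 / 8 ≤ Int.fract (l * N) then ρ (l * t - ⌊l * N⌋) else 0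

section
variable {l0 : ℕ} [NeZero l0] {χ ρ : ℝ → ℝ}

lemma FT_mul_ee (X : ℝ → ℂ) (u v : ℝ) : FT (fun t => X t * ee (v * t)) u = FT X (u + v) := by
  unfold FT
  congr 1
  funext t
  rw [mul_assoc, ← ee_add]
  congr 2
  ring

lemma hasSum_packet (hχ : Continuous χ) (hρ : Continuous ρ) (hχρ : ∀ t, χ t * ρ t = ρ t)
    (hs : ∀ t, t ∉ Set.Ioo (-1 / 2 : ℝ) (3 / 2) → ρ t = 0) {i : ℕ} {b : ℤ} (h0 : 0 ≤ b)
    (h1 : b < sc l0 i) (x y : ℤ) :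
    HasSum (fun a : ℤ => starRingEnd ℂ (packet l0 χ ⟨i, a, b⟩ y) * packet l0 ρ ⟨i, a, b⟩ x)
      (2 * FT (fun t => (ρ (len l0 i * t - b) : ℂ)) (x - y)) := by
  obtain ⟨hb0, hb1⟩ := valid_bounds (l0 := l0) (s := ⟨i, 0, b⟩) ⟨h0, h1⟩
  simp only at hb0 hb1
  have hl := one_le_len (l0 := l0) i
  have hl0 : 0 < len l0 i := by positivity
  rw [FT_affine hs hl hb0 hb1]
  have h := ((Equiv.neg ℤ).hasSum_iff.2 (hasSum_FT
    (X := fun t => (χ t : ℂ) * ee (y / len l0 i * t)) (Y := fun t => (ρ t : ℂ) * ee (x / len l0 i * t))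
    (sqInt_of_continuous (by fun_prop)) (sqInt_of_continuous (by fun_prop)))).mul_left
    ((len l0 i : ℂ)⁻¹ * ee (b * ((x - y) / len l0 i)))
  have e1 : (2 : ℂ) * ((len l0 i : ℂ)⁻¹ * ee (b * ((x - y) / len l0 i)) *
      FT (fun t => (ρ t : ℂ)) (((x : ℝ) - y) / len l0 i)) =
      (len l0 i : ℂ)⁻¹ * ee (b * ((x - y) / len l0 i)) * (2 * ∫ t in (-1 / 2 : ℝ)..(3 / 2),
        starRingEnd ℂ ((χ t : ℂ) * ee (y / len l0 i * t)) * ((ρ t : ℂ) * ee (x / len l0 i * t))) := by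
    rw [mul_left_comm]
    congr 2
    unfold FT
    congr 1
    funext t
    rw [map_mul, Complex.conj_ofReal, ← ee_neg, mul_mul_mul_comm, ← ee_add, ← Complex.ofReal_mul,
      hχρ]
    congr 2
    ring
  have e2 : (fun a : ℤ => starRingEnd ℂ (packet l0 χ ⟨i, a, b⟩ y) * packet l0 ρ ⟨i, a, b⟩ x)
      = fun a : ℤ => (len l0 i : ℂ)⁻¹ * ee (b * ((x - y) / len l0 i)) *
        ((fun n : ℤ => starRingEnd ℂ (FT (fun t => (χ t : ℂ) * ee (y / len l0 i * t)) n) *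
          FT (fun t => (ρ t : ℂ) * ee (x / len l0 i * t)) n) ∘ (Equiv.neg ℤ)) a := by
    funext a
    have h3 : (√(len l0 i) : ℂ)⁻¹ * (√(len l0 i) : ℂ)⁻¹ = (len l0 i : ℂ)⁻¹ := by
      rw [← mul_inv]
      congr 1
      exact_mod_cast Real.mul_self_sqrt (by positivity)
    have h4 : ee (-(b * (y / len l0 i - a))) * ee (b * (x / len l0 i - a)) =
        ee (b * ((x - y) / len l0 i)) := by
      rw [← ee_add]
      congr 1
      ring
    simp only [Function.comp, Equiv.neg_apply, packet]
    rw [FT_mul_ee, FT_mul_ee, map_mul, map_mul, ← ee_neg, ← h3, ← h4, map_inv₀,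
      Complex.conj_ofReal, Int.cast_neg, neg_add_eq_sub, neg_add_eq_sub]
    ring
  rw [e1, e2]
  exact h

/-- The tiles of the first `M` scales with positions in `A`. -/
noncomputable def tiles (l0 M : ℕ) (A : Finset ℤ) : Finset Tile :=
  ((Finset.range M).sigma fun i => Finset.Ico 0 (sc l0 i) ×ˢ A).map
    ⟨fun p => ⟨p.1, p.2.2, p.2.1⟩, fun p q h => by
      rcases p with ⟨i, b, a⟩
      rcases q with ⟨i', b', a'⟩
      simp only [Tile.mk.injEq] at h
      obtain ⟨rfl, rfl, rfl⟩ := h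
      rfl⟩

lemma tiles_valid {M : ℕ} {A : Finset ℤ} : ∀ s ∈ tiles l0 M A, s.Valid l0 := by
  intro s hs
  rw [tiles, Finset.mem_map] at hs
  obtain ⟨p, hp, rfl⟩ := hs
  rw [Finset.mem_sigma, Finset.mem_product, Finset.mem_Ico] at hp
  exact hp.2.1

lemma modelOp_tiles (N : ℤ → ℝ) (c : Tile → ℂ) (ψ : Tile → ℤ → ℂ) (M : ℕ) (A : Finset ℤ) (x : ℤ) :
    modelOp l0 N c ψ (tiles l0 M A) x = ∑ i ∈ Finset.range M, ∑ b ∈ Finset.Ico 0 (sc l0 i),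
      if ⌊len l0 (i + 1) * N x⌋ = 8 * b + 7 then ∑ a ∈ A, c ⟨i, a, b⟩ * ψ ⟨i, a, b⟩ x else 0 := by
  rw [modelOp, Finset.sum_filter, tiles, Finset.sum_map, Finset.sum_sigma]
  refine Finset.sum_congr rfl fun i _ => ?_
  rw [Finset.sum_product]
  refine Finset.sum_congr rfl fun b _ => ?_
  by_cases h : ⌊len l0 (i + 1) * N x⌋ = 8 * b + 7
  · rw [if_pos h]
    refine Finset.sum_congr rfl fun a _ => ?_
    exact if_pos h
  · rw [if_neg h]
    refine Finset.sum_eq_zero fun a _ => ?_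
    exact if_neg h

lemma floor_eight_iff (v : ℝ) (b : ℤ) : ⌊8 * v⌋ = 8 * b + 7 ↔ ⌊v⌋ = b ∧ 7 / 8 ≤ Int.fract v := by
  rw [Int.floor_eq_iff]
  push_cast
  constructor
  · rintro ⟨h1, h2⟩
    have h3 : ⌊v⌋ = b := by
      rw [Int.floor_eq_iff]
      constructor <;> linarith
    refine ⟨h3, ?_⟩
    rw [Int.fract, h3]
    linarith
  · rintro ⟨rfl, h⟩
    rw [Int.fract] at h
    have := Int.lt_floor_add_one v
    constructor <;> linarith

lemma sum_active {N : ℝ} (h0 : 0 ≤ N) (h1 : N < 1) (i : ℕ) (u : ℝ) :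
    (∑ b ∈ Finset.Ico 0 (sc l0 i), if ⌊len l0 (i + 1) * N⌋ = 8 * b + 7 then
      FT (fun t => (ρ (len l0 i * t - b) : ℂ)) u else 0)
      = FT (fun t => (actMul ρ (len l0 i) N t : ℂ)) u := by
  have hl := len_pos (l0 := l0) i
  have hm : ⌊len l0 i * N⌋ ∈ Finset.Ico 0 (sc l0 i) := by
    rw [Finset.mem_Ico]
    refine ⟨Int.floor_nonneg.2 (by positivity), ?_⟩
    rw [Int.floor_lt, sc_cast]
    nlinarith
  have h2 : ∀ b : ℤ, ⌊len l0 (i + 1) * N⌋ = 8 * b + 7 ↔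
      ⌊len l0 i * N⌋ = b ∧ 7 / 8 ≤ Int.fract (len l0 i * N) := by
    intro b
    rw [len_succ, mul_assoc, floor_eight_iff]
  simp only [h2]
  rw [Finset.sum_eq_single_of_mem _ hm fun b _ hb => if_neg fun h => hb h.1.symm]
  unfold actMul
  by_cases h : 7 / 8 ≤ Int.fract (len l0 i * N)
  · simp [h]
  · simp [h, FT]

lemma sum_model_le {K : ℝ} (hφ : Packets l0 (packet l0 χ) K) (hψ : Packets l0 (packet l0 ρ) K)
    (hK : 1 ≤ K) (hχ : Continuous χ) (hρ : Continuous ρ) (hχρ : ∀ t, χ t * ρ t = ρ t)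
    (hs : ∀ t, t ∉ Set.Ioo (-1 / 2 : ℝ) (3 / 2) → ρ t = 0) (E F : Finset ℤ) (N : ℤ → ℝ)
    (h0 : ∀ x, 0 ≤ N x) (h1 : ∀ x, N x < 1) (f : ℤ → ℂ) (M : ℕ) :
    ∑ x ∈ E, ‖∑ y ∈ F, f y * (2 * ∑ i ∈ Finset.range M,
      FT (fun t => (actMul ρ (len l0 i) (N x) t : ℂ)) (x - y))‖ ^ 2
      ≤ (2 ^ 148 * K ^ 4) ^ 2 * ∑ y ∈ F, ‖f y‖ ^ 2 := by
  have key : ∀ x : ℤ, Filter.Tendsto (fun A : Finset ℤ =>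
      modelOp l0 N (coef (packet l0 χ) f F) (packet l0 ρ) (tiles l0 M A) x) Filter.atTop
      (nhds (∑ y ∈ F, f y * (2 * ∑ i ∈ Finset.range M,
        FT (fun t => (actMul ρ (len l0 i) (N x) t : ℂ)) (x - y)))) := by
    intro x
    have e : ∑ y ∈ F, f y * (2 * ∑ i ∈ Finset.range M,
        FT (fun t => (actMul ρ (len l0 i) (N x) t : ℂ)) (x - y)) =
        ∑ i ∈ Finset.range M, ∑ b ∈ Finset.Ico 0 (sc l0 i),
        if ⌊len l0 (i + 1) * N x⌋ = 8 * b + 7 then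
          ∑ y ∈ F, f y * (2 * FT (fun t => (ρ (len l0 i * t - b) : ℂ)) (x - y)) else 0 := by
      simp only [← sum_active (h0 x) (h1 x), Finset.mul_sum]
      rw [Finset.sum_comm]
      refine Finset.sum_congr rfl fun i _ => ?_
      rw [Finset.sum_comm]
      refine Finset.sum_congr rfl fun b _ => ?_
      split_ifs
      · rfl
      · simp
    rw [e]
    simp only [modelOp_tiles]
    refine tendsto_finsetSum _ fun i _ => tendsto_finsetSum _ fun b hb => ?_
    rw [Finset.mem_Ico] at hb
    split_ifs
    · have h := hasSum_sum (s := F) fun y _ =>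
        (hasSum_packet hχ hρ hχρ hs hb.1 hb.2 x y).mul_left (f y)
      have e2 : (fun A : Finset ℤ => ∑ a ∈ A, coef (packet l0 χ) f F ⟨i, a, b⟩ *
          packet l0 ρ ⟨i, a, b⟩ x) = fun A : Finset ℤ => ∑ a ∈ A, ∑ y ∈ F,
          f y * (starRingEnd ℂ (packet l0 χ ⟨i, a, b⟩ y) * packet l0 ρ ⟨i, a, b⟩ x) := by
        funext A
        refine Finset.sum_congr rfl fun a _ => ?_
        rw [coef, Finset.sum_mul]
        exact Finset.sum_congr rfl fun y _ => by ring
      rw [e2]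
      exact h
    · exact tendsto_const_nhds
  exact le_of_tendsto (tendsto_finsetSum _ fun x _ => ((key x).norm.pow 2))
    (Filter.Eventually.of_forall fun A => strong_le hφ hψ hK tiles_valid)

lemma continuous_actMul (hρ : Continuous ρ) (l N : ℝ) : Continuous (actMul ρ l N) := by
  unfold actMul
  split_ifs <;> fun_prop

lemma sum_FT_actMul_le {K : ℝ} (hφ : Packets l0 (packet l0 χ) K)
    (hψ : Packets l0 (packet l0 ρ) K)
    (hK : 1 ≤ K) (hχ : Continuous χ) (hρ : Continuous ρ) (hχρ : ∀ t, χ t * ρ t = ρ t)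
    (hs : ∀ t, t ∉ Set.Ioo (-1 / 2 : ℝ) (3 / 2) → ρ t = 0) (E : Finset ℤ) (N : ℤ → ℝ)
    (h0 : ∀ x, 0 ≤ N x) (h1 : ∀ x, N x < 1) {g : ℝ → ℂ} (hg : SqInt g) (M : ℕ) :
    ∑ x ∈ E, ‖FT (fun t => (∑ i ∈ Finset.range M, actMul ρ (len l0 i) (N x) t : ℝ) * g t) x‖ ^ 2
      ≤ (2 ^ 148 * K ^ 4) ^ 2 * ∫ t in (-1 / 2 : ℝ)..(3 / 2), ‖g t‖ ^ 2 := by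
  have key : ∀ x : ℤ, Filter.Tendsto (fun F : Finset ℤ => ∑ y ∈ F, FT g y *
      (2 * ∑ i ∈ Finset.range M, FT (fun t => (actMul ρ (len l0 i) (N x) t : ℂ)) (x - y)))
      Filter.atTop (nhds (4 * FT (fun t =>
        (∑ i ∈ Finset.range M, actMul ρ (len l0 i) (N x) t : ℝ) * g t) x)) := by
    intro x
    have hc : ∀ i, Continuous fun t => (actMul ρ (len l0 i) (N x) t : ℂ) := fun i =>
      Complex.continuous_ofReal.comp (continuous_actMul hρ _ _)
    have h := (hasSum_convolution
      (W := fun t => ((∑ i ∈ Finset.range M, actMul ρ (len l0 i) (N x) t : ℝ) : ℂ))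
      (by push_cast; fun_prop) (fun t => Complex.conj_ofReal _) hg x).mul_left 4
    have e : (fun F : Finset ℤ => ∑ y ∈ F, FT g y *
      (2 * ∑ i ∈ Finset.range M, FT (fun t => (actMul ρ (len l0 i) (N x) t : ℂ)) (x - y))) =
      fun F : Finset ℤ => ∑ y ∈ F, 4 * (FT g y * (1 / 2 *
        FT (fun t => ((∑ i ∈ Finset.range M, actMul ρ (len l0 i) (N x) t : ℝ) : ℂ)) (x - y))) := by
      funext F
      refine Finset.sum_congr rfl fun y _ => ?_
      have : FT (fun t => ((∑ i ∈ Finset.range M, actMul ρ (len l0 i) (N x) t : ℝ) : ℂ)) (x - y) =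
          ∑ i ∈ Finset.range M, FT (fun t => (actMul ρ (len l0 i) (N x) t : ℂ)) (x - y) := by
        unfold FT
        rw [← intervalIntegral.integral_finsetSum (s := Finset.range M)
          (f := fun i t => (actMul ρ (len l0 i) (N x) t : ℂ) * ee (((x : ℝ) - y) * t)) fun i _ =>
          Continuous.intervalIntegrable ((hc i).mul (by fun_prop)) _ _]
        congr 1
        funext t
        push_cast
        rw [Finset.sum_mul]
      rw [this]
      ring
    rw [e]
    exact h
  have hl : ∀ F : Finset ℤ, (2 ^ 148 * K ^ 4) ^ 2 * ∑ y ∈ F, ‖FT g y‖ ^ 2 ≤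
      (2 ^ 148 * K ^ 4) ^ 2 * (2 * ∫ t in (-1 / 2 : ℝ)..(3 / 2), ‖g t‖ ^ 2) := fun F =>
    mul_le_mul_of_nonneg_left (sum_le_hasSum F (fun _ _ => by positivity) (hasSum_sq_FT hg))
      (by positivity)
  have h := le_of_tendsto (tendsto_finsetSum E fun x _ => ((key x).norm.pow 2))
    (Filter.Eventually.of_forall fun F => (sum_model_le hφ hψ hK hχ hρ hχρ hs E F N h0 h1
      (fun y => FT g y) M).trans (hl F))
  simp only [norm_mul, mul_pow, ← Finset.mul_sum] at h
  have h4 : ‖(4 : ℂ)‖ ^ 2 = 16 := by norm_num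
  rw [h4] at h
  have h5 : 0 ≤ ∫ t in (-1 / 2 : ℝ)..(3 / 2), ‖g t‖ ^ 2 :=
    intervalIntegral.integral_nonneg (by norm_num) fun _ _ => by positivity
  have h6 : 0 ≤ (2 ^ 148 * K ^ 4) ^ 2 * ∫ t in (-1 / 2 : ℝ)..(3 / 2), ‖g t‖ ^ 2 := by positivity
  rw [← mul_pow] at h
  linarith

end

section
variable {χ ρ : ℝ → ℝ}

lemma measurable_actMul (hρ : Continuous ρ) (l : ℝ) : Measurable fun p : ℝ × ℝ =>
    actMul ρ l p.1 p.2 := by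
  unfold actMul
  have h1 : Measurable fun p : ℝ × ℝ => Int.fract (l * p.1) :=
    measurable_fract.comp (by fun_prop)
  have h2 : Measurable fun p : ℝ × ℝ => ((⌊l * p.1⌋ : ℤ) : ℝ) :=
    measurable_from_top.comp (Int.measurable_floor.comp (by fun_prop))
  refine Measurable.ite (measurableSet_le measurable_const h1) ?_ measurable_const
  exact hρ.measurable.comp (by fun_prop)

lemma abs_actMul_le {B : ℝ} (hB : ∀ t, |ρ t| ≤ B) (l N t : ℝ) : |actMul ρ l N t| ≤ B := by
  unfold actMul
  split_ifs
  · exact hB _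
  · simpa using (abs_nonneg _).trans (hB 0)

lemma integral_actMul (hρ : Continuous ρ) {B : ℝ} (hB : ∀ t, |ρ t| ≤ B) (n : ℕ) (hn : n ≠ 0)
    (N t : ℝ) :
    ∫ η in (0 : ℝ)..(1 / 2), actMul ρ (2 * n) (N - η) (t - η)
      = 1 / 2 * ∫ a in (7 / 8 : ℝ)..1, ρ (a - 2 * n * (N - t)) := by
  set u := 2 * (n : ℝ) * (N - t) with hu
  set Φ : ℝ → ℝ := fun v => if 7 / 8 ≤ Int.fract v then ρ (Int.fract v - u) else 0 with hΦ
  have hn' : (n : ℝ) ≠ 0 := by exact_mod_cast hn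
  have hp : Function.Periodic Φ 1 := fun v => by simp only [hΦ, Int.fract_add_one]
  have e1 : ∀ η, actMul ρ (2 * n) (N - η) (t - η) = Φ (2 * n * N - 2 * n * η) := by
    intro η
    simp only [actMul, hΦ]
    rw [← mul_sub]
    congr 2
    rw [Int.fract, hu]
    ring
  have e2 : ∫ v in (0 : ℝ)..1, Φ v = ∫ a in (7 / 8 : ℝ)..1, ρ (a - u) := by
    rw [intervalIntegral.integral_of_le (by norm_num), intervalIntegral.integral_of_le (by norm_num)]
    have h1 : ∀ᵐ v : ℝ, v ∈ Set.Ioc (0 : ℝ) 1 →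
        Φ v = (Set.Ioc (7 / 8 : ℝ) 1).indicator (fun a => ρ (a - u)) v := by
      filter_upwards [(Set.finite_singleton (7 / 8 : ℝ)).countable.ae_notMem volume,
        (Set.finite_singleton (1 : ℝ)).countable.ae_notMem volume] with v h2 h3 h4
      rw [Set.mem_singleton_iff] at h2 h3
      have h5 : Int.fract v = v := Int.fract_eq_self.2 ⟨h4.1.le, lt_of_le_of_ne h4.2 h3⟩
      simp only [hΦ, h5, Set.indicator, Set.mem_Ioc]
      refine if_congr ⟨fun h => ⟨lt_of_le_of_ne h (Ne.symm h2), h4.2⟩, fun h => h.1.le⟩ rfl rfl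
    rw [setIntegral_congr_ae measurableSet_Ioc h1, setIntegral_indicator measurableSet_Ioc,
      Set.Ioc_inter_Ioc]
    norm_num
  simp only [e1]
  rw [intervalIntegral.integral_comp_sub_mul Φ (by positivity) (2 * n * N), smul_eq_mul]
  have e3 : 2 * (n : ℝ) * N - 2 * n * 0 = (2 * n * N - 2 * n * (1 / 2)) + (n : ℤ) • (1 : ℝ) := by
    simp only [zsmul_eq_mul, Int.cast_natCast, mul_one]
    ring
  have hi : ∀ a b, IntervalIntegrable Φ volume a b := by
    intro a b
    have hm : Measurable Φ := Measurable.ite (measurableSet_le measurable_const measurable_fract)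
      (hρ.measurable.comp (measurable_fract.sub_const u)) measurable_const
    rw [intervalIntegrable_iff]
    refine Measure.integrableOn_of_bounded (M := B) (by simp) hm.aestronglyMeasurable
      (Filter.Eventually.of_forall fun v => ?_)
    simp only [hΦ]
    split_ifs
    · exact hB _
    · simpa using (abs_nonneg _).trans (hB 0)
  rw [e3, hp.intervalIntegral_add_zsmul_eq _ _ hi, hp.intervalIntegral_add_eq _ 0, zero_add, e2]
  simp only [zsmul_eq_mul, Int.cast_natCast]
  field_simp

/-- The averaged multiplier. -/
noncomputable def avgMul (ρ : ℝ → ℝ) (u : ℝ) : ℝ := ∫ a in (7 / 8 : ℝ)..1, ρ (a - u)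

lemma integrable_of_support {g : ℝ → ℂ} (hg : MemLp g 2 volume) {a b : ℝ}
    (hs : ∀ t, t ∉ Set.Icc a b → g t = 0) : Integrable g := by
  rw [← integrableOn_iff_integrable_of_support_subset (s := Set.Icc a b)
    fun t ht => by_contra fun h => ht (hs t h)]
  exact (hg.restrict _).integrable (by norm_num)

section
variable {l0 : ℕ} [NeZero l0]

lemma sum_translate_le {K : ℝ} (hφ : Packets l0 (packet l0 χ) K)
    (hψ : Packets l0 (packet l0 ρ) K)
    (hK : 1 ≤ K) (hχ : Continuous χ) (hρ : Continuous ρ) (hχρ : ∀ t, χ t * ρ t = ρ t)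
    (hs : ∀ t, t ∉ Set.Ioo (-1 / 2 : ℝ) (3 / 2) → ρ t = 0) (E : Finset ℤ) (N : ℤ → ℝ)
    (hN : ∀ x, N x ∈ Set.Icc (3 / 4 : ℝ) (7 / 8)) {g : ℝ → ℂ} (hg : MemLp g 2 volume)
    (hgs : ∀ t, t ∉ Set.Icc (3 / 4 : ℝ) (7 / 8) → g t = 0) (M : ℕ) {η : ℝ}
    (hη : η ∈ Set.Icc (0 : ℝ) (1 / 2)) :
    ∑ x ∈ E, ‖∫ t, (∑ i ∈ Finset.range M, actMul ρ (len l0 i) (N x - η) (t - η) : ℝ) *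
      (g t * ee (x * t))‖ ^ 2 ≤ (2 ^ 148 * K ^ 4) ^ 2 * ∫ t, ‖g t‖ ^ 2 := by
  have hG : MemLp (fun t => g (t + η)) 2 volume :=
    hg.comp_measurePreserving (measurePreserving_add_right volume η)
  have h := sum_FT_actMul_le hφ hψ hK hχ hρ hχρ hs E (fun x => N x - η)
    (fun x => by linarith [(hN x).1, hη.2]) (fun x => by linarith [(hN x).2, hη.1])
    (hG.restrict _) M
  have e : ∀ x : ℤ, ‖FT (fun t => (∑ i ∈ Finset.range M, actMul ρ (len l0 i) (N x - η) t : ℝ) *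
      g (t + η)) x‖ = ‖∫ t, (∑ i ∈ Finset.range M, actMul ρ (len l0 i) (N x - η) (t - η) : ℝ) *
      (g t * ee (x * t))‖ := by
    intro x
    rw [FT_eq_integral]
    · rw [← integral_add_right_eq_self (fun t =>
        ((∑ i ∈ Finset.range M, actMul ρ (len l0 i) (N x - η) (t - η) : ℝ) : ℂ) *
        (g t * ee (x * t))) η]
      simp only [add_sub_cancel_right, mul_add, ee_add]
      have : (fun t => ((∑ i ∈ Finset.range M, actMul ρ (len l0 i) (N x - η) t : ℝ) : ℂ) *
          (g (t + η) * (ee (x * t) * ee (x * η)))) = fun t =>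
          (((∑ i ∈ Finset.range M, actMul ρ (len l0 i) (N x - η) t : ℝ) : ℂ) * g (t + η) *
          ee (x * t)) * ee (x * η) := by
        funext t
        ring
      rw [this, integral_mul_const, norm_mul, norm_ee, mul_one]
    · intro t ht
      rw [hgs (t + η) fun h => ht ⟨by linarith [h.1, hη.2], by linarith [h.2, hη.1]⟩, mul_zero]
  simp only [e] at h
  refine h.trans (mul_le_mul_of_nonneg_left ?_ (by positivity))
  rw [intervalIntegral.integral_of_le (by norm_num),
    ← integral_add_right_eq_self (fun t => ‖g t‖ ^ 2) η]
  exact setIntegral_le_integral hG.norm.integrable_sq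
    (Filter.Eventually.of_forall fun t => by positivity)

lemma sum_average_le {K : ℝ} (hφ : Packets l0 (packet l0 χ) K)
    (hψ : Packets l0 (packet l0 ρ) K) (h2 : Even l0)
    (hK : 1 ≤ K) (hχ : Continuous χ) (hρ : Continuous ρ) (hχρ : ∀ t, χ t * ρ t = ρ t)
    (hs : ∀ t, t ∉ Set.Ioo (-1 / 2 : ℝ) (3 / 2) → ρ t = 0) {B : ℝ} (hB : ∀ t, |ρ t| ≤ B)
    (E : Finset ℤ) (N : ℤ → ℝ)
    (hN : ∀ x, N x ∈ Set.Icc (3 / 4 : ℝ) (7 / 8)) {g : ℝ → ℂ} (hg : MemLp g 2 volume)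
    (hgs : ∀ t, t ∉ Set.Icc (3 / 4 : ℝ) (7 / 8) → g t = 0) (M : ℕ) :
    ∑ x ∈ E, ‖∫ t, (∑ i ∈ Finset.range M, avgMul ρ (len l0 i * (N x - t)) : ℝ) *
      (g t * ee (x * t))‖ ^ 2 ≤ (2 ^ 148 * K ^ 4) ^ 2 * ∫ t, ‖g t‖ ^ 2 := by
  set D := (2 ^ 148 * K ^ 4) ^ 2 * ∫ t, ‖g t‖ ^ 2 with hD
  have hD0 : 0 ≤ D := mul_nonneg (by positivity) (integral_nonneg fun _ => by positivity)
  set κ : ℤ → ℝ → ℝ → ℂ := fun x η t =>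
    ((∑ i ∈ Finset.range M, actMul ρ (len l0 i) (N x - η) (t - η) : ℝ) : ℂ) * (g t * ee (x * t))
    with hκ
  set H : ℤ → ℝ → ℂ := fun x η => ∫ t, κ x η t with hH
  have hgi := integrable_of_support hg hgs
  set ν : Measure ℝ := volume.restrict (Set.Ioc (0 : ℝ) (1 / 2)) with hν
  have hint : ∀ x, Integrable (Function.uncurry (κ x)) (ν.prod volume) := by
    intro x
    have h1 : Integrable (fun p : ℝ × ℝ => g p.2 * ee (x * p.2)) (ν.prod volume) := by
      have h3 : Integrable fun t => g t * ee (x * t) := by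
        refine hgi.mul_bdd (c := 1) ?_ (Filter.Eventually.of_forall fun t => (norm_ee _).le)
        exact Continuous.aestronglyMeasurable (by fun_prop)
      exact h3.comp_snd ν
    refine h1.bdd_mul (c := M * B) ?_ ?_
    · refine Measurable.aestronglyMeasurable ?_
      refine Complex.measurable_ofReal.comp (Finset.measurable_sum _ fun i _ => ?_)
      exact (measurable_actMul hρ (len l0 i)).comp
        (f := fun p : ℝ × ℝ => (N x - p.1, p.2 - p.1)) (by fun_prop)
    · refine Filter.Eventually.of_forall fun p => ?_
      rw [Complex.norm_real]
      refine (norm_sum_le _ _).trans ?_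
      refine (Finset.sum_le_sum fun i _ => abs_actMul_le hB _ _ _).trans ?_
      simp
  have hT : ∀ x, ∫ t, ((∑ i ∈ Finset.range M, avgMul ρ (len l0 i * (N x - t)) : ℝ) : ℂ) *
      (g t * ee (x * t)) = 2 * ∫ η in (0 : ℝ)..(1 / 2), H x η := by
    intro x
    rw [intervalIntegral.integral_of_le (by norm_num)]
    simp only [hH]
    rw [integral_integral_swap (hint x), ← integral_const_mul]
    congr 1
    funext t
    simp only [hκ]
    rw [integral_mul_const, ← mul_assoc (2 : ℂ), integral_complex_ofReal]
    congr 1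
    rw [hν, ← intervalIntegral.integral_of_le (by norm_num),
      intervalIntegral.integral_finsetSum, ← Complex.ofReal_ofNat, ← Complex.ofReal_mul,
      Finset.mul_sum]
    · congr 1
      refine Finset.sum_congr rfl fun i _ => ?_
      obtain ⟨n, hn⟩ : ∃ n : ℕ, n ≠ 0 ∧ len l0 i = 2 * n := by
        obtain ⟨k, hk⟩ := h2
        have hk0 := NeZero.ne l0
        refine ⟨k * 8 ^ i, ?_, ?_⟩
        · have : k ≠ 0 := by omega
          positivity
        · rw [len, hk]
          push_cast
          ring
      rw [hn.2, integral_actMul hρ hB n hn.1, avgMul]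
      ring
    · intro i _
      have hm : Measurable fun η => actMul ρ (len l0 i) (N x - η) (t - η) :=
        (measurable_actMul hρ (len l0 i)).comp (f := fun η : ℝ => (N x - η, t - η)) (by fun_prop)
      rw [intervalIntegrable_iff]
      exact Measure.integrableOn_of_bounded (M := B) (by simp) hm.aestronglyMeasurable
        (Filter.Eventually.of_forall fun η => abs_actMul_le hB _ _ _)
  simp only [hT]
  have hHi : ∀ x, IntervalIntegrable (H x) volume 0 (1 / 2) := by
    intro x
    rw [intervalIntegrable_iff_integrableOn_Ioc_of_le (by norm_num)]
    exact (hint x).integral_prod_left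
  set w : ℤ → ℂ := fun x => 2 * ∫ η in (0 : ℝ)..(1 / 2), H x η with hw
  set W := ∑ x ∈ E, ‖w x‖ ^ 2 with hW
  have hW0 : 0 ≤ W := Finset.sum_nonneg fun _ _ => by positivity
  have h3 : (W : ℂ) = 2 * ∫ η in (0 : ℝ)..(1 / 2), ∑ x ∈ E, starRingEnd ℂ (w x) * H x η := by
    rw [intervalIntegral.integral_finsetSum fun x _ => (hHi x).const_mul _, Finset.mul_sum, hW]
    push_cast
    refine Finset.sum_congr rfl fun x _ => ?_
    rw [intervalIntegral.integral_const_mul, mul_left_comm]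
    change _ = starRingEnd ℂ (w x) * w x
    rw [← Complex.normSq_eq_conj_mul_self, Complex.normSq_eq_norm_sq]
    push_cast
    rfl
  have h4 : W ≤ √W * √D := by
    have h5 : ‖(W : ℂ)‖ ≤ 2 * ((√W * √D) * |1 / 2 - 0|) := by
      rw [h3, norm_mul, show ‖(2 : ℂ)‖ = 2 by norm_num]
      refine mul_le_mul_of_nonneg_left ?_ (by norm_num)
      refine intervalIntegral.norm_integral_le_of_norm_le_const fun η hη => ?_
      rw [Set.uIoc_of_le (by norm_num)] at hη
      refine (norm_sum_le _ _).trans ?_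
      simp only [norm_mul, RCLike.norm_conj]
      refine (Real.sum_mul_le_sqrt_mul_sqrt E (fun x => ‖w x‖) fun x => ‖H x η‖).trans ?_
      refine mul_le_mul_of_nonneg_left (Real.sqrt_le_sqrt ?_) (Real.sqrt_nonneg _)
      exact sum_translate_le hφ hψ hK hχ hρ hχρ hs E N hN hg hgs M ⟨hη.1.le, hη.2⟩
    rw [Complex.norm_real, Real.norm_of_nonneg hW0, sub_zero, abs_of_pos (by norm_num)] at h5
    linarith
  have h6 := Real.sq_sqrt hW0
  have h7 := Real.sq_sqrt hD0
  have h8 := Real.sqrt_nonneg W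
  have h9 := Real.sqrt_nonneg D
  nlinarith [sq_nonneg (√W - √D)]

end
end

/-- A smooth step from `0` to `1` on `[0, 1/16]`. -/
noncomputable def step (v : ℝ) : ℝ := Real.smoothTransition (16 * v)

/-- The primitive of `step`. -/
noncomputable def ramp (u : ℝ) : ℝ := ∫ v in (0 : ℝ)..u, step v

/-- A smooth function equal to `0` before `1/4` and to `1/4` after `9/16`. -/
noncomputable def jump (u : ℝ) : ℝ := ramp (u - 1 / 4) - ramp (u - 1 / 2)

/-- The bump whose averages are the dyadic differences of `jump`. -/
noncomputable def diffBump (u : ℝ) : ℝ :=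
  2 * step (2 * u - 1 / 4) - step (u - 1 / 4) - step (u - 3 / 8)

/-- The bump defining the outer wave packets. -/
noncomputable def outerBump (t : ℝ) : ℝ := diffBump (7 / 8 - t)

/-- The bump defining the inner wave packets. -/
noncomputable def innerBump (t : ℝ) : ℝ :=
  Real.smoothTransition (16 * t - 6) * Real.smoothTransition (13 - 16 * t)

lemma step_of_nonpos {v : ℝ} (h : v ≤ 0) : step v = 0 :=
  Real.smoothTransition.zero_of_nonpos (by linarith)

lemma step_of_le {v : ℝ} (h : 1 / 16 ≤ v) : step v = 1 :=
  Real.smoothTransition.one_of_one_le (by linarith)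

lemma abs_step_le (v : ℝ) : |step v| ≤ 1 := by
  rw [step, abs_of_nonneg (Real.smoothTransition.nonneg _)]
  exact Real.smoothTransition.le_one _

lemma contDiff_step : ContDiff ℝ (⊤ : ℕ∞) step := by
  have h1 : ContDiff ℝ (⊤ : ℕ∞) Real.smoothTransition := Real.smoothTransition.contDiff
  exact h1.comp (by fun_prop)

@[fun_prop]
lemma continuous_step : Continuous step := contDiff_step.continuous

lemma contDiff_outerBump : ContDiff ℝ (⊤ : ℕ∞) outerBump := by
  have h := contDiff_step
  have h1 : ContDiff ℝ (⊤ : ℕ∞) diffBump :=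
    ((contDiff_const.mul (h.comp (by fun_prop))).sub (h.comp (by fun_prop))).sub
      (h.comp (by fun_prop))
  exact h1.comp (by fun_prop)

lemma contDiff_innerBump : ContDiff ℝ (⊤ : ℕ∞) innerBump := by
  have h1 : ContDiff ℝ (⊤ : ℕ∞) Real.smoothTransition := Real.smoothTransition.contDiff
  exact (h1.comp (by fun_prop)).mul (h1.comp (by fun_prop))

lemma innerBump_eq_zero (t : ℝ) (ht : t ∉ Set.Ico (3 / 8 : ℝ) (13 / 16)) : innerBump t = 0 := by
  rw [Set.mem_Ico, not_and_or, not_le, not_lt] at ht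
  rcases ht with h | h
  · rw [innerBump, Real.smoothTransition.zero_of_nonpos (by linarith), zero_mul]
  · rw [innerBump, mul_comm, Real.smoothTransition.zero_of_nonpos (by linarith), zero_mul]

lemma outerBump_eq_zero {t : ℝ} (ht : t < 7 / 16 ∨ 3 / 4 < t) : outerBump t = 0 := by
  rw [outerBump, diffBump]
  rcases ht with h | h
  · rw [step_of_le (by linarith), step_of_le (by linarith), step_of_le (by linarith)]
    norm_num
  · rw [step_of_nonpos (by linarith), step_of_nonpos (by linarith), step_of_nonpos (by linarith)]
    norm_num

lemma outerBump_eq_zero' (t : ℝ) (ht : t ∉ Set.Ico (3 / 8 : ℝ) (13 / 16)) : outerBump t = 0 := by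
  refine outerBump_eq_zero ?_
  rw [Set.mem_Ico, not_and_or, not_le, not_lt] at ht
  rcases ht with h | h
  · left; linarith
  · right; linarith

lemma innerBump_mul_outerBump (t : ℝ) : innerBump t * outerBump t = outerBump t := by
  by_cases h : t < 7 / 16 ∨ 3 / 4 < t
  · rw [outerBump_eq_zero h, mul_zero]
  · push Not at h
    rw [innerBump, Real.smoothTransition.one_of_one_le (by linarith [h.1]),
      Real.smoothTransition.one_of_one_le (by linarith [h.2]), one_mul, one_mul]

lemma abs_outerBump_le (t : ℝ) : |outerBump t| ≤ 4 := by
  rw [outerBump, diffBump]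
  have h1 := abs_le.1 (abs_step_le (2 * (7 / 8 - t) - 1 / 4))
  have h2 := abs_le.1 (abs_step_le (7 / 8 - t - 1 / 4))
  have h3 := abs_le.1 (abs_step_le (7 / 8 - t - 3 / 8))
  rw [abs_le]
  constructor <;> linarith

lemma hasDerivAt_ramp (u : ℝ) : HasDerivAt ramp (step u) u :=
  intervalIntegral.integral_hasDerivAt_right (continuous_step.intervalIntegrable _ _)
    (continuous_step.stronglyMeasurableAtFilter _ _) continuous_step.continuousAt

lemma avgMul_outerBump (u : ℝ) : avgMul outerBump u = jump (2 * u) - jump u := by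
  have h1 : ∀ v, HasDerivAt (fun v => ramp (2 * v - 1 / 4) - ramp (v - 1 / 4) - ramp (v - 3 / 8))
      (diffBump v) v := by
    intro v
    have e1 : HasDerivAt (fun v : ℝ => 2 * v - 1 / 4) 2 v := by
      simpa using ((hasDerivAt_id v).const_mul 2).sub_const (1 / 4)
    have h := ((hasDerivAt_ramp (2 * v - 1 / 4)).comp v e1).sub
      ((hasDerivAt_ramp (v - 1 / 4)).comp v ((hasDerivAt_id v).sub_const (1 / 4))) |>.sub
      ((hasDerivAt_ramp (v - 3 / 8)).comp v ((hasDerivAt_id v).sub_const (3 / 8)))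
    rw [mul_one, mul_one, mul_comm] at h
    exact h
  have h2 : Continuous diffBump := by
    unfold diffBump
    fun_prop
  have e : avgMul outerBump u = ∫ a in (7 / 8 : ℝ)..1, diffBump (7 / 8 + u - a) := by
    unfold avgMul outerBump
    congr 1
    funext a
    congr 1
    ring
  rw [e, intervalIntegral.integral_comp_sub_left,
    intervalIntegral.integral_eq_sub_of_hasDerivAt (fun v _ => h1 v) (h2.intervalIntegrable _ _),
    jump, jump]
  ring_nf

lemma ramp_of_nonpos {u : ℝ} (h : u ≤ 0) : ramp u = 0 := by
  rw [ramp, intervalIntegral.integral_congr (g := fun _ => 0), intervalIntegral.integral_zero]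
  intro v hv
  rw [Set.uIcc_of_ge h] at hv
  exact step_of_nonpos hv.2

lemma ramp_sub (u v : ℝ) : ramp u - ramp v = ∫ t in v..u, step t :=
  intervalIntegral.integral_interval_sub_left (continuous_step.intervalIntegrable _ _)
    (continuous_step.intervalIntegrable _ _)

lemma jump_of_le {u : ℝ} (h : u ≤ 1 / 4) : jump u = 0 := by
  rw [jump, ramp_of_nonpos (by linarith), ramp_of_nonpos (by linarith), sub_zero]

lemma jump_of_ge {u : ℝ} (h : 9 / 16 ≤ u) : jump u = 1 / 4 := by
  rw [jump, ramp_sub, intervalIntegral.integral_congr (g := fun _ => 1)]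
  · simp
    ring
  · intro v hv
    rw [Set.uIcc_of_le (by linarith)] at hv
    exact step_of_le (by linarith [hv.1])

lemma abs_jump_le (u : ℝ) : |jump u| ≤ 1 := by
  rw [jump, ramp_sub, ← Real.norm_eq_abs]
  refine (intervalIntegral.norm_integral_le_of_norm_le_const (C := 1)
    fun v _ => abs_step_le v).trans ?_
  rw [one_mul, show u - 1 / 4 - (u - 1 / 2) = 1 / 4 by ring]
  norm_num

lemma continuous_jump : Continuous jump := by
  have h : Continuous ramp :=
    continuous_iff_continuousAt.2 fun u => (hasDerivAt_ramp u).continuousAt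
  unfold jump
  fun_prop

lemma sum_avgMul_outerBump (M : ℕ) (u : ℝ) :
    ∑ i ∈ Finset.range M, avgMul outerBump (len 2 i * u) +
      ∑ i ∈ Finset.range M, avgMul outerBump (len 4 i * u) +
      ∑ i ∈ Finset.range M, avgMul outerBump (len 8 i * u)
      = jump (2 * 8 ^ M * u) - jump (2 * u) := by
  induction M with
  | zero => simp
  | succ M ih =>
    rw [Finset.sum_range_succ, Finset.sum_range_succ, Finset.sum_range_succ]
    have e : ∀ a b c x y z : ℝ, a + x + (b + y) + (c + z) = (a + b + c) + (x + y + z) := by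
      intros; ring
    rw [e, ih, avgMul_outerBump, avgMul_outerBump, avgMul_outerBump]
    simp only [len]
    push_cast
    ring_nf

lemma exists_jump_bound : ∃ C : ℝ, 0 ≤ C ∧ ∀ g : ℝ → ℂ, MemLp g 2 volume →
    (∀ t, t ∉ Set.Icc (3 / 4 : ℝ) (7 / 8) → g t = 0) → ∀ (E : Finset ℤ) (N : ℤ → ℝ),
    (∀ x, N x ∈ Set.Icc (3 / 4 : ℝ) (7 / 8)) → ∀ M : ℕ,
    ∑ x ∈ E, ‖∫ t, (jump (2 * 8 ^ M * (N x - t)) : ℝ) * (g t * ee (x * t))‖ ^ 2 ≤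
      C * ∫ t, ‖g t‖ ^ 2 := by
  obtain ⟨K, hK, hP⟩ := exists_packets contDiff_innerBump contDiff_outerBump innerBump_eq_zero
    outerBump_eq_zero'
  refine ⟨9 * (2 ^ 148 * K ^ 4) ^ 2, by positivity, fun g hg hgs E N hN M => ?_⟩
  have hs : ∀ t, t ∉ Set.Ioo (-1 / 2 : ℝ) (3 / 2) → outerBump t = 0 := fun t ht =>
    outerBump_eq_zero' t fun h => ht ⟨by linarith [h.1], by linarith [h.2]⟩
  have hl : ∀ l0 : ℕ, l0 ≠ 0 → Even l0 → ∑ x ∈ E, ‖∫ t, (∑ i ∈ Finset.range M,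
      avgMul outerBump (len l0 i * (N x - t)) : ℝ) * (g t * ee (x * t))‖ ^ 2 ≤
      (2 ^ 148 * K ^ 4) ^ 2 * ∫ t, ‖g t‖ ^ 2 := by
    intro l0 h0 h2
    have : NeZero l0 := ⟨h0⟩
    exact sum_average_le (hP l0 h0).1 (hP l0 h0).2 h2 hK contDiff_innerBump.continuous
      contDiff_outerBump.continuous innerBump_mul_outerBump hs abs_outerBump_le E N hN hg hgs M
  have hgi := integrable_of_support hg hgs
  have hi : ∀ (x : ℤ) (l0 : ℕ), Integrable fun t => ((∑ i ∈ Finset.range M,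
      avgMul outerBump (len l0 i * (N x - t)) : ℝ) : ℂ) * (g t * ee (x * t)) := by
    intro x l0
    have h3 : Integrable fun t => g t * ee (x * t) := by
      refine hgi.mul_bdd (c := 1) ?_ (Filter.Eventually.of_forall fun t => (norm_ee _).le)
      exact Continuous.aestronglyMeasurable (by fun_prop)
    refine h3.bdd_mul (c := M * 2) ?_ (Filter.Eventually.of_forall fun t => ?_)
    · refine Continuous.aestronglyMeasurable ?_
      simp only [avgMul_outerBump]
      have := continuous_jump
      fun_prop
    · rw [Complex.norm_real]
      have h5 := norm_sum_le_of_le (Finset.range M)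
        (f := fun i => avgMul outerBump (len l0 i * (N x - t))) (n := fun _ => 2) fun i _ => by
          have h6 := abs_le.1 (abs_jump_le (2 * (len l0 i * (N x - t))))
          have h7 := abs_le.1 (abs_jump_le (len l0 i * (N x - t)))
          rw [avgMul_outerBump, Real.norm_eq_abs, abs_le]
          constructor <;> linarith
      simpa using h5
  have e : ∀ x : ℤ, ∫ t, (jump (2 * 8 ^ M * (N x - t)) : ℝ) * (g t * ee (x * t)) =
      (∫ t, ((∑ i ∈ Finset.range M, avgMul outerBump (len 2 i * (N x - t)) : ℝ) : ℂ) *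
        (g t * ee (x * t))) +
      (∫ t, ((∑ i ∈ Finset.range M, avgMul outerBump (len 4 i * (N x - t)) : ℝ) : ℂ) *
        (g t * ee (x * t))) +
      ∫ t, ((∑ i ∈ Finset.range M, avgMul outerBump (len 8 i * (N x - t)) : ℝ) : ℂ) *
        (g t * ee (x * t)) := by
    intro x
    rw [← integral_add (hi x 2) (hi x 4)]
    refine Eq.trans ?_ (integral_add ((hi x 2).add (hi x 4)) (hi x 8))
    congr 1
    funext t
    rw [← add_mul, ← add_mul, ← Complex.ofReal_add, ← Complex.ofReal_add, sum_avgMul_outerBump]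
    by_cases ht : t ∈ Set.Icc (3 / 4 : ℝ) (7 / 8)
    · rw [jump_of_le (u := 2 * (N x - t)) (by linarith [(hN x).2, ht.1]), sub_zero]
    · simp [hgs t ht]
  have h3 : ∀ a b c : ℂ, ‖a + b + c‖ ^ 2 ≤ 3 * (‖a‖ ^ 2 + ‖b‖ ^ 2 + ‖c‖ ^ 2) := by
    intro a b c
    have h := pow_le_pow_left₀ (norm_nonneg _) (norm_add₃_le (a := a) (b := b) (c := c)) 2
    nlinarith [sq_nonneg (‖a‖ - ‖b‖), sq_nonneg (‖a‖ - ‖c‖), sq_nonneg (‖b‖ - ‖c‖)]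
  refine (Finset.sum_le_sum fun x _ => (e x ▸ h3 _ _ _)).trans ?_
  rw [← Finset.mul_sum, Finset.sum_add_distrib, Finset.sum_add_distrib]
  have h4 := hl 2 (by norm_num) (by decide)
  have h5 := hl 4 (by norm_num) (by decide)
  have h6 := hl 8 (by norm_num) (by decide)
  linarith

theorem exists_piece_bound : ∃ C : ℝ, 0 ≤ C ∧ ∀ g : ℝ → ℂ, MemLp g 2 volume →
    (∀ t, t ∉ Set.Icc (3 / 4 : ℝ) (7 / 8) → g t = 0) → ∀ (E : Finset ℤ) (N : ℤ → ℝ),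
    (∀ x, N x ∈ Set.Icc (3 / 4 : ℝ) (7 / 8)) →
    ∑ x ∈ E, ‖∫ t in (3 / 4 : ℝ)..N x, g t * ee (x * t)‖ ^ 2 ≤ C * ∫ t, ‖g t‖ ^ 2 := by
  obtain ⟨C, hC, h⟩ := exists_jump_bound
  refine ⟨16 * C, by positivity, fun g hg hgs E N hN => ?_⟩
  have hgi := integrable_of_support hg hgs
  have key : ∀ x : ℤ, Filter.Tendsto (fun M : ℕ =>
      ∫ t, (jump (2 * 8 ^ M * (N x - t)) : ℝ) * (g t * ee (x * t))) Filter.atTop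
      (nhds (1 / 4 * ∫ t in (3 / 4 : ℝ)..N x, g t * ee (x * t))) := by
    intro x
    have e : 1 / 4 * ∫ t in (3 / 4 : ℝ)..N x, g t * ee (x * t) =
        ∫ t, (Set.Ioo (3 / 4 : ℝ) (N x)).indicator (fun t => 1 / 4 * (g t * ee (x * t))) t := by
      rw [integral_indicator measurableSet_Ioo, intervalIntegral.integral_of_le (hN x).1,
        integral_Ioc_eq_integral_Ioo, integral_const_mul]
    rw [e]
    refine tendsto_integral_of_dominated_convergence (fun t => ‖g t‖) (fun M => ?_) hgi.norm
      (fun M => Filter.Eventually.of_forall fun t => ?_) ?_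
    · have := continuous_jump
      refine Continuous.aestronglyMeasurable (by fun_prop) |>.mul (hgi.1.mul ?_)
      exact Continuous.aestronglyMeasurable (by fun_prop)
    · rw [norm_mul, norm_mul, norm_ee, mul_one, Complex.norm_real]
      exact mul_le_of_le_one_left (norm_nonneg _) (abs_jump_le _)
    · filter_upwards [(Set.finite_singleton (3 / 4 : ℝ)).countable.ae_notMem volume] with t ht
      rw [Set.mem_singleton_iff] at ht
      by_cases h1 : t ∈ Set.Icc (3 / 4 : ℝ) (7 / 8)
      swap
      · simp [Set.indicator, hgs t h1]
      have h34 : 3 / 4 < t := lt_of_le_of_ne h1.1 (Ne.symm ht)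
      by_cases h2 : t < N x
      · rw [Set.indicator_of_mem (show t ∈ Set.Ioo (3 / 4) (N x) from ⟨h34, h2⟩)]
        refine tendsto_const_nhds.congr' ?_
        have h3 : Filter.Tendsto (fun M : ℕ => (8 : ℝ) ^ M) Filter.atTop Filter.atTop :=
          tendsto_pow_atTop_atTop_of_one_lt (by norm_num)
        filter_upwards [h3.eventually_ge_atTop (1 / (N x - t))] with M hM
        rw [div_le_iff₀ (by linarith)] at hM
        rw [jump_of_ge (by linarith)]
        norm_num
      · rw [Set.indicator_of_notMem fun h => h2 h.2]
        push Not at h2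
        refine tendsto_const_nhds.congr fun M => ?_
        rw [jump_of_le, Complex.ofReal_zero, zero_mul]
        have : 0 ≤ 2 * (8 : ℝ) ^ M * (t - N x) := mul_nonneg (by positivity) (by linarith)
        linarith
  have h2 := le_of_tendsto (tendsto_finsetSum E fun x _ => ((key x).norm.pow 2))
    (Filter.Eventually.of_forall fun M => h g hg hgs E N hN M)
  simp only [norm_mul, mul_pow, ← Finset.mul_sum] at h2
  have h4 : ‖(1 / 4 : ℂ)‖ ^ 2 = 1 / 16 := by norm_num
  rw [h4] at h2
  linarith

/-- The part of the maximal inequality coming from an interval of length `1/8`. -/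
lemma exists_interval_piece_bound : ∃ C : ℝ, 0 ≤ C ∧ ∀ g : ℝ → ℂ, MemLp g 2 volume →
    ∀ (c : ℝ) (E : Finset ℤ) (N : ℤ → ℝ), (∀ x, N x ∈ Set.Icc c (c + 1 / 8)) →
    ∑ x ∈ E, ‖∫ t in c..N x, g t * ee (x * t)‖ ^ 2 ≤ C * ∫ t, ‖g t‖ ^ 2 := by
  obtain ⟨C, hC, h⟩ := exists_piece_bound
  refine ⟨C, hC, fun g hg c E N hN => ?_⟩
  set d := c - 3 / 4 with hd
  have hG : MemLp (fun s => g (s + d)) 2 volume :=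
    hg.comp_measurePreserving (measurePreserving_add_right volume d)
  set G := (Set.Icc (3 / 4 : ℝ) (7 / 8)).indicator fun s => g (s + d) with hGd
  have hG' : MemLp G 2 volume := hG.indicator measurableSet_Icc
  have h1 := h G hG' (fun t ht => Set.indicator_of_notMem ht _) E (fun x => N x - d)
    fun x => ⟨by linarith [(hN x).1], by linarith [(hN x).2]⟩
  have e : ∀ x : ℤ, ‖∫ t in c..N x, g t * ee (x * t)‖ =
      ‖∫ t in (3 / 4 : ℝ)..(N x - d), G t * ee (x * t)‖ := by
    intro x
    have e1 := intervalIntegral.integral_comp_add_right (a := 3 / 4) (b := N x - d)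
      (fun t => g t * ee (x * t)) d
    rw [show 3 / 4 + d = c by rw [hd]; ring, sub_add_cancel] at e1
    rw [← e1]
    have e2 : ∫ t in (3 / 4 : ℝ)..(N x - d), g (t + d) * ee (x * (t + d)) =
        ∫ t in (3 / 4 : ℝ)..(N x - d), G t * ee (x * t) * ee (x * d) := by
      refine intervalIntegral.integral_congr fun t ht => ?_
      rw [Set.uIcc_of_le (by linarith [(hN x).1])] at ht
      have ht' : t ∈ Set.Icc (3 / 4 : ℝ) (7 / 8) := ⟨ht.1, by linarith [(hN x).2, ht.2]⟩
      simp only [hGd]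
      rw [Set.indicator_of_mem ht', mul_add, ee_add, mul_assoc]
    rw [e2, intervalIntegral.integral_mul_const, norm_mul, norm_ee, mul_one]
  simp only [e]
  refine h1.trans (mul_le_mul_of_nonneg_left ?_ hC)
  rw [← integral_add_right_eq_self (fun t => ‖g t‖ ^ 2) d]
  refine integral_mono hG'.norm.integrable_sq hG.norm.integrable_sq fun t => ?_
  simp only [hGd]
  exact pow_le_pow_left₀ (norm_nonneg _) (norm_indicator_le_norm_self _ _) 2

/-- The maximal inequality for Fourier series, linearized. -/
theorem exists_interval_bound : ∃ C : ℝ, 0 ≤ C ∧ ∀ g : ℝ → ℂ, MemLp g 2 volume →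
    ∀ (E : Finset ℤ) (N : ℤ → ℝ), (∀ x, N x ∈ Set.Icc (0 : ℝ) 1) →
    ∑ x ∈ E, ‖∫ t in (0 : ℝ)..N x, g t * ee (x * t)‖ ^ 2 ≤ C * ∫ t, ‖g t‖ ^ 2 := by
  obtain ⟨C, hC, h⟩ := exists_interval_piece_bound
  refine ⟨64 * C, by positivity, fun g hg E N hN => ?_⟩
  set p : ℤ → ℕ → ℂ := fun x k => ∫ t in (k / 8 : ℝ)..max (k / 8) (min (N x) ((k + 1) / 8)),
    g t * ee (x * t) with hp
  have e : ∀ x : ℤ, ∫ t in (0 : ℝ)..N x, g t * ee (x * t) = ∑ k ∈ Finset.range 8, p x k := by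
    intro x
    have hi : ∀ a b, IntervalIntegrable (fun t => g t * ee (x * t)) volume a b := by
      intro a b
      rw [intervalIntegrable_iff]
      have h1 : IntegrableOn g (Set.Ioc (min a b) (max a b)) :=
        (hg.restrict (Set.Ioc (min a b) (max a b))).integrable (by norm_num)
      refine h1.mul_bdd (c := 1) ?_ (Filter.Eventually.of_forall fun t => (norm_ee _).le)
      exact Continuous.aestronglyMeasurable (by fun_prop)
    have h2 := intervalIntegral.sum_integral_adjacent_intervals (n := 8)
      (a := fun k : ℕ => min (N x) (k / 8)) (f := fun t => g t * ee (x * t)) (μ := volume)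
      fun k _ => hi _ _
    have h3 : min (N x) ((0 : ℕ) / 8) = 0 := by simpa using (hN x).1
    have h4 : min (N x) ((8 : ℕ) / 8) = N x := by simpa using (hN x).2
    simp only [h3, h4] at h2
    rw [← h2]
    refine Finset.sum_congr rfl fun k _ => ?_
    simp only [hp]
    push_cast
    have hk : (k / 8 : ℝ) ≤ (k + 1) / 8 := by linarith
    rcases le_total (k / 8 : ℝ) (N x) with h5 | h5
    · rw [min_eq_right h5, max_eq_right (le_min h5 hk)]
    · rw [min_eq_left h5, min_eq_left (h5.trans hk), max_eq_left h5]
      simp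
  have h1 : ∀ k ∈ Finset.range 8, ∑ x ∈ E, ‖p x k‖ ^ 2 ≤ C * ∫ t, ‖g t‖ ^ 2 := by
    intro k _
    refine h g hg (k / 8) E _ fun x => ⟨le_max_left _ _, max_le (by linarith) ?_⟩
    exact (min_le_right _ _).trans (by linarith)
  calc ∑ x ∈ E, ‖∫ t in (0 : ℝ)..N x, g t * ee (x * t)‖ ^ 2
      ≤ ∑ x ∈ E, 8 * ∑ k ∈ Finset.range 8, ‖p x k‖ ^ 2 := by
        refine Finset.sum_le_sum fun x _ => ?_
        rw [e]
        refine (pow_le_pow_left₀ (norm_nonneg _) (norm_sum_le _ _) 2).trans ?_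
        have := sq_sum_le_card_mul_sum_sq (s := Finset.range 8) (f := fun k => ‖p x k‖)
        simpa using this
    _ = 8 * ∑ k ∈ Finset.range 8, ∑ x ∈ E, ‖p x k‖ ^ 2 := by
        rw [← Finset.mul_sum, Finset.sum_comm]
    _ ≤ 8 * ∑ k ∈ Finset.range 8, C * ∫ t, ‖g t‖ ^ 2 := by
        gcongr with k hk
        exact h1 k hk
    _ = 64 * C * ∫ t, ‖g t‖ ^ 2 := by
        simp
        ring

lemma norm_exp_le {δ : ℂ} {h t : ℝ} (hδ : |δ.im| ≤ h) (h0 : 0 ≤ t) (h1 : t ≤ 1) :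
    ‖Complex.exp (Complex.I * δ * t)‖ ≤ Real.exp h := by
  rw [Complex.norm_exp]
  refine Real.exp_le_exp.2 ?_
  have h2 := abs_le.1 hδ
  simp only [Complex.mul_re, Complex.I_re, Complex.I_im, Complex.ofReal_re, Complex.ofReal_im,
    Complex.mul_im]
  nlinarith

/-- Integration by parts against an exponential. -/
lemma norm_integral_mul_exp_le {f : ℝ → ℂ} {y h S : ℝ} {δ : ℂ} (hδ : |δ.im| ≤ h) (h0 : 0 ≤ y)
    (h1 : y ≤ 1) (hf : IntegrableOn f (Set.Ioc 0 y))
    (hS : ∀ s ∈ Set.Icc 0 y, ‖∫ t in (0 : ℝ)..s, f t‖ ≤ S) :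
    ‖∫ t in (0 : ℝ)..y, f t * Complex.exp (Complex.I * δ * t)‖ ≤ Real.exp h * (1 + ‖δ‖) * S := by
  set φ : ℝ → ℂ := fun t => Complex.exp (Complex.I * δ * t) with hφ
  set φ' : ℝ → ℂ := fun t => φ t * (Complex.I * δ) with hφ'
  have hd : ∀ t, HasDerivAt φ (φ' t) t := by
    intro t
    have := (((hasDerivAt_id (t : ℂ)).const_mul (Complex.I * δ)).cexp).comp_ofReal
    simpa [hφ, hφ'] using this
  have hc : Continuous φ := continuous_iff_continuousAt.2 fun t => (hd t).continuousAt
  have hc' : Continuous φ' := by fun_prop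
  have hS0 : 0 ≤ S := (norm_nonneg _).trans (hS 0 ⟨le_rfl, h0⟩)
  have hint : Integrable (Function.uncurry fun t s => (Set.Ioi t).indicator (fun s => f t * φ' s) s)
      ((volume.restrict (Set.Ioc 0 y)).prod (volume.restrict (Set.Ioc 0 y))) := by
    have h2 : Integrable (fun p : ℝ × ℝ => f p.1 * φ' p.2)
        ((volume.restrict (Set.Ioc 0 y)).prod (volume.restrict (Set.Ioc 0 y))) :=
      Integrable.mul_prod hf ((hc'.integrableOn_Icc).mono_set Set.Ioc_subset_Icc_self)
    have h3 := h2.indicator (measurableSet_lt measurable_fst measurable_snd)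
    refine h3.congr (Filter.Eventually.of_forall fun p => ?_)
    simp [Function.uncurry, Set.indicator]
  have key : ∫ t in (0 : ℝ)..y, f t * φ t = (∫ t in (0 : ℝ)..y, f t) * φ y -
      ∫ s in (0 : ℝ)..y, (∫ t in (0 : ℝ)..s, f t) * φ' s := by
    have h2 : ∫ t in (0 : ℝ)..y, f t * (φ y - φ t) =
        ∫ s in (0 : ℝ)..y, (∫ t in (0 : ℝ)..s, f t) * φ' s := by
      rw [intervalIntegral.integral_of_le h0, intervalIntegral.integral_of_le h0]
      refine Eq.trans ?_ ((integral_integral_swap hint).trans ?_)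
      · refine setIntegral_congr_fun measurableSet_Ioc fun t ht => ?_
        rw [setIntegral_indicator measurableSet_Ioi, Set.Ioc_inter_Ioi, sup_eq_right.2 ht.1.le,
          integral_const_mul, ← intervalIntegral.integral_of_le ht.2,
          intervalIntegral.integral_eq_sub_of_hasDerivAt (fun s _ => hd s)
            (hc'.intervalIntegrable _ _)]
      · refine setIntegral_congr_fun measurableSet_Ioc fun s hs => ?_
        have e : ∀ t, (Set.Ioi t).indicator (fun s => f t * φ' s) s =
            (Set.Iio s).indicator (fun t => f t * φ' s) t := fun t => by
          simp [Set.indicator]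
        simp only [e]
        rw [setIntegral_indicator measurableSet_Iio, integral_mul_const,
          intervalIntegral.integral_of_le hs.1.le, integral_Ioc_eq_integral_Ioo]
        congr 3
        ext t
        simp only [Set.mem_inter_iff, Set.mem_Ioc, Set.mem_Iio, Set.mem_Ioo]
        constructor
        · rintro ⟨⟨h3, -⟩, h5⟩
          exact ⟨h3, h5⟩
        · rintro ⟨h3, h4⟩
          exact ⟨⟨h3, h4.le.trans hs.2⟩, h4⟩
    have hfi : IntervalIntegrable f volume 0 y := by
      rwa [intervalIntegrable_iff_integrableOn_Ioc_of_le h0]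
    rw [← h2]
    simp only [mul_sub]
    rw [intervalIntegral.integral_sub (hfi.mul_const _) (hfi.mul_continuousOn hc.continuousOn),
      intervalIntegral.integral_mul_const]
    ring
  have hb : ∀ s ∈ Set.Icc 0 y, ‖φ s‖ ≤ Real.exp h := fun s hs =>
    norm_exp_le hδ hs.1 (hs.2.trans h1)
  rw [key]
  refine (norm_sub_le _ _).trans ?_
  have h3 : ‖(∫ t in (0 : ℝ)..y, f t) * φ y‖ ≤ S * Real.exp h := by
    rw [norm_mul]
    exact mul_le_mul (hS y ⟨h0, le_rfl⟩) (hb y ⟨h0, le_rfl⟩) (norm_nonneg _) hS0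
  have h4 : ‖∫ s in (0 : ℝ)..y, (∫ t in (0 : ℝ)..s, f t) * φ' s‖
      ≤ S * (Real.exp h * ‖δ‖) * |y - 0| := by
    refine intervalIntegral.norm_integral_le_of_norm_le_const fun s hs => ?_
    rw [Set.uIoc_of_le h0] at hs
    have hs' : s ∈ Set.Icc 0 y := ⟨hs.1.le, hs.2⟩
    simp only [hφ', norm_mul, Complex.norm_I, one_mul]
    exact mul_le_mul (hS s hs') (mul_le_mul_of_nonneg_right (hb s hs') (norm_nonneg _))
      (by positivity) hS0
  rw [sub_zero, abs_of_nonneg h0] at h4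
  have h5 : S * (Real.exp h * ‖δ‖) * y ≤ S * (Real.exp h * ‖δ‖) :=
    mul_le_of_le_one_right (by positivity) h1
  linarith

lemma integrableOn_mul_exp {g : ℝ → ℂ} (hg : IntegrableOn g (Set.Ioc 0 1)) (lam : ℂ) {y : ℝ}
    (hy : y ∈ Set.Icc (0 : ℝ) 1) :
    IntegrableOn (fun t => g t * Complex.exp (Complex.I * lam * t)) (Set.Ioc 0 y) := by
  have h1 : IntervalIntegrable g volume 0 y :=
    (intervalIntegrable_iff_integrableOn_Ioc_of_le hy.1).2
      (hg.mono_set (Set.Ioc_subset_Ioc_right hy.2))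
  have h2 : Continuous fun t : ℝ => Complex.exp (Complex.I * lam * t) := by fun_prop
  exact (intervalIntegrable_iff_integrableOn_Ioc_of_le hy.1).1 (h1.mul_continuousOn h2.continuousOn)

lemma norm_integral_le_exp_mul {g : ℝ → ℂ} (hg : IntegrableOn g (Set.Ioc 0 1)) {lam : ℂ} {h : ℝ}
    (hl : |lam.im| ≤ h) {y : ℝ} (hy : y ∈ Set.Icc (0 : ℝ) 1) :
    ‖∫ t in (0 : ℝ)..y, g t * Complex.exp (Complex.I * lam * t)‖ ≤
      Real.exp h * ∫ t in Set.Ioc 0 1, ‖g t‖ := by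
  rw [intervalIntegral.integral_of_le hy.1, ← integral_const_mul]
  refine (norm_integral_le_integral_norm _).trans ?_
  have hi : IntegrableOn (fun t => Real.exp h * ‖g t‖) (Set.Ioc 0 1) := hg.norm.const_mul _
  refine (setIntegral_mono_on (integrableOn_mul_exp hg lam hy).norm
    (hi.mono_set (Set.Ioc_subset_Ioc_right hy.2)) measurableSet_Ioc fun t ht => ?_).trans
    (setIntegral_mono_set hi ?_ (Set.Ioc_subset_Ioc_right hy.2).eventuallyLE)
  · rw [norm_mul, mul_comm]
    exact mul_le_mul_of_nonneg_right (norm_exp_le hl ht.1.le (ht.2.trans hy.2)) (norm_nonneg _)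
  · exact Filter.Eventually.of_forall fun t => by positivity

lemma bddAbove_maxFourier {g : ℝ → ℂ} (hg : IntegrableOn g (Set.Ioc 0 1)) (lam : ℂ) :
    BddAbove (Set.range fun x : Set.Icc (0 : ℝ) 1 =>
      ‖∫ t in (0 : ℝ)..(x : ℝ), g t * Complex.exp (Complex.I * lam * t)‖) := by
  refine ⟨Real.exp |lam.im| * ∫ t in Set.Ioc 0 1, ‖g t‖, ?_⟩
  rintro _ ⟨x, rfl⟩
  exact norm_integral_le_exp_mul hg le_rfl x.2

instance : Nonempty (Set.Icc (0 : ℝ) 1) := ⟨⟨0, by simp⟩⟩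

lemma maxFourier_nonneg (g : ℝ → ℂ) (lam : ℂ) : 0 ≤ maxFourier g lam :=
  Real.iSup_nonneg fun _ => norm_nonneg _

lemma maxFourier_le_integral {g : ℝ → ℂ} (hg : IntegrableOn g (Set.Ioc 0 1)) {lam : ℂ} {h : ℝ}
    (hl : |lam.im| ≤ h) : maxFourier g lam ≤ Real.exp h * ∫ t in Set.Ioc 0 1, ‖g t‖ :=
  ciSup_le fun x => norm_integral_le_exp_mul hg hl x.2

lemma maxFourier_add_le {u v : ℝ → ℂ} (hu : IntegrableOn u (Set.Ioc 0 1))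
    (hv : IntegrableOn v (Set.Ioc 0 1)) (lam : ℂ) :
    maxFourier (fun t => u t + v t) lam ≤ maxFourier u lam + maxFourier v lam := by
  refine ciSup_le fun x => ?_
  simp only [add_mul]
  have hi : ∀ {w : ℝ → ℂ}, IntegrableOn w (Set.Ioc 0 1) → IntervalIntegrable
      (fun t => w t * Complex.exp (Complex.I * lam * t)) volume 0 x := fun hw =>
    (intervalIntegrable_iff_integrableOn_Ioc_of_le x.2.1).2 (integrableOn_mul_exp hw lam x.2)
  rw [intervalIntegral.integral_add (hi hu) (hi hv)]
  exact (norm_add_le _ _).trans (add_le_add (le_ciSup (bddAbove_maxFourier hu lam) x)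
    (le_ciSup (bddAbove_maxFourier hv lam) x))

/-- The nearest integer to `Re z / π`. -/
noncomputable def freq (z : ℂ) : ℤ := round (z.re / Real.pi)

lemma abs_re_sub_freq (z : ℂ) : |z.re - Real.pi * freq z| ≤ 2 := by
  have h1 := abs_sub_round (z.re / Real.pi)
  have hp := Real.pi_pos
  have e : z.re - Real.pi * freq z = Real.pi * (z.re / Real.pi - freq z) := by
    field_simp
  rw [e, abs_mul, abs_of_pos hp]
  have h2 : |z.re / Real.pi - freq z| ≤ 1 / 2 := h1
  nlinarith [Real.pi_lt_four]

lemma card_freq_le {d : ℕ} {μ : ℤ → ℂ} (hμ : Incompressible d μ) (F : Finset ℤ) (x : ℤ) :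
    (F.filter fun n => freq (μ n) = x).card ≤ 2 * d := by
  have hsub : ((F.filter fun n => freq (μ n) = x : Finset ℤ) : Set ℤ) ⊆
      {n | |(μ n).re - (Real.pi * x - 1)| ≤ 1} ∪ {n | |(μ n).re - (Real.pi * x + 1)| ≤ 1} := by
    intro n hn
    simp only [Finset.coe_filter, Set.mem_ofPred_eq] at hn
    have h1 := abs_re_sub_freq (μ n)
    rw [hn.2] at h1
    have h2 := abs_le.1 h1
    rcases le_total (μ n).re (Real.pi * x) with h3 | h3
    · left
      show |(μ n).re - (Real.pi * x - 1)| ≤ 1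
      rw [abs_le]
      constructor <;> linarith
    · right
      show |(μ n).re - (Real.pi * x + 1)| ≤ 1
      rw [abs_le]
      constructor <;> linarith
  have h1 := (Set.encard_le_encard hsub).trans ((Set.encard_union_le _ _).trans
    (add_le_add (hμ _) (hμ _)))
  rw [Set.encard_coe_eq_coe_finsetCard] at h1
  have h2 : ((F.filter fun n => freq (μ n) = x).card : ℕ∞) ≤ ((2 * d : ℕ) : ℕ∞) := by
    rw [two_mul]
    exact_mod_cast h1
  exact_mod_cast h2

lemma exists_maximizer {g : ℝ → ℂ} (hg : IntegrableOn g (Set.Ioc 0 1)) (x : ℤ) :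
    ∃ N ∈ Set.Icc (0 : ℝ) 1, ∀ y ∈ Set.Icc (0 : ℝ) 1,
      ‖∫ t in (0 : ℝ)..y, g t * ee (x * t)‖ ≤ ‖∫ t in (0 : ℝ)..N, g t * ee (x * t)‖ := by
  have hi : IntegrableOn (fun t => g t * ee (x * t)) (Set.Icc 0 1) := by
    rw [integrableOn_Icc_iff_integrableOn_Ioc]
    refine hg.mul_bdd (c := 1) ?_ (Filter.Eventually.of_forall fun t => (norm_ee _).le)
    exact Continuous.aestronglyMeasurable (by fun_prop)
  have hc := (intervalIntegral.continuousOn_primitive_interval (a := 0) (b := 1) (μ := volume)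
    (by rwa [Set.uIcc_of_le zero_le_one])).norm
  rw [Set.uIcc_of_le zero_le_one] at hc
  obtain ⟨N, hN, hm⟩ := isCompact_Icc.exists_isMaxOn ⟨0, by simp⟩ hc
  exact ⟨N, hN, fun y hy => hm hy⟩

lemma maxFourier_le_of_forall_le {g : ℝ → ℂ} (hg : IntegrableOn g (Set.Ioc 0 1)) {z : ℂ} {h S : ℝ}
    (hz : |z.im| ≤ h) (hS : ∀ y ∈ Set.Icc (0 : ℝ) 1,
      ‖∫ t in (0 : ℝ)..y, g t * ee (freq z * t)‖ ≤ S) :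
    maxFourier g z ≤ Real.exp h * (3 + h) * S := by
  set δ : ℂ := z - Real.pi * freq z with hδ
  have hS0 : 0 ≤ S := (norm_nonneg _).trans (hS 0 (by simp))
  have hre : δ.re = z.re - Real.pi * freq z := by simp [hδ]
  have him : δ.im = z.im := by simp [hδ]
  have hn : ‖δ‖ ≤ 2 + h := by
    refine (Complex.norm_le_abs_re_add_abs_im δ).trans ?_
    rw [hre, him]
    exact add_le_add (abs_re_sub_freq z) hz
  refine ciSup_le fun y => ?_
  have e : ∀ t : ℝ, g t * Complex.exp (Complex.I * z * t) =
      g t * ee (freq z * t) * Complex.exp (Complex.I * δ * t) := by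
    intro t
    rw [mul_assoc (g t), ee, ← Complex.exp_add]
    congr 2
    rw [hδ]
    push_cast
    ring
  simp only [e]
  have hi : IntegrableOn (fun t => g t * ee (freq z * t)) (Set.Ioc 0 y) := by
    refine (hg.mono_set (Set.Ioc_subset_Ioc_right y.2.2)).mul_bdd (c := 1) ?_
      (Filter.Eventually.of_forall fun t => (norm_ee _).le)
    exact Continuous.aestronglyMeasurable (by fun_prop)
  refine (norm_integral_mul_exp_le (h := h) (S := S) (him ▸ hz) y.2.1 y.2.2 hi
    fun s hs => hS s ⟨hs.1, hs.2.trans y.2.2⟩).trans ?_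
  refine mul_le_mul_of_nonneg_right (mul_le_mul_of_nonneg_left ?_ (Real.exp_pos h).le) hS0
  linarith

/-- The square-summability estimate for the maximal Fourier transform. -/
theorem exists_sum_maxFourier_sq_le {h : ℝ} (hh : 0 ≤ h) (d : ℕ) : ∃ C : ℝ, 0 ≤ C ∧
    ∀ μ : ℤ → ℂ, Incompressible d μ → (∀ n, |(μ n).im| ≤ h) → ∀ g : ℝ → ℂ, Measurable g →
    IntegrableOn (fun t => ‖g t‖ ^ 2) (Set.Ioc 0 1) → ∀ F : Finset ℤ,
    ∑ n ∈ F, maxFourier g (μ n) ^ 2 ≤ C * ∫ t in Set.Ioc 0 1, ‖g t‖ ^ 2 := by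
  obtain ⟨C, hC, hb⟩ := exists_interval_bound
  refine ⟨(Real.exp h * (3 + h)) ^ 2 * (2 * d) * C, by positivity, fun μ hμ hs g hgm hg F => ?_⟩
  have hL : MemLp g 2 (volume.restrict (Set.Ioc 0 1)) := by
    rw [memLp_two_iff_integrable_sq_norm hgm.aestronglyMeasurable]
    exact hg
  have hgi : IntegrableOn g (Set.Ioc 0 1) := hL.integrable (by norm_num)
  choose N hN hmax using exists_maximizer hgi
  set G := (Set.Ioc (0 : ℝ) 1).indicator g with hG
  have hGL : MemLp G 2 volume := (memLp_indicator_iff_restrict measurableSet_Ioc).2 hL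
  have eG : ∀ x : ℤ, ∫ t in (0 : ℝ)..N x, G t * ee (x * t) =
      ∫ t in (0 : ℝ)..N x, g t * ee (x * t) := by
    intro x
    rw [intervalIntegral.integral_of_le (hN x).1, intervalIntegral.integral_of_le (hN x).1]
    refine setIntegral_congr_fun measurableSet_Ioc fun t ht => ?_
    have ht' : t ∈ Set.Ioc (0 : ℝ) 1 := ⟨ht.1, ht.2.trans (hN x).2⟩
    simp only [hG, Set.indicator_of_mem ht']
  have eI : ∫ t, ‖G t‖ ^ 2 = ∫ t in Set.Ioc 0 1, ‖g t‖ ^ 2 := by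
    rw [← integral_indicator measurableSet_Ioc]
    refine integral_congr_ae (Filter.Eventually.of_forall fun t => ?_)
    by_cases ht : t ∈ Set.Ioc (0 : ℝ) 1
    · simp [hG, Set.indicator_of_mem ht]
    · simp [hG, Set.indicator_of_notMem ht]
  set A : ℤ → ℝ := fun x => ‖∫ t in (0 : ℝ)..N x, g t * ee (x * t)‖ ^ 2 with hA
  have h1 : ∑ x ∈ F.image (fun n => freq (μ n)), A x ≤ C * ∫ t in Set.Ioc 0 1, ‖g t‖ ^ 2 := by
    have := hb G hGL (F.image fun n => freq (μ n)) N hN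
    rw [eI] at this
    simpa only [eG] using this
  have h2 : ∑ n ∈ F, A (freq (μ n)) ≤ (2 * d) * ∑ x ∈ F.image (fun n => freq (μ n)), A x := by
    rw [← Finset.sum_fiberwise_of_maps_to (t := F.image fun n => freq (μ n))
      (g := fun n => freq (μ n)) (fun n hn => Finset.mem_image_of_mem _ hn), Finset.mul_sum]
    refine Finset.sum_le_sum fun x _ => ?_
    rw [Finset.sum_congr rfl (g := fun _ => A x) fun n hn => by
      rw [(Finset.mem_filter.1 hn).2], Finset.sum_const, nsmul_eq_mul]
    refine mul_le_mul_of_nonneg_right ?_ (sq_nonneg _)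
    exact_mod_cast card_freq_le hμ F x
  calc ∑ n ∈ F, maxFourier g (μ n) ^ 2
      ≤ ∑ n ∈ F, (Real.exp h * (3 + h)) ^ 2 * A (freq (μ n)) := by
        refine Finset.sum_le_sum fun n _ => ?_
        simp only [hA]
        rw [← mul_pow]
        exact pow_le_pow_left₀ (maxFourier_nonneg _ _)
          (maxFourier_le_of_forall_le hgi (hs n) (hmax _)) 2
    _ = (Real.exp h * (3 + h)) ^ 2 * ∑ n ∈ F, A (freq (μ n)) := by rw [Finset.mul_sum]
    _ ≤ (Real.exp h * (3 + h)) ^ 2 * ((2 * d) * (C * ∫ t in Set.Ioc 0 1, ‖g t‖ ^ 2)) := by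
        gcongr
        exact h2.trans (mul_le_mul_of_nonneg_left h1 (by positivity))
    _ = _ := by ring

lemma sum_inv_sq_tail_le {R : ℝ} (hR : 0 < R) (F : Finset ℤ) (hF : ∀ n ∈ F, R < 1 + |(n : ℝ)|) :
    ∑ n ∈ F, ((1 + |(n : ℝ)|) ^ 2)⁻¹ ≤ 4 / R := by
  have e : ∀ n : ℤ, 1 + |(n : ℝ)| = ((n.natAbs + 1 : ℕ) : ℝ) := by
    intro n
    push_cast [Nat.cast_natAbs]
    ring
  simp only [e] at hF ⊢
  set S := F.image fun n => n.natAbs + 1 with hS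
  have h1 : ∑ n ∈ F, (((n.natAbs + 1 : ℕ) : ℝ) ^ 2)⁻¹ ≤ ∑ i ∈ S, 2 * ((i : ℝ) ^ 2)⁻¹ := by
    rw [← Finset.sum_fiberwise_of_maps_to (t := S) (g := fun n => n.natAbs + 1)
      (fun n hn => Finset.mem_image_of_mem _ hn)]
    refine Finset.sum_le_sum fun i _ => ?_
    rw [Finset.sum_congr rfl (g := fun _ => ((i : ℝ) ^ 2)⁻¹) fun n hn => by
      rw [(Finset.mem_filter.1 hn).2], Finset.sum_const, nsmul_eq_mul]
    refine mul_le_mul_of_nonneg_right ?_ (by positivity)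
    have hsub : (F.filter fun n => n.natAbs + 1 = i) ⊆ {((i : ℤ) - 1), -((i : ℤ) - 1)} := by
      intro n hn
      have := (Finset.mem_filter.1 hn).2
      simp only [Finset.mem_insert, Finset.mem_singleton]
      omega
    exact_mod_cast (Finset.card_le_card hsub).trans Finset.card_le_two
  have hsub : S ⊆ Finset.Ioo ⌊R⌋₊ (S.sup id + 1) := by
    intro i hi
    rw [Finset.mem_Ioo]
    refine ⟨?_, Nat.lt_succ_of_le (Finset.le_sup (f := id) hi)⟩
    obtain ⟨n, hn, rfl⟩ := Finset.mem_image.1 hi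
    exact (Nat.floor_lt hR.le).2 (hF n hn)
  have h2 : ∑ i ∈ S, ((i : ℝ) ^ 2)⁻¹ ≤ 2 / (⌊R⌋₊ + 1) :=
    (Finset.sum_le_sum_of_subset_of_nonneg hsub fun i _ _ => by positivity).trans
      (sum_Ioo_inv_sq_le _ _)
  have h3 : (2 : ℝ) / (⌊R⌋₊ + 1) ≤ 2 / R :=
    div_le_div_of_nonneg_left (by norm_num) hR (Nat.lt_floor_add_one R).le
  rw [← Finset.mul_sum] at h1
  calc _ ≤ _ := h1
    _ ≤ 2 * (2 / R) := by linarith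
    _ = 4 / R := by ring

lemma sum_pow_toNat_le {r : ℝ} (h0 : 0 ≤ r) (h1 : r < 1) {ι : Type*} (J : Finset ι) (k : ι → ℕ)
    (hk : Set.InjOn k J) : ∑ j ∈ J, r ^ k j ≤ (1 - r)⁻¹ := by
  rw [← Finset.sum_image (g := k) (f := fun i => r ^ i) hk, ← tsum_geometric_of_lt_one h0 h1]
  exact (summable_geometric_of_lt_one h0 h1).sum_le_tsum _ fun i _ => pow_nonneg h0 i

lemma zpow_rpow_add_nat (a : ℤ) (k : ℕ) (s : ℝ) :
    ((2 : ℝ) ^ (a + k)) ^ s = ((2 : ℝ) ^ a) ^ s * ((2 : ℝ) ^ s) ^ k := by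
  rw [zpow_add₀ two_ne_zero, Real.mul_rpow (by positivity) (by positivity), zpow_natCast,
    ← Real.rpow_natCast, ← Real.rpow_natCast, ← Real.rpow_mul two_pos.le,
    ← Real.rpow_mul two_pos.le, mul_comm s]

/-- The pointwise summation over dyadic heights in the interpolation argument. -/
lemma sum_dyadic_le {p : ℝ} (hp1 : 1 < p) (hp2 : p < 2) (J : Finset ℤ) {t : ℝ} (ht : 0 ≤ t) :
    ∑ j ∈ J, ((2 : ℝ) ^ j) ^ p * ((((2 : ℝ) ^ j) ^ 2)⁻¹ * (if t ≤ (2 : ℝ) ^ j then t ^ 2 else 0) +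
      ((2 : ℝ) ^ j)⁻¹ * (if t ≤ (2 : ℝ) ^ j then 0 else t)) ≤
    ((1 - (2 : ℝ) ^ (p - 2))⁻¹ + (1 - (2 : ℝ) ^ (1 - p))⁻¹) * t ^ p := by
  have hr : (2 : ℝ) ^ (p - 2) < 1 := Real.rpow_lt_one_of_one_lt_of_neg (by norm_num) (by linarith)
  have hr' : (2 : ℝ) ^ (1 - p) < 1 := Real.rpow_lt_one_of_one_lt_of_neg (by norm_num) (by linarith)
  rcases ht.eq_or_lt with rfl | ht
  · rw [Real.zero_rpow (by linarith), mul_zero]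
    refine (Finset.sum_eq_zero fun j _ => ?_).le
    simp
  obtain ⟨m, hm1, hm2⟩ := exists_mem_Ioc_zpow ht (one_lt_two (α := ℝ))
  have e1 : ∀ j : ℤ, ((2 : ℝ) ^ j) ^ p * ((((2 : ℝ) ^ j) ^ 2)⁻¹ *
      (if t ≤ (2 : ℝ) ^ j then t ^ 2 else 0) + ((2 : ℝ) ^ j)⁻¹ *
      (if t ≤ (2 : ℝ) ^ j then 0 else t)) =
      if t ≤ (2 : ℝ) ^ j then ((2 : ℝ) ^ j) ^ (p - 2) * t ^ 2 else ((2 : ℝ) ^ j) ^ (p - 1) * t := by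
    intro j
    have hpos : (0 : ℝ) < 2 ^ j := by positivity
    split_ifs
    · rw [Real.rpow_sub hpos, Real.rpow_two]
      field_simp
      ring
    · rw [Real.rpow_sub hpos, Real.rpow_one]
      field_simp
      ring
  simp only [e1]
  rw [Finset.sum_ite, add_mul]
  refine add_le_add ?_ ?_
  · have hj : ∀ j ∈ J.filter (fun j => t ≤ (2 : ℝ) ^ j), m + 1 ≤ j := by
      intro j hj
      have h1 := hm1.trans_le (Finset.mem_filter.1 hj).2
      have := (zpow_lt_zpow_iff_right₀ (one_lt_two (α := ℝ))).1 h1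
      omega
    have hb : ∀ j ∈ J.filter (fun j => t ≤ (2 : ℝ) ^ j), ((2 : ℝ) ^ j) ^ (p - 2) * t ^ 2 ≤
        ((2 : ℝ) ^ (p - 2)) ^ (j - (m + 1)).toNat * t ^ p := by
      intro j hjm
      have h1 := hj j hjm
      have e : j = (m + 1) + ((j - (m + 1)).toNat : ℤ) := by omega
      have h2 : ((2 : ℝ) ^ (m + 1)) ^ (p - 2) ≤ t ^ (p - 2) :=
        Real.rpow_le_rpow_of_nonpos ht hm2 (by linarith)
      have h3 : t ^ p = t ^ (p - 2) * t ^ 2 := by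
        rw [← Real.rpow_two, ← Real.rpow_add ht]
        congr 1
        ring
      calc ((2 : ℝ) ^ j) ^ (p - 2) * t ^ 2
          = ((2 : ℝ) ^ (m + 1)) ^ (p - 2) * ((2 : ℝ) ^ (p - 2)) ^ (j - (m + 1)).toNat * t ^ 2 := by
            rw [← zpow_rpow_add_nat, ← e]
        _ ≤ t ^ (p - 2) * ((2 : ℝ) ^ (p - 2)) ^ (j - (m + 1)).toNat * t ^ 2 := by gcongr
        _ = _ := by rw [h3]; ring
    refine (Finset.sum_le_sum hb).trans ?_
    rw [← Finset.sum_mul]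
    refine mul_le_mul_of_nonneg_right ?_ (by positivity)
    refine sum_pow_toNat_le (by positivity) hr _ _ fun i hi j hj' hij => ?_
    have h1 := hj i hi
    have h2 := hj j hj'
    omega
  · have hj : ∀ j ∈ J.filter (fun j => ¬ t ≤ (2 : ℝ) ^ j), j ≤ m := by
      intro j hj
      have h1 := (not_le.1 (Finset.mem_filter.1 hj).2).trans_le hm2
      have := (zpow_lt_zpow_iff_right₀ (one_lt_two (α := ℝ))).1 h1
      omega
    have hb : ∀ j ∈ J.filter (fun j => ¬ t ≤ (2 : ℝ) ^ j), ((2 : ℝ) ^ j) ^ (p - 1) * t ≤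
        ((2 : ℝ) ^ (1 - p)) ^ (m - j).toNat * t ^ p := by
      intro j hjm
      have h1 := hj j hjm
      have e : m = j + ((m - j).toNat : ℤ) := by omega
      have h2 : ((2 : ℝ) ^ m) ^ (p - 1) ≤ t ^ (p - 1) :=
        Real.rpow_le_rpow (by positivity) hm1.le (by linarith)
      have h3 : t ^ p = t ^ (p - 1) * t := by
        nth_rewrite 3 [← Real.rpow_one t]
        rw [← Real.rpow_add ht]
        congr 1
        ring
      have h4 : ((2 : ℝ) ^ (1 - p)) ^ (m - j).toNat * ((2 : ℝ) ^ (p - 1)) ^ (m - j).toNat = 1 := by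
        rw [← mul_pow, ← Real.rpow_add two_pos]
        simp
      have h5 := zpow_rpow_add_nat j (m - j).toNat (p - 1)
      rw [← e] at h5
      calc ((2 : ℝ) ^ j) ^ (p - 1) * t
          = ((2 : ℝ) ^ (1 - p)) ^ (m - j).toNat * (((2 : ℝ) ^ j) ^ (p - 1) *
            ((2 : ℝ) ^ (p - 1)) ^ (m - j).toNat) * t := by
            linear_combination (-((2 : ℝ) ^ j) ^ (p - 1) * t) * h4
        _ ≤ ((2 : ℝ) ^ (1 - p)) ^ (m - j).toNat * t ^ (p - 1) * t := by
            rw [← h5]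
            gcongr
        _ = _ := by rw [h3]; ring
    refine (Finset.sum_le_sum hb).trans ?_
    rw [← Finset.sum_mul]
    refine mul_le_mul_of_nonneg_right ?_ (by positivity)
    refine sum_pow_toNat_le (by positivity) hr' _ _ fun i hi j hj' hij => ?_
    have h1 := hj i hi
    have h2 := hj j hj'
    omega

/-- The distributional estimate at height `l`. -/
lemma sum_height_le {h K l : ℝ} (hl : 0 < l) (hK : 0 ≤ K) {μ : ℤ → ℂ} (hs : ∀ n, |(μ n).im| ≤ h)
    (F : Finset ℤ)
    (hK2 : ∀ u : ℝ → ℂ, Measurable u → IntegrableOn (fun t => ‖u t‖ ^ 2) (Set.Ioc 0 1) →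
      ∀ E : Finset ℤ, ∑ n ∈ E, maxFourier u (μ n) ^ 2 ≤ K * ∫ t in Set.Ioc 0 1, ‖u t‖ ^ 2)
    {g : ℝ → ℂ} (hgm : Measurable g) (hg : IntegrableOn g (Set.Ioc 0 1)) :
    ∑ n ∈ F.filter (fun n : ℤ => l < (1 + |(n : ℝ)|) * maxFourier g (μ n)),
      ((1 + |(n : ℝ)|) ^ 2)⁻¹ ≤
    (4 * K + 8 * Real.exp h) *
      ((l ^ 2)⁻¹ * (∫ t in Set.Ioc 0 1, if ‖g t‖ ≤ l then ‖g t‖ ^ 2 else 0) +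
        l⁻¹ * ∫ t in Set.Ioc 0 1, if ‖g t‖ ≤ l then 0 else ‖g t‖) := by
  set u : ℝ → ℂ := fun t => if ‖g t‖ ≤ l then g t else 0 with hu
  set v : ℝ → ℂ := fun t => if ‖g t‖ ≤ l then 0 else g t with hv
  have hset : MeasurableSet {t | ‖g t‖ ≤ l} := measurableSet_le hgm.norm measurable_const
  have hum : Measurable u := Measurable.ite hset hgm measurable_const
  have hvm : Measurable v := Measurable.ite hset measurable_const hgm
  have hui : IntegrableOn u (Set.Ioc 0 1) := by
    refine Integrable.mono hg hum.aestronglyMeasurable (Filter.Eventually.of_forall fun t => ?_)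
    simp only [hu]
    split_ifs <;> simp
  have hvi : IntegrableOn v (Set.Ioc 0 1) := by
    refine Integrable.mono hg hvm.aestronglyMeasurable (Filter.Eventually.of_forall fun t => ?_)
    simp only [hv]
    split_ifs <;> simp
  have hu2 : IntegrableOn (fun t => ‖u t‖ ^ 2) (Set.Ioc 0 1) := by
    refine Measure.integrableOn_of_bounded (M := l ^ 2) (by simp)
      (hum.norm.pow_const 2).aestronglyMeasurable (Filter.Eventually.of_forall fun t => ?_)
    rw [Real.norm_of_nonneg (by positivity)]
    refine pow_le_pow_left₀ (norm_nonneg _) ?_ 2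
    simp only [hu]
    split_ifs with h1
    · exact h1
    · simpa using hl.le
  have eu : ∀ t, ‖u t‖ ^ 2 = if ‖g t‖ ≤ l then ‖g t‖ ^ 2 else 0 := fun t => by
    simp only [hu]
    split_ifs <;> simp
  have ev : ∀ t, ‖v t‖ = if ‖g t‖ ≤ l then 0 else ‖g t‖ := fun t => by
    simp only [hv]
    split_ifs <;> simp
  have eg : g = fun t => u t + v t := by
    funext t
    simp only [hu, hv]
    split_ifs <;> simp
  simp only [← eu, ← ev]
  set U := ∫ t in Set.Ioc 0 1, ‖u t‖ ^ 2 with hU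
  set V := ∫ t in Set.Ioc 0 1, ‖v t‖ with hV
  have hU0 : 0 ≤ U := integral_nonneg fun t => by positivity
  have hV0 : 0 ≤ V := integral_nonneg fun t => by positivity
  set P := F.filter (fun n : ℤ => l / 2 < (1 + |(n : ℝ)|) * maxFourier u (μ n)) with hP
  set Q := F.filter (fun n : ℤ => l / 2 < (1 + |(n : ℝ)|) * maxFourier v (μ n)) with hQ
  have hsub : F.filter (fun n : ℤ => l < (1 + |(n : ℝ)|) * maxFourier g (μ n)) ⊆ P ∪ Q := by
    intro n hn
    rw [Finset.mem_filter] at hn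
    rw [Finset.mem_union, hP, hQ, Finset.mem_filter, Finset.mem_filter]
    by_contra hc
    rw [not_or, not_and, not_and, not_lt, not_lt] at hc
    have h1 := hc.1 hn.1
    have h2 := hc.2 hn.1
    have h3 := maxFourier_add_le hui hvi (μ n)
    rw [← eg] at h3
    have h4 := mul_le_mul_of_nonneg_left h3 (show (0 : ℝ) ≤ 1 + |(n : ℝ)| by positivity)
    linarith [hn.2]
  have hPb : ∑ n ∈ P, ((1 + |(n : ℝ)|) ^ 2)⁻¹ ≤ 4 * K * ((l ^ 2)⁻¹ * U) := by
    calc ∑ n ∈ P, ((1 + |(n : ℝ)|) ^ 2)⁻¹ ≤ ∑ n ∈ P, 4 * (l ^ 2)⁻¹ * maxFourier u (μ n) ^ 2 := by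
          refine Finset.sum_le_sum fun n hn => ?_
          have h1 := (Finset.mem_filter.1 hn).2
          have h2 : (l / 2) ^ 2 ≤ ((1 + |(n : ℝ)|) * maxFourier u (μ n)) ^ 2 :=
            pow_le_pow_left₀ (by positivity) h1.le 2
          have h3 : (0 : ℝ) < 1 + |(n : ℝ)| := by positivity
          rw [inv_le_iff_one_le_mul₀ (by positivity)]
          rw [mul_pow] at h2
          have h4 : 4 * (l ^ 2)⁻¹ * (l / 2) ^ 2 = 1 := by
            field_simp
            ring
          have h5 := mul_le_mul_of_nonneg_left h2 (show 0 ≤ 4 * (l ^ 2)⁻¹ by positivity)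
          linarith
      _ = 4 * (l ^ 2)⁻¹ * ∑ n ∈ P, maxFourier u (μ n) ^ 2 := by rw [Finset.mul_sum]
      _ ≤ 4 * (l ^ 2)⁻¹ * (K * U) := by
          gcongr
          exact hK2 u hum hu2 P
      _ = _ := by ring
  have hQb : ∑ n ∈ Q, ((1 + |(n : ℝ)|) ^ 2)⁻¹ ≤ 8 * Real.exp h * (l⁻¹ * V) := by
    have hq : ∀ n ∈ Q, l / 2 < (1 + |(n : ℝ)|) * (Real.exp h * V) := by
      intro n hn
      refine (Finset.mem_filter.1 hn).2.trans_le ?_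
      exact mul_le_mul_of_nonneg_left (maxFourier_le_integral hvi (hs n)) (by positivity)
    rcases hV0.eq_or_lt with h0 | h0
    · have : Q = ∅ := by
        refine Finset.eq_empty_of_forall_notMem fun n hn => ?_
        have := hq n hn
        rw [← h0] at this
        simp only [mul_zero] at this
        linarith
      rw [this, Finset.sum_empty]
      positivity
    · have hM : 0 < Real.exp h * V := by positivity
      refine (sum_inv_sq_tail_le (R := l / 2 / (Real.exp h * V)) (by positivity) Q
        fun n hn => (div_lt_iff₀ hM).2 (hq n hn)).trans_eq ?_
      field_simp
      ring
  have h1 : ∑ n ∈ F.filter (fun n : ℤ => l < (1 + |(n : ℝ)|) * maxFourier g (μ n)),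
      ((1 + |(n : ℝ)|) ^ 2)⁻¹ ≤
      ∑ n ∈ P, ((1 + |(n : ℝ)|) ^ 2)⁻¹ + ∑ n ∈ Q, ((1 + |(n : ℝ)|) ^ 2)⁻¹ := by
    refine (Finset.sum_le_sum_of_subset_of_nonneg hsub fun i _ _ => by positivity).trans ?_
    rw [← Finset.sum_union_inter]
    exact le_add_of_nonneg_right (Finset.sum_nonneg fun i _ => by positivity)
  refine h1.trans ((add_le_add hPb hQb).trans ?_)
  have hA : 0 ≤ (l ^ 2)⁻¹ * U := by positivity
  have hB : 0 ≤ l⁻¹ * V := by positivity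
  have := Real.exp_pos h
  nlinarith [mul_nonneg hK hB, mul_nonneg this.le hA]

lemma integrableOn_of_rpow {p : ℝ} (hp : 1 ≤ p) {g : ℝ → ℂ} (hgm : Measurable g)
    (hg : IntegrableOn (fun t => ‖g t‖ ^ p) (Set.Ioc 0 1)) : IntegrableOn g (Set.Ioc 0 1) := by
  have h1 : IntegrableOn (fun t => 1 + ‖g t‖ ^ p) (Set.Ioc 0 1) :=
    (integrableOn_const (by simp)).add hg
  refine Integrable.mono h1 hgm.aestronglyMeasurable (Filter.Eventually.of_forall fun t => ?_)
  have h2 : (0 : ℝ) ≤ ‖g t‖ ^ p := by positivity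
  rw [Real.norm_of_nonneg (by positivity)]
  rcases le_total ‖g t‖ 1 with h3 | h3
  · linarith
  · linarith [Real.self_le_rpow_of_one_le h3 hp]

/-- The weighted inequality below the exponent `2`, by interpolation. -/
theorem sum_weighted_rpow_le {p h K : ℝ} (hp1 : 1 < p) (hp2 : p < 2) (hK : 0 ≤ K) {μ : ℤ → ℂ}
    (hs : ∀ n, |(μ n).im| ≤ h)
    (hK2 : ∀ u : ℝ → ℂ, Measurable u → IntegrableOn (fun t => ‖u t‖ ^ 2) (Set.Ioc 0 1) →
      ∀ E : Finset ℤ, ∑ n ∈ E, maxFourier u (μ n) ^ 2 ≤ K * ∫ t in Set.Ioc 0 1, ‖u t‖ ^ 2)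
    {g : ℝ → ℂ} (hgm : Measurable g) (hg : IntegrableOn (fun t => ‖g t‖ ^ p) (Set.Ioc 0 1))
    (F : Finset ℤ) :
    ∑ n ∈ F, (1 + |(n : ℝ)|) ^ (p - 2) * maxFourier g (μ n) ^ p ≤
      2 ^ p * ((4 * K + 8 * Real.exp h) *
        ((1 - (2 : ℝ) ^ (p - 2))⁻¹ + (1 - (2 : ℝ) ^ (1 - p))⁻¹)) *
          ∫ t in Set.Ioc 0 1, ‖g t‖ ^ p := by
  have hgi := integrableOn_of_rpow hp1.le hgm hg
  set b : ℤ → ℝ := fun n => (1 + |(n : ℝ)|) * maxFourier g (μ n) with hb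
  have hb0 : ∀ n, 0 ≤ b n := fun n => mul_nonneg (by positivity) (maxFourier_nonneg _ _)
  have hj : ∀ n, ∃ j : ℤ, 0 < b n → (2 : ℝ) ^ j < b n ∧ b n ≤ 2 ^ (j + 1) := by
    intro n
    by_cases h0 : 0 < b n
    · obtain ⟨j, hj⟩ := exists_mem_Ioc_zpow h0 (one_lt_two (α := ℝ))
      exact ⟨j, fun _ => hj⟩
    · exact ⟨0, fun h1 => absurd h1 h0⟩
  choose j hj using hj
  set J := F.image j with hJ
  set w : ℤ → ℝ := fun n => ((1 + |(n : ℝ)|) ^ 2)⁻¹ with hw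
  have hw0 : ∀ n, 0 ≤ w n := fun n => by positivity
  have e1 : ∀ n : ℤ, (1 + |(n : ℝ)|) ^ (p - 2) * maxFourier g (μ n) ^ p = w n * b n ^ p := by
    intro n
    have h3 : (0 : ℝ) < 1 + |(n : ℝ)| := by positivity
    simp only [hw, hb]
    rw [Real.mul_rpow h3.le (maxFourier_nonneg _ _), Real.rpow_sub h3, Real.rpow_two]
    field_simp
  have h1 : ∑ n ∈ F, w n * b n ^ p ≤
      ∑ i ∈ J, 2 ^ p * ((2 : ℝ) ^ i) ^ p * ∑ n ∈ F.filter (fun n => (2 : ℝ) ^ i < b n), w n := by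
    rw [← Finset.sum_fiberwise_of_maps_to (t := J) (g := j)
      (fun n hn => Finset.mem_image_of_mem _ hn)]
    refine Finset.sum_le_sum fun i _ => ?_
    rw [Finset.mul_sum, Finset.sum_filter, Finset.sum_filter]
    refine Finset.sum_le_sum fun n _ => ?_
    split_ifs with h2 h3 h3
    · have h4 := (hj n ((by positivity : (0 : ℝ) < 2 ^ i).trans h3)).2
      rw [h2, zpow_add_one₀ two_ne_zero] at h4
      have h5 : b n ^ p ≤ 2 ^ p * ((2 : ℝ) ^ i) ^ p := by
        rw [← Real.mul_rpow (by norm_num) (by positivity), mul_comm (2 : ℝ)]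
        exact Real.rpow_le_rpow (hb0 n) h4 (by linarith)
      rw [mul_comm]
      exact mul_le_mul_of_nonneg_right h5 (hw0 n)
    · rcases (hb0 n).eq_or_lt with h4 | h4
      · rw [← h4, Real.zero_rpow (by linarith), mul_zero]
      · exact absurd (h2 ▸ (hj n h4).1) h3
    · have := hw0 n
      positivity
    · exact le_rfl
  set A : ℤ → ℝ → ℝ := fun i t => if ‖g t‖ ≤ (2 : ℝ) ^ i then ‖g t‖ ^ 2 else 0 with hA
  set B : ℤ → ℝ → ℝ := fun i t => if ‖g t‖ ≤ (2 : ℝ) ^ i then 0 else ‖g t‖ with hB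
  set c := 4 * K + 8 * Real.exp h with hc
  have hc0 : 0 ≤ c := by positivity
  have hset : ∀ i : ℤ, MeasurableSet {t | ‖g t‖ ≤ (2 : ℝ) ^ i} := fun i =>
    measurableSet_le hgm.norm measurable_const
  have hAi : ∀ i, IntegrableOn (A i) (Set.Ioc 0 1) := by
    intro i
    refine Measure.integrableOn_of_bounded (M := ((2 : ℝ) ^ i) ^ 2) (by simp)
      (Measurable.ite (hset i) (hgm.norm.pow_const 2) measurable_const).aestronglyMeasurable
      (Filter.Eventually.of_forall fun t => ?_)
    simp only [hA]
    split_ifs with h2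
    · rw [Real.norm_of_nonneg (by positivity)]
      exact pow_le_pow_left₀ (norm_nonneg _) h2 2
    · rw [norm_zero]
      positivity
  have hBi : ∀ i, IntegrableOn (B i) (Set.Ioc 0 1) := by
    intro i
    refine Integrable.mono hgi.norm
      (Measurable.ite (hset i) measurable_const hgm.norm).aestronglyMeasurable
      (Filter.Eventually.of_forall fun t => ?_)
    simp only [hB]
    split_ifs <;> simp
  have hi : ∀ i ∈ J, IntegrableOn (fun t => ((2 : ℝ) ^ i) ^ p * ((((2 : ℝ) ^ i) ^ 2)⁻¹ * A i t +
      ((2 : ℝ) ^ i)⁻¹ * B i t)) (Set.Ioc 0 1) := fun i _ =>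
    (((hAi i).const_mul _).add ((hBi i).const_mul _)).const_mul _
  have h2 : ∑ i ∈ J, ((2 : ℝ) ^ i) ^ p * ((((2 : ℝ) ^ i) ^ 2)⁻¹ * (∫ t in Set.Ioc 0 1, A i t) +
      ((2 : ℝ) ^ i)⁻¹ * ∫ t in Set.Ioc 0 1, B i t) ≤
      ((1 - (2 : ℝ) ^ (p - 2))⁻¹ + (1 - (2 : ℝ) ^ (1 - p))⁻¹) *
        ∫ t in Set.Ioc 0 1, ‖g t‖ ^ p := by
    have e : ∀ i : ℤ, ((2 : ℝ) ^ i) ^ p * ((((2 : ℝ) ^ i) ^ 2)⁻¹ * (∫ t in Set.Ioc 0 1, A i t) +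
        ((2 : ℝ) ^ i)⁻¹ * ∫ t in Set.Ioc 0 1, B i t) =
        ∫ t in Set.Ioc 0 1, ((2 : ℝ) ^ i) ^ p * ((((2 : ℝ) ^ i) ^ 2)⁻¹ * A i t +
          ((2 : ℝ) ^ i)⁻¹ * B i t) := by
      intro i
      rw [integral_const_mul, integral_add ((hAi i).const_mul _) ((hBi i).const_mul _),
        integral_const_mul, integral_const_mul]
    simp only [e]
    rw [← integral_finsetSum _ hi, ← integral_const_mul]
    exact integral_mono (integrable_finsetSum _ hi) (hg.const_mul _) fun t =>
      sum_dyadic_le hp1 hp2 J (norm_nonneg (g t))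
  simp only [e1]
  calc ∑ n ∈ F, w n * b n ^ p ≤ _ := h1
    _ ≤ ∑ i ∈ J, 2 ^ p * ((2 : ℝ) ^ i) ^ p * (c * ((((2 : ℝ) ^ i) ^ 2)⁻¹ *
        (∫ t in Set.Ioc 0 1, A i t) + ((2 : ℝ) ^ i)⁻¹ * ∫ t in Set.Ioc 0 1, B i t)) := by
        refine Finset.sum_le_sum fun i _ => mul_le_mul_of_nonneg_left ?_ (by positivity)
        exact sum_height_le (by positivity) hK hs F hK2 hgm hgi
    _ = 2 ^ p * c * ∑ i ∈ J, ((2 : ℝ) ^ i) ^ p * ((((2 : ℝ) ^ i) ^ 2)⁻¹ *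
        (∫ t in Set.Ioc 0 1, A i t) + ((2 : ℝ) ^ i)⁻¹ * ∫ t in Set.Ioc 0 1, B i t) := by
        rw [Finset.mul_sum]
        refine Finset.sum_congr rfl fun i _ => ?_
        ring
    _ ≤ 2 ^ p * c * _ := mul_le_mul_of_nonneg_left h2 (by positivity)
    _ = _ := by ring

end MaxFourier

/-- For `p ∈ (1,2]`, `h ≥ 0` and `d ∈ ℕ` there is `C = C(p,h,d) > 0` such that for every
incompressible sequence `μ` of density `d` lying in the strip `Π_h` and every `g ∈ L^p[0,1]`,
`∑_{n∈ℤ} (1+|n|)^{p-2} (𝓕[g](μ_n))^{p} ≤ C ‖g‖_p^{p}`. -/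
theorem stmt4 (p : ℝ) (hp1 : 1 < p) (hp2 : p ≤ 2) (h : ℝ) (hh : 0 ≤ h) (d : ℕ) :
    ∃ C : ℝ, 0 < C ∧ ∀ μ : ℤ → ℂ, Incompressible d μ → (∀ n : ℤ, |(μ n).im| ≤ h) →
      ∀ g : ℝ → ℂ, Measurable g →
      IntervalIntegrable (fun t => ‖g t‖ ^ p) volume 0 1 →
      ∀ F : Finset ℤ, ∑ n ∈ F, (1 + |(n : ℝ)|) ^ (p - 2) * maxFourier g (μ n) ^ p ≤
        C * lpNorm01 p g ^ p := by
  obtain ⟨K, hK, hb⟩ := MaxFourier.exists_sum_maxFourier_sq_le hh d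
  have hnorm : ∀ g : ℝ → ℂ, lpNorm01 p g ^ p = ∫ t in Set.Ioc 0 1, ‖g t‖ ^ p := by
    intro g
    rw [lpNorm01, intervalIntegral.integral_of_le zero_le_one, ← Real.rpow_mul
      (integral_nonneg fun t => by positivity), one_div_mul_cancel (by linarith), Real.rpow_one]
  simp only [hnorm]
  rcases hp2.eq_or_lt with rfl | hp2
  · refine ⟨K + 1, by positivity, fun μ hμ hs g hgm hg F => ?_⟩
    rw [intervalIntegrable_iff_integrableOn_Ioc_of_le zero_le_one] at hg
    simp only [Real.rpow_two, sub_self, Real.rpow_zero, one_mul] at hg ⊢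
    refine (hb μ hμ hs g hgm hg F).trans (mul_le_mul_of_nonneg_right (by linarith) ?_)
    exact integral_nonneg fun t => by positivity
  · set C := 2 ^ p * ((4 * K + 8 * Real.exp h) *
        ((1 - (2 : ℝ) ^ (p - 2))⁻¹ + (1 - (2 : ℝ) ^ (1 - p))⁻¹)) with hC
    have h1 : 0 < 1 - (2 : ℝ) ^ (p - 2) :=
      sub_pos.2 (Real.rpow_lt_one_of_one_lt_of_neg (by norm_num) (by linarith))
    have h2 : 0 < 1 - (2 : ℝ) ^ (1 - p) :=
      sub_pos.2 (Real.rpow_lt_one_of_one_lt_of_neg (by norm_num) (by linarith))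
    refine ⟨C, by positivity, fun μ hμ hs g hgm hg F => ?_⟩
    rw [intervalIntegrable_iff_integrableOn_Ioc_of_le zero_le_one] at hg
    exact MaxFourier.sum_weighted_rpow_le hp1 hp2 hK hs (hb μ hμ hs) hgm hg F
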